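/- arXiv:1706.08937 — 7 statements merged into one kernel-verified Lean document; each statement's English description precedes it below -/
import Mathlib

section
/- Let f(γ) = (γ³ − 3γ² + 6γ − 6)² − 72γ(2−γ)(γ−1)², and let λ₀ = 1.97466… be the real number in (1.9, 2) with f(λ₀) = 0 such that f(γ) > 0 for all γ ∈ (λ₀, 2). Then for every positive integer n, R(𝒫; n) ≤ λ₀·n + 7√n. -/
open Finset

/-- The 3-graph `H` contains a copy of the loose path `𝒫` with three edges. -/
def HasLoosePath {V : Type*} [DecidableEq V] (H : Finset (Finset V)) : Prop :=
  ∃ a b c d e f g : V, ([a, b, c, d, e, f, g] : List V).Nodup ∧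
    ({a, b, c} : Finset V) ∈ H ∧ ({c, d, e} : Finset V) ∈ H ∧ ({e, f, g} : Finset V) ∈ H

/-- The polynomial `f(γ) = (γ³ − 3γ² + 6γ − 6)² − 72γ(2−γ)(γ−1)²`. -/
def fpoly (γ : ℝ) : ℝ :=
  (γ ^ 3 - 3 * γ ^ 2 + 6 * γ - 6) ^ 2 - 72 * γ * (2 - γ) * (γ - 1) ^ 2

/-- `R(𝒫; n)`: the least `N` such that every coloring of the triples of an
`N`-element set with `n` colors yields a monochromatic copy of `𝒫`. -/
noncomputable def RamseyP (n : ℕ) : ℕ :=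
  sInf {N : ℕ | ∀ χ : Finset (Fin N) → Fin n, ∃ i : Fin n,
    HasLoosePath ((Finset.univ : Finset (Finset (Fin N))).filter
      (fun e => e.card = 3 ∧ χ e = i))}


section structureLemma

variable {V : Type*} [DecidableEq V]

/-- `x` owns `w`: all edges through `w` contain `x`. -/
def LPOwn (H : Finset (Finset V)) (x w : V) : Prop :=
  x ≠ w ∧ ∀ e ∈ H, w ∈ e → x ∈ e

/-- Good edges: star edges or twin edges. -/
def LPGood (H : Finset (Finset V)) (e : Finset V) : Prop :=
  ∃ x y z, e = {x, y, z} ∧ ((LPOwn H x y ∧ LPOwn H x z) ∨ (LPOwn H y z ∧ LPOwn H z y))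

theorem lp_distinct {H : Finset (Finset V)} (h3 : ∀ e ∈ H, e.card = 3) {x y z : V}
    (h : ({x, y, z} : Finset V) ∈ H) : x ≠ y ∧ x ≠ z ∧ y ≠ z := by
  have := h3 _ h
  rw [Finset.card_eq_three] at this
  have h' := h3 _ h
  refine ⟨?_, ?_, ?_⟩
  · rintro rfl
    have : ({x, x, z} : Finset V).card ≤ 2 := by simpa using Finset.card_le_two
    omega
  · rintro rfl
    have h2 : ({x, y, x} : Finset V) = {x, y} := by ext t; simp; tauto
    rw [h2] at h'
    have := Finset.card_le_two (a := x) (b := y)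
    omega
  · rintro rfl
    have h2 : ({x, y, y} : Finset V) = {x, y} := by ext t; simp
    rw [h2] at h'
    have := Finset.card_le_two (a := x) (b := y)
    omega

theorem lp_nopath {H : Finset (Finset V)} (h3 : ∀ e ∈ H, e.card = 3) (hP : ¬ HasLoosePath H)
    {a b c d e f g : V} (h1 : ({a, b, c} : Finset V) ∈ H) (h2 : ({c, d, e} : Finset V) ∈ H)
    (h4 : ({e, f, g} : Finset V) ∈ H)
    (had : a ≠ d) (hae : a ≠ e) (haf : a ≠ f) (hag : a ≠ g)
    (hbd : b ≠ d) (hbe : b ≠ e) (hbf : b ≠ f) (hbg : b ≠ g)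
    (hcf : c ≠ f) (hcg : c ≠ g) (hdf : d ≠ f) (hdg : d ≠ g) : False := by
  apply hP
  have := lp_distinct h3 h1
  have := lp_distinct h3 h2
  have := lp_distinct h3 h4
  refine ⟨a, b, c, d, e, f, g, ?_, h1, h2, h4⟩
  simp
  tauto

theorem lp_rot {x y z : V} : ({x, y, z} : Finset V) = {y, z, x} := by
  ext t; simp; tauto

theorem lp_swap {x y z : V} : ({x, y, z} : Finset V) = {x, z, y} := by
  ext t; simp; tauto

theorem lp_swap' {x y z : V} : ({x, y, z} : Finset V) = {y, x, z} := by
  ext t; simp; tauto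

/-- An edge through `v` is `{v,a,b}`. -/
theorem lp_edge1 {H : Finset (Finset V)} (h3 : ∀ e ∈ H, e.card = 3) {e : Finset V} (he : e ∈ H)
    {v : V} (hv : v ∈ e) : ∃ a b, e = {v, a, b} := by
  obtain ⟨x, y, z, -, -, -, rfl⟩ := Finset.card_eq_three.1 (h3 e he)
  simp only [Finset.mem_insert, Finset.mem_singleton] at hv
  rcases hv with rfl | rfl | rfl
  · exact ⟨y, z, rfl⟩
  · exact ⟨x, z, lp_swap'⟩
  · exact ⟨x, y, by rw [← lp_rot]⟩

theorem lp_edge2 {H : Finset (Finset V)} (h3 : ∀ e ∈ H, e.card = 3) {e : Finset V} (he : e ∈ H)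
    {v w : V} (hv : v ∈ e) (hw : w ∈ e) (hvw : v ≠ w) : ∃ a, e = {v, w, a} := by
  obtain ⟨a, b, rfl⟩ := lp_edge1 h3 he hv
  simp only [Finset.mem_insert, Finset.mem_singleton] at hw
  rcases hw with h | rfl | rfl
  · exact absurd h.symm hvw
  · exact ⟨b, rfl⟩
  · exact ⟨a, lp_swap⟩

theorem lp_third {H : Finset (Finset V)} (h3 : ∀ e ∈ H, e.card = 3) {x y : V} (hxy : x ≠ y)
    (A : Finset V) (hA : A.card < (H.filter (fun e => x ∈ e ∧ y ∈ e)).card) :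
    ∃ z, z ∉ A ∧ ({x, y, z} : Finset V) ∈ H := by
  by_contra! hcon
  have : H.filter (fun e => x ∈ e ∧ y ∈ e) ⊆ A.image (fun z => ({x, y, z} : Finset V)) := by
    intro e he
    simp only [Finset.mem_filter] at he
    obtain ⟨z, rfl⟩ := lp_edge2 h3 he.1 he.2.1 he.2.2 hxy
    simp only [Finset.mem_image]
    refine ⟨z, ?_, rfl⟩
    by_contra hz
    exact hcon z hz he.1
  have h1 := Finset.card_le_card this
  have h2 := Finset.card_image_le (s := A) (f := fun z => ({x, y, z} : Finset V))
  omega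

/-- If `z` has degree at least seven then it has an edge outside a list of six. -/
theorem lp_deg {H : Finset (Finset V)} {z : V}
    (hd : 7 ≤ (H.filter (fun e => z ∈ e)).card) (A : Finset (Finset V)) (hA : A.card ≤ 6) :
    ∃ e ∈ H, z ∈ e ∧ e ∉ A := by
  by_contra! hcon
  have : H.filter (fun e => z ∈ e) ⊆ A := by
    intro e he
    simp only [Finset.mem_filter] at he
    exact hcon e he.1 he.2
  have h1 := Finset.card_le_card this
  omega

/-- Case 2: no pair of codegree at least five has private edges on both sides. -/
theorem lp_case2 {H : Finset (Finset V)} (h3 : ∀ e ∈ H, e.card = 3) (hP : ¬ HasLoosePath H)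
    (hdeg : ∀ e ∈ H, ∀ z ∈ e, 7 ≤ (H.filter (fun e => z ∈ e)).card)
    {x y : V} (hxy : x ≠ y) (hc : 5 ≤ (H.filter (fun e => x ∈ e ∧ y ∈ e)).card)
    {p q r s : V} (hpq : ({x, p, q} : Finset V) ∈ H) (hyp : y ≠ p) (hyq : y ≠ q)
    (hrs : ({y, r, s} : Finset V) ∈ H) (hxr : x ≠ r) (hxs : x ≠ s) : False := by
  -- cross-intersecting
  have cross : ∀ p q r s : V, ({x, p, q} : Finset V) ∈ H → y ≠ p → y ≠ q →
      ({y, r, s} : Finset V) ∈ H → x ≠ r → x ≠ s → p ≠ r → p ≠ s → q ≠ r → q ≠ s → False := by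
    intro p q r s hpq hyp hyq hrs hxr hxs h1 h2 h5 h4
    obtain ⟨z, hz, hzH⟩ := lp_third h3 hxy {p, q, r, s}
      (lt_of_le_of_lt Finset.card_le_four hc)
    simp only [Finset.mem_insert, Finset.mem_singleton, not_or] at hz
    obtain ⟨hz1, hz2, hz3, hz4⟩ := hz
    rw [lp_rot] at hpq
    rw [lp_swap] at hzH
    exact lp_nopath h3 hP hpq hzH hrs (Ne.symm hz1) (Ne.symm hyp) h1 h2 (Ne.symm hz2)
      (Ne.symm hyq) h5 h4 hxr hxs hz3 hz4
  obtain ⟨z, hz, hzH⟩ := lp_third h3 hxy {p, q, r, s}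
      (lt_of_le_of_lt Finset.card_le_four hc)
  simp only [Finset.mem_insert, Finset.mem_singleton, not_or] at hz
  obtain ⟨hz1, hz2, hz3, hz4⟩ := hz
  have hdz := lp_distinct h3 hzH
  obtain ⟨e, heH, hze, heA⟩ := lp_deg (hdeg _ hzH z (by simp))
    {{x, y, z}, {x, z, r}, {x, z, s}, {y, z, p}, {y, z, q}, {z, p, q}} Finset.card_le_six
  simp only [Finset.mem_insert, Finset.mem_singleton, not_or] at heA
  obtain ⟨e1, e2, e3, e4, e5, e6⟩ := heA
  by_cases hxe : x ∈ e
  · by_cases hye : y ∈ e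
    · obtain ⟨t, rfl⟩ := lp_edge2 h3 heH hxe hye hxy
      simp only [Finset.mem_insert, Finset.mem_singleton] at hze
      rcases hze with h | h | rfl
      · exact hdz.2.1 h.symm
      · exact hdz.2.2 h.symm
      · exact e1 rfl
    · obtain ⟨t, rfl⟩ := lp_edge2 h3 heH hxe hze hdz.2.1
      simp only [Finset.mem_insert, Finset.mem_singleton, not_or] at hye
      refine cross z t r s heH hye.2.1 hye.2.2 hrs hxr hxs hz3 hz4 ?_ ?_
      · rintro rfl; exact e2 rfl
      · rintro rfl; exact e3 rfl
  · by_cases hye : y ∈ e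
    · obtain ⟨t, rfl⟩ := lp_edge2 h3 heH hye hze hdz.2.2
      simp only [Finset.mem_insert, Finset.mem_singleton, not_or] at hxe
      refine cross p q z t hpq hyp hyq heH hxe.2.1 hxe.2.2 (Ne.symm hz1) ?_ (Ne.symm hz2) ?_
      · rintro rfl; exact e4 rfl
      · rintro rfl; exact e5 rfl
    · obtain ⟨s', t', rfl⟩ := lp_edge1 h3 heH hze
      simp only [Finset.mem_insert, Finset.mem_singleton, not_or] at hxe hye
      -- one common vertex with `{p,q}`
      have one : ∀ p q t : V, ({x, p, q} : Finset V) ∈ H → y ≠ p → y ≠ q →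
          ({z, t, p} : Finset V) ∈ H → x ≠ t → y ≠ t → t ≠ q → z ≠ p → z ≠ q → False := by
        intro p q t hpq hyp hyq hj hxt hyt htq hzp hzq
        obtain ⟨z', hz', hzH'⟩ := lp_third h3 hxy {z, t, p, q}
          (lt_of_le_of_lt Finset.card_le_four hc)
        simp only [Finset.mem_insert, Finset.mem_singleton, not_or] at hz'
        obtain ⟨h1, h2, h5, h4⟩ := hz'
        rw [lp_rot] at hpq
        exact lp_nopath h3 hP hj hpq hzH' hzq hdz.2.1.symm hdz.2.2.symm (Ne.symm h1)
          htq (Ne.symm hxt) (Ne.symm hyt) (Ne.symm h2) (Ne.symm hyp) (Ne.symm h5)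
          (Ne.symm hyq) (Ne.symm h4)
      have hst := lp_distinct h3 heH
      have hpqd := lp_distinct h3 hpq
      have hqp : ({x, q, p} : Finset V) ∈ H := by rwa [lp_swap]
      have hzt : ({z, t', s'} : Finset V) ∈ H := by rwa [lp_swap]
      by_cases c1 : s' = p
      · subst c1
        by_cases c2 : t' = q
        · subst c2; exact e6 rfl
        · exact one s' q t' hpq hyp hyq hzt hxe.2.2 hye.2.2 c2 hz1 hz2
      · by_cases c2 : s' = q
        · subst c2
          by_cases c3 : t' = p
          · subst c3; exact e6 lp_swap
          · exact one s' p t' hqp hyq hyp hzt hxe.2.2 hye.2.2 c3 hz2 hz1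
        · by_cases c3 : t' = p
          · subst c3
            exact one t' q s' hpq hyp hyq heH hxe.2.1 hye.2.1 c2 hz1 hz2
          · by_cases c4 : t' = q
            · subst c4
              exact one t' p s' hqp hyq hyp heH hxe.2.1 hye.2.1 c1 hz2 hz1
            · have hj : ({s', t', z} : Finset V) ∈ H := by rwa [← lp_rot]
              have hzz : ({z, y, x} : Finset V) ∈ H := by
                have h0 : ({z, y, x} : Finset V) = {x, y, z} := by ext t; simp; tauto
                rw [h0]; exact hzH
              exact lp_nopath h3 hP hj hzz hpq (Ne.symm hye.2.1) (Ne.symm hxe.2.1) c1 c2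
                (Ne.symm hye.2.2) (Ne.symm hxe.2.2) c3 c4 hz1 hz2 hyp hyq

theorem lp_mem2 {H : Finset (Finset V)} (h3 : ∀ e ∈ H, e.card = 3) {e : Finset V} (he : e ∈ H)
    {u v w : V} (hu : u ∈ e) (hv : v ∈ e) (hw : w ∈ e) (h1 : u ≠ v) (h2 : u ≠ w) (h4 : v ≠ w) :
    e = {u, v, w} := by
  symm
  apply Finset.eq_of_subset_of_card_le
  · intro t ht
    simp only [Finset.mem_insert, Finset.mem_singleton] at ht
    rcases ht with rfl | rfl | rfl <;> assumption
  · rw [h3 e he, Finset.card_eq_three.2 ⟨u, v, w, h1, h2, h4, rfl⟩]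

theorem lp_case1 {H : Finset (Finset V)} (h3 : ∀ e ∈ H, e.card = 3) (hP : ¬ HasLoosePath H)
    (hdeg : ∀ e ∈ H, ∀ z ∈ e, 7 ≤ (H.filter (fun e => z ∈ e)).card)
    {x y : V} (hxy : x ≠ y) (hc : 5 ≤ (H.filter (fun e => x ∈ e ∧ y ∈ e)).card)
    (hown : ∀ e ∈ H, y ∈ e → x ∈ e)
    {p q : V} (hpq : ({x, p, q} : Finset V) ∈ H) (hyp : y ≠ p) (hyq : y ≠ q)
    {z : V} (hz : ({x, y, z} : Finset V) ∈ H) : LPOwn H x z := by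
  have clA : ∀ p q : V, ({x, p, q} : Finset V) ∈ H → y ≠ p → y ≠ q → ∀ j ∈ H, x ∉ j →
      p ∈ j → q ∈ j := by
    intro p q hpq hyp hyq j hj hxj hpj
    by_contra hqj
    have hyj : y ∉ j := fun h => hxj (hown j hj h)
    obtain ⟨u, w, rfl⟩ := lp_edge1 h3 hj hpj
    obtain ⟨z', hz', hzH'⟩ := lp_third h3 hxy {u, w, p, q}
          (lt_of_le_of_lt Finset.card_le_four hc)
    simp only [Finset.mem_insert, Finset.mem_singleton, not_or] at hz' hqj hxj hyj
    rw [lp_rot] at hj hpq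
    exact lp_nopath h3 hP hj hpq hzH' (Ne.symm hqj.2.1) (Ne.symm hxj.2.1) (Ne.symm hyj.2.1)
      (Ne.symm hz'.1) (Ne.symm hqj.2.2) (Ne.symm hxj.2.2) (Ne.symm hyj.2.2)
      (Ne.symm hz'.2.1) (Ne.symm hyp) (Ne.symm hz'.2.2.1) (Ne.symm hyq) (Ne.symm hz'.2.2.2)
  have clB : ∀ z p q : V, ({x, y, z} : Finset V) ∈ H → ({x, p, q} : Finset V) ∈ H →
      y ≠ p → y ≠ q → z ≠ p → z ≠ q → ∀ j ∈ H, x ∉ j → z ∈ j → p ∈ j ∧ q ∈ j := by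
    intro z p q hz hpq hyp hyq hzp hzq j hj hxj hzj
    have hqp : ({x, q, p} : Finset V) ∈ H := by rwa [lp_swap]
    have A1 := clA p q hpq hyp hyq j hj hxj
    have A2 := clA q p hqp hyq hyp j hj hxj
    by_contra hcon
    have hpj : p ∉ j := by tauto
    have hqj : q ∉ j := by tauto
    have hyj : y ∉ j := fun h => hxj (hown j hj h)
    obtain ⟨u, w, rfl⟩ := lp_edge1 h3 hj hzj
    simp only [Finset.mem_insert, Finset.mem_singleton, not_or] at hpj hqj hxj hyj
    rw [lp_rot] at hj
    have h0 : ({x, y, z} : Finset V) = {z, y, x} := by ext t; simp; tauto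
    rw [h0] at hz
    exact lp_nopath h3 hP hj hz hpq (Ne.symm hyj.2.1) (Ne.symm hxj.2.1) (Ne.symm hpj.2.1)
      (Ne.symm hqj.2.1) (Ne.symm hyj.2.2) (Ne.symm hxj.2.2) (Ne.symm hpj.2.2) (Ne.symm hqj.2.2)
      hzp hzq hyp hyq
  refine ⟨(lp_distinct h3 hz).2.1, ?_⟩
  intro j hj hzj
  by_contra hxj
  have hall : ∀ p q : V, ({x, p, q} : Finset V) ∈ H → y ≠ p → y ≠ q → p ∈ j ∧ q ∈ j := by
    intro p q hpq hyp hyq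
    have hqp : ({x, q, p} : Finset V) ∈ H := by rwa [lp_swap]
    by_cases h1 : z = p
    · subst h1; exact ⟨hzj, clA z q hpq hyp hyq j hj hxj hzj⟩
    · by_cases h2 : z = q
      · subst h2; exact ⟨clA z p hqp hyq hyp j hj hxj hzj, hzj⟩
      · exact clB z p q hz hpq hyp hyq h1 h2 j hj hxj hzj
  obtain ⟨z2, hz2, hz2H⟩ := lp_third h3 hxy j (by rw [h3 j hj]; omega)
  have hz2d := lp_distinct h3 hz2H
  obtain ⟨e, heH, hze, heA⟩ := lp_deg (hdeg _ hz2H z2 (by simp))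
    {{x, y, z2}, {z2, p, q}} (Finset.card_le_two.trans (by omega))
  simp only [Finset.mem_insert, Finset.mem_singleton, not_or] at heA
  have hpqj := hall p q hpq hyp hyq
  have hpqd := lp_distinct h3 hpq
  by_cases hye : y ∈ e
  · exact heA.1 (lp_mem2 h3 heH (hown e heH hye) hye hze hxy hz2d.2.1 hz2d.2.2)
  · by_cases hxe : x ∈ e
    · obtain ⟨t, rfl⟩ := lp_edge2 h3 heH hxe hze hz2d.2.1
      simp only [Finset.mem_insert, Finset.mem_singleton, not_or] at hye
      exact hz2 (hall z2 t heH hye.2.1 hye.2.2).1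
    · have h1 : z2 ≠ p := by rintro rfl; exact hz2 hpqj.1
      have h2 : z2 ≠ q := by rintro rfl; exact hz2 hpqj.2
      have := clB z2 p q hz2H hpq hyp hyq h1 h2 e heH hxe hze
      exact heA.2 (lp_mem2 h3 heH hze this.1 this.2 h1 h2 hpqd.2.2)

/-- Codegree lemma. -/
theorem lp_codeg {H : Finset (Finset V)} (h3 : ∀ e ∈ H, e.card = 3) (hP : ¬ HasLoosePath H)
    (hdeg : ∀ e ∈ H, ∀ z ∈ e, 7 ≤ (H.filter (fun e => z ∈ e)).card)
    {x y : V} (hxy : x ≠ y) (hc : 5 ≤ (H.filter (fun e => x ∈ e ∧ y ∈ e)).card)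
    {e : Finset V} (he : e ∈ H) (hxe : x ∈ e) (hye : y ∈ e) : LPGood H e := by
  have hc' : 5 ≤ (H.filter (fun e => y ∈ e ∧ x ∈ e)).card := by
    simpa only [and_comm] using hc
  obtain ⟨z, rfl⟩ := lp_edge2 h3 he hxe hye hxy
  by_cases hx : ∀ e ∈ H, x ∈ e → y ∈ e
  · by_cases hy : ∀ e ∈ H, y ∈ e → x ∈ e
    · exact ⟨z, x, y, by rw [← lp_rot], Or.inr ⟨⟨hxy, hy⟩, ⟨hxy.symm, hx⟩⟩⟩
    · push Not at hy
      obtain ⟨f, hf, hyf, hxf⟩ := hy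
      obtain ⟨p, q, rfl⟩ := lp_edge1 h3 hf hyf
      simp only [Finset.mem_insert, Finset.mem_singleton, not_or] at hxf
      have he' : ({y, x, z} : Finset V) ∈ H := by rwa [lp_swap']
      have := lp_case1 h3 hP hdeg hxy.symm hc' hx hf hxf.2.1 hxf.2.2 he'
      exact ⟨y, x, z, lp_swap', Or.inl ⟨⟨hxy.symm, hx⟩, this⟩⟩
  · push Not at hx
    obtain ⟨f, hf, hxf, hyf⟩ := hx
    obtain ⟨p, q, rfl⟩ := lp_edge1 h3 hf hxf
    simp only [Finset.mem_insert, Finset.mem_singleton, not_or] at hyf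
    by_cases hy : ∀ e ∈ H, y ∈ e → x ∈ e
    · have := lp_case1 h3 hP hdeg hxy hc hy hf hyf.2.1 hyf.2.2 he
      exact ⟨x, y, z, rfl, Or.inl ⟨⟨hxy, hy⟩, this⟩⟩
    · push Not at hy
      obtain ⟨g, hg, hyg, hxg⟩ := hy
      obtain ⟨r, s, rfl⟩ := lp_edge1 h3 hg hyg
      simp only [Finset.mem_insert, Finset.mem_singleton, not_or] at hxg
      exact (lp_case2 h3 hP hdeg hxy hc hf hyf.2.1 hyf.2.2 hg hxg.2.1 hxg.2.2).elim

/-- Big vertex lemma. -/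
theorem lp_big {H : Finset (Finset V)} (h3 : ∀ e ∈ H, e.card = 3) (hP : ¬ HasLoosePath H)
    (hdeg : ∀ e ∈ H, ∀ z ∈ e, 7 ≤ (H.filter (fun e => z ∈ e)).card)
    {v : V} (hv : ∀ C : Finset V, C.card ≤ 4 → ∃ y z, ({v, y, z} : Finset V) ∈ H ∧ y ∉ C ∧ z ∉ C)
    {e : Finset V} (he : e ∈ H) (hve : v ∈ e) : LPGood H e := by
  have st : ∀ f ∈ H, v ∉ f → ∀ w w' : V, w ∈ f → ({v, w, w'} : Finset V) ∈ H → w' ∈ f := by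
    intro f hf hvf w w' hwf hw
    by_contra hcon
    obtain ⟨a, b, rfl⟩ := lp_edge1 h3 hf hwf
    obtain ⟨y, z, hyz, hy, hz⟩ := hv {a, b, w, w'} Finset.card_le_four
    simp only [Finset.mem_insert, Finset.mem_singleton, not_or] at hy hz hvf hcon
    rw [lp_rot] at hf hw
    exact lp_nopath h3 hP hf hw hyz (Ne.symm hcon.2.1) (Ne.symm hvf.2.1) (Ne.symm hy.1)
      (Ne.symm hz.1) (Ne.symm hcon.2.2) (Ne.symm hvf.2.2) (Ne.symm hy.2.1) (Ne.symm hz.2.1)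
      (Ne.symm hy.2.2.1) (Ne.symm hz.2.2.1) (Ne.symm hy.2.2.2) (Ne.symm hz.2.2.2)
  -- key: the neighbourhood of w is a single vertex
  have key : ∀ f ∈ H, v ∉ f → ∀ w w' : V, w ∈ f → ({v, w, w'} : Finset V) ∈ H →
      LPOwn H w' w := by
    intro f hf hvf w w' hwf hw
    have hd := lp_distinct h3 hw
    refine ⟨hd.2.2.symm, ?_⟩
    intro g hg hwg
    by_cases hvg : v ∈ g
    · by_contra hw'g
      obtain ⟨t, rfl⟩ := lp_edge2 h3 hg hvg hwg hd.1
      have hd2 := lp_distinct h3 hg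
      simp only [Finset.mem_insert, Finset.mem_singleton, not_or] at hw'g
      obtain ⟨e, heH, hwe, heA⟩ := lp_deg (hdeg _ hw w (by simp))
        {{v, w, w'}, {v, w, t}, {w, w', t}} (Finset.card_le_three.trans (by omega))
      simp only [Finset.mem_insert, Finset.mem_singleton, not_or] at heA
      by_cases hve : v ∈ e
      · obtain ⟨s, rfl⟩ := lp_edge2 h3 heH hve hwe hd.1
        have h1 := st f hf hvf w s hwf heH
        have h2 := st f hf hvf w w' hwf hw
        have h4 := st f hf hvf w t hwf hg
        have hf' := lp_mem2 h3 hf hwf h2 h4 hd.2.2 hd2.2.2 hw'g.2.2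
        rw [hf'] at h1
        simp only [Finset.mem_insert, Finset.mem_singleton] at h1
        rcases h1 with rfl | rfl | rfl
        · exact (lp_distinct h3 heH).2.2 rfl
        · exact heA.1 rfl
        · exact heA.2.1 rfl
      · have h2 := st e heH hve w w' hwe hw
        have h4 := st e heH hve w t hwe hg
        exact heA.2.2 (lp_mem2 h3 heH hwe h2 h4 hd.2.2 hd2.2.2 hw'g.2.2)
    · exact st g hg hvg w w' hwg hw
  obtain ⟨w, w', rfl⟩ := lp_edge1 h3 he hve
  have hd := lp_distinct h3 he
  have he' : ({v, w', w} : Finset V) ∈ H := by rwa [lp_swap]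
  have tw : ∀ f ∈ H, v ∉ f → w ∈ f → LPGood H {v, w, w'} := by
    intro f hf hvf hwf
    have h2 := st f hf hvf w w' hwf he
    exact ⟨v, w, w', rfl, Or.inr ⟨key f hf hvf w' w h2 he', key f hf hvf w w' hwf he⟩⟩
  by_cases h1 : ∀ f ∈ H, w ∈ f → v ∈ f
  · by_cases h2 : ∀ f ∈ H, w' ∈ f → v ∈ f
    · exact ⟨v, w, w', rfl, Or.inl ⟨⟨hd.1, h1⟩, ⟨hd.2.1, h2⟩⟩⟩
    · push Not at h2
      obtain ⟨f, hf, hwf, hvf⟩ := h2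
      exact tw f hf hvf (st f hf hvf w' w hwf he')
  · push Not at h1
    obtain ⟨f, hf, hwf, hvf⟩ := h1
    exact tw f hf hvf hwf

open Classical in
/-- Each vertex lies in at most sixteen bad edges. -/
theorem lp_badcount {H : Finset (Finset V)} (h3 : ∀ e ∈ H, e.card = 3) (hP : ¬ HasLoosePath H)
    (hdeg : ∀ e ∈ H, ∀ z ∈ e, 7 ≤ (H.filter (fun e => z ∈ e)).card) (v : V) :
    ((H.filter (fun e => ¬ LPGood H e)).filter (fun e => v ∈ e)).card ≤ 16 := by
  by_cases hv : ∀ C : Finset V, C.card ≤ 4 → ∃ y z, ({v, y, z} : Finset V) ∈ H ∧ y ∉ C ∧ z ∉ C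
  · have : (H.filter (fun e => ¬ LPGood H e)).filter (fun e => v ∈ e) = ∅ := by
      apply Finset.eq_empty_of_forall_notMem
      intro e he
      simp only [Finset.mem_filter] at he
      exact he.1.2 (lp_big h3 hP hdeg hv he.1.1 he.2)
    rw [this]; simp
  · push Not at hv
    obtain ⟨C, hC, hcov⟩ := hv
    have hsub : (H.filter (fun e => ¬ LPGood H e)).filter (fun e => v ∈ e) ⊆
        C.biUnion (fun u => (H.filter (fun e => ¬ LPGood H e)).filter
          (fun e => v ∈ e ∧ u ∈ e ∧ u ≠ v)) := by
      intro e he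
      simp only [Finset.mem_filter, Finset.mem_biUnion] at he ⊢
      obtain ⟨y, z, rfl⟩ := lp_edge1 h3 he.1.1 he.2
      have hd := lp_distinct h3 he.1.1
      by_cases hy : y ∈ C
      · exact ⟨y, hy, he.1, by simp, by simp, hd.1.symm⟩
      · exact ⟨z, hcov y z he.1.1 hy, he.1, by simp, by simp, hd.2.1.symm⟩
    refine (Finset.card_le_card hsub).trans ?_
    refine (Finset.card_biUnion_le_card_mul _ _ 4 ?_).trans (by omega)
    intro u hu
    by_contra! hcon
    have hne : (filter (fun e => v ∈ e ∧ u ∈ e ∧ u ≠ v) (H.filter (fun e => ¬ LPGood H e))).Nonempty := by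
      rw [← Finset.card_pos]; omega
    obtain ⟨e, he⟩ := hne
    simp only [Finset.mem_filter] at he
    refine he.1.2 (lp_codeg h3 hP hdeg he.2.2.2.symm ?_ he.1.1 he.2.1 he.2.2.1)
    refine le_trans hcon (Finset.card_le_card ?_)
    intro f hf
    simp only [Finset.mem_filter] at hf ⊢
    exact ⟨hf.1.1, hf.2.1, hf.2.2.1⟩

/-- An edge covered by the functional digraph `π` restricted to `S`. -/
def LPCov (S : Finset V) (π : V → V) (e : Finset V) : Prop :=
  ∃ x y z, e = {x, y, z} ∧ y ∈ S ∧ z ∈ S ∧ π y = x ∧ π z = x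

open Classical in
theorem lp_core {H : Finset (Finset V)} (h3 : ∀ e ∈ H, e.card = 3) (hP : ¬ HasLoosePath H)
    (U : Finset V) (hU : ∀ e ∈ H, e ⊆ U)
    (hdegU : ∀ z ∈ U, 7 ≤ (H.filter (fun e => z ∈ e)).card) :
    ∃ (S : Finset V) (π : V → V), S ⊆ U ∧ (∀ v ∈ S, π v ≠ v) ∧
      8 * (H.filter (fun e => ¬ LPCov S π e)).card ≤ 48 * U.card + (U.card - S.card) ^ 2 := by
  have hdeg : ∀ e ∈ H, ∀ z ∈ e, 7 ≤ (H.filter (fun e => z ∈ e)).card :=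
    fun e he z hz => hdegU z (hU e he hz)
  -- uniqueness of owners
  have uniq : ∀ w ∈ U, ∀ x x', LPOwn H x w → LPOwn H x' w → x = x' := by
    intro w hw x x' h1 h2
    by_contra hne
    obtain ⟨e, he, hwe, heA⟩ := lp_deg (hdegU w hw) {{w, x, x'}} (by simp)
    apply heA
    rw [Finset.mem_singleton]
    exact lp_mem2 h3 he hwe (h1.2 e he hwe) (h2.2 e he hwe) h1.1.symm h2.1.symm hne
  let π : V → V := fun w => if h : ∃ x, LPOwn H x w then h.choose else w
  have hπ : ∀ w ∈ U, ∀ x, LPOwn H x w → π w = x := by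
    intro w hw x hx
    have h : ∃ x, LPOwn H x w := ⟨x, hx⟩
    have h' : π w = h.choose := by simp only [π]; rw [dif_pos h]
    rw [h']
    exact uniq w hw _ _ h.choose_spec hx
  let S := U.filter (fun w => ∃ x, LPOwn H x w ∧ ¬ LPOwn H w x)
  let W := U.filter (fun w => ∃ x, LPOwn H x w ∧ LPOwn H w x)
  let X := U.filter (fun w => ¬ ∃ x, LPOwn H x w)
  refine ⟨S, π, Finset.filter_subset _ _, ?_, ?_⟩
  · intro v hv
    simp only [S, Finset.mem_filter] at hv
    obtain ⟨hvU, x, hx, -⟩ := hv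
    rw [hπ v hvU x hx]; exact hx.1
  have hSW : Disjoint S W := by
    rw [Finset.disjoint_left]
    intro w h1 h2
    simp only [S, W, Finset.mem_filter] at h1 h2
    obtain ⟨hwU, x, hx, hx'⟩ := h1
    obtain ⟨-, y, hy, hy'⟩ := h2
    rw [uniq w hwU x y hx hy] at hx'
    exact hx' hy'
  have hSWX : Disjoint (S ∪ W) X := by
    rw [Finset.disjoint_left]
    intro w h1 h2
    simp only [S, W, X, Finset.mem_filter, Finset.mem_union] at h1 h2
    rcases h1 with ⟨-, x, hx, -⟩ | ⟨-, x, hx, -⟩ <;> exact h2.2 ⟨x, hx⟩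
  have hcard : S.card + W.card + X.card ≤ U.card := by
    rw [← Finset.card_union_of_disjoint hSW, ← Finset.card_union_of_disjoint hSWX]
    apply Finset.card_le_card
    intro w hw
    simp only [S, W, X, Finset.mem_filter, Finset.mem_union] at hw
    tauto
  -- bad edges
  let B := H.filter (fun e => ¬ LPGood H e)
  have hB : B.card * 3 ≤ U.card * 16 := by
    apply Finset.card_mul_le_card_mul (fun (e : Finset V) (v : V) => v ∈ e)
    · intro e he
      have heH : e ∈ H := (Finset.mem_filter.1 he).1
      rw [← h3 e heH]
      apply Finset.card_le_card
      intro v hv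
      simp only [Finset.bipartiteAbove, Finset.mem_filter]
      exact ⟨hU e heH hv, hv⟩
    · intro v hv
      exact lp_badcount h3 hP hdeg v
  let T := H.filter (fun e => ∃ x y z, e = {x, y, z} ∧ LPOwn H y z ∧ LPOwn H z y)
  have hT : T.card * 2 ≤ (X ×ˢ W).card * 1 := by
    apply Finset.card_mul_le_card_mul
      (fun (e : Finset V) (a : V × V) => e = {a.1, a.2, π a.2})
    · intro e he
      simp only [T, Finset.mem_filter] at he
      obtain ⟨heH, x, y, z, rfl, hyz, hzy⟩ := he
      have hd := lp_distinct h3 heH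
      have hxU : x ∈ U := hU _ heH (by simp)
      have hyU : y ∈ U := hU _ heH (by simp)
      have hzU : z ∈ U := hU _ heH (by simp)
      have hxX : x ∈ X := by
        simp only [X, Finset.mem_filter]
        refine ⟨hxU, ?_⟩
        rintro ⟨u, hu⟩
        have hue := hu.2 _ heH (by simp)
        simp only [Finset.mem_insert, Finset.mem_singleton] at hue
        rcases hue with rfl | rfl | rfl
        · exact hu.1 rfl
        · have : LPOwn H z x := ⟨hd.2.1.symm, fun e he hx => hzy.2 e he (hu.2 e he hx)⟩
          exact hd.2.2 (uniq x hxU _ _ hu this)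
        · have : LPOwn H y x := ⟨hd.1.symm, fun e he hx => hyz.2 e he (hu.2 e he hx)⟩
          exact hd.2.2 (uniq x hxU _ _ this hu)
      have hyW : y ∈ W := by
        simp only [W, Finset.mem_filter]; exact ⟨hyU, z, hzy, hyz⟩
      have hzW : z ∈ W := by
        simp only [W, Finset.mem_filter]; exact ⟨hzU, y, hyz, hzy⟩
      have hne : ((x, y) : V × V) ≠ (x, z) := by
        intro h; exact hd.2.2 (Prod.mk.inj h).2
      rw [← Finset.card_pair hne]
      apply Finset.card_le_card
      intro a ha
      simp only [Finset.mem_insert, Finset.mem_singleton] at ha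
      simp only [Finset.bipartiteAbove, Finset.mem_filter, Finset.mem_product]
      rcases ha with rfl | rfl
      · refine ⟨⟨hxX, hyW⟩, ?_⟩
        simp only []
        rw [hπ y hyU z hzy]
      · refine ⟨⟨hxX, hzW⟩, ?_⟩
        simp only []
        rw [hπ z hzU y hyz, lp_swap]
    · intro a ha
      rw [Finset.card_le_one]
      intro e he f hf
      simp only [Finset.bipartiteBelow, Finset.mem_filter] at he hf
      rw [he.2, hf.2]
  have hsub : H.filter (fun e => ¬ LPCov S π e) ⊆ B ∪ T := by
    intro e he
    simp only [B, T, Finset.mem_filter, Finset.mem_union] at he ⊢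
    by_cases hg : LPGood H e
    · right
      refine ⟨he.1, ?_⟩
      obtain ⟨x, y, z, rfl, h | h⟩ := hg
      · exfalso
        apply he.2
        have heH := he.1
        have hd := lp_distinct h3 heH
        have hyU : y ∈ U := hU _ heH (by simp)
        have hzU : z ∈ U := hU _ heH (by simp)
        refine ⟨x, y, z, rfl, ?_, ?_, hπ y hyU x h.1, hπ z hzU x h.2⟩
        · simp only [S, Finset.mem_filter]
          refine ⟨hyU, x, h.1, fun hyx => ?_⟩
          have : LPOwn H y z := ⟨hd.2.2, fun e he hz => hyx.2 e he (h.2.2 e he hz)⟩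
          exact hd.1 (uniq z hzU _ _ h.2 this)
        · simp only [S, Finset.mem_filter]
          refine ⟨hzU, x, h.2, fun hzx => ?_⟩
          have : LPOwn H z y := ⟨hd.2.2.symm, fun e he hy => hzx.2 e he (h.1.2 e he hy)⟩
          exact hd.2.1 (uniq y hyU _ _ h.1 this)
      · exact ⟨x, y, z, rfl, h⟩
    · left; exact ⟨he.1, hg⟩
  have h1 := (Finset.card_le_card hsub).trans (Finset.card_union_le _ _)
  rw [Finset.card_product, mul_one] at hT
  have h2 : 4 * (X.card * W.card) ≤ (U.card - S.card) ^ 2 := by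
    have h5 : X.card + W.card ≤ U.card - S.card := by omega
    have h6 : (X.card + W.card) ^ 2 ≤ (U.card - S.card) ^ 2 := Nat.pow_le_pow_left h5 2
    zify at h6 ⊢
    nlinarith [sq_nonneg ((X.card : ℤ) - W.card)]
  omega

open Classical in
/-- Structure lemma. -/
theorem lp_structure [Fintype V] {H : Finset (Finset V)} (h3 : ∀ e ∈ H, e.card = 3)
    (hP : ¬ HasLoosePath H) :
    ∃ (S : Finset V) (π : V → V), (∀ v ∈ S, π v ≠ v) ∧
      8 * (H.filter (fun e => ¬ LPCov S π e)).card
        ≤ Fintype.card V * (Fintype.card V - S.card) + 48 * Fintype.card V := by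
  let P : Finset V → Prop := fun U =>
    (H.filter (fun e => ¬ e ⊆ U)).card ≤ 6 * (Fintype.card V - U.card)
  have hne : ((Finset.univ : Finset (Finset V)).filter P).Nonempty := by
    refine ⟨Finset.univ, ?_⟩
    simp [P]
  obtain ⟨U, hUP, hmin⟩ := Finset.exists_min_image _ (fun U : Finset V => U.card) hne
  simp only [Finset.mem_filter, Finset.mem_univ, true_and] at hUP hmin
  let H' := H.filter (fun e => e ⊆ U)
  have hH' : ∀ e ∈ H', e ∈ H ∧ e ⊆ U := by
    intro e he; simpa [H'] using he
  have hdegU : ∀ z ∈ U, 7 ≤ (H'.filter (fun e => z ∈ e)).card := by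
    intro z hz
    by_contra! hlt
    have hPe : P (U.erase z) := by
      simp only [P] at hUP ⊢
      have hsub : H.filter (fun e => ¬ e ⊆ U.erase z) ⊆
          H.filter (fun e => ¬ e ⊆ U) ∪ H'.filter (fun e => z ∈ e) := by
        intro e he
        simp only [H', Finset.mem_filter, Finset.mem_union] at he ⊢
        by_cases h : e ⊆ U
        · right
          refine ⟨⟨he.1, h⟩, ?_⟩
          by_contra hze
          exact he.2 (Finset.subset_erase.2 ⟨h, hze⟩)
        · left; exact ⟨he.1, h⟩
      have h1 := (Finset.card_le_card hsub).trans (Finset.card_union_le _ _)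
      rw [Finset.card_erase_of_mem hz]
      have hpos : 0 < U.card := Finset.card_pos.2 ⟨z, hz⟩
      have hle : U.card ≤ Fintype.card V := Finset.card_le_univ U
      omega
    have := hmin _ hPe
    rw [Finset.card_erase_of_mem hz] at this
    have hpos : 0 < U.card := Finset.card_pos.2 ⟨z, hz⟩
    omega
  have hP' : ¬ HasLoosePath H' := by
    rintro ⟨a, b, c, d, e, f, g, hnd, h1, h2, h4⟩
    exact hP ⟨a, b, c, d, e, f, g, hnd, (hH' _ h1).1, (hH' _ h2).1, (hH' _ h4).1⟩
  obtain ⟨S, π, hSU, hπ, hcount⟩ := lp_core (fun e he => h3 e (hH' e he).1) hP' U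
    (fun e he => (hH' e he).2) hdegU
  refine ⟨S, π, hπ, ?_⟩
  have hsub : H.filter (fun e => ¬ LPCov S π e) ⊆
      H.filter (fun e => ¬ e ⊆ U) ∪ H'.filter (fun e => ¬ LPCov S π e) := by
    intro e he
    simp only [H', Finset.mem_filter, Finset.mem_union] at he ⊢
    tauto
  have h1 := (Finset.card_le_card hsub).trans (Finset.card_union_le _ _)
  have hle : U.card ≤ Fintype.card V := Finset.card_le_univ U
  have hSle : S.card ≤ U.card := Finset.card_le_card hSU
  have h2 : (U.card - S.card) ^ 2 ≤ Fintype.card V * (Fintype.card V - S.card) := by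
    rw [pow_two]
    exact Nat.mul_le_mul (by omega) (by omega)
  simp only [P] at hUP
  omega

end structureLemma

section counting

variable {V : Type*} [DecidableEq V]

/-- The local weight function. -/
noncomputable def lpF (η p q b z : ℝ) : ℝ :=
  -η * (q ^ 2 - q) / 2 + η * p * q - η / 2 * p * b + η / 2 * p * z - η / 2 * q * b
    + q * z / 2 + (z ^ 2 - z) / 6

open Classical in
/-- Out-only neighbour indicator. -/
noncomputable def lpP (A : V → V → Prop) (u v : V) : ℝ := if A u v ∧ ¬ A v u then 1 else 0

open Classical in
/-- In-only neighbour indicator. -/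
noncomputable def lpQ (A : V → V → Prop) (u v : V) : ℝ := if ¬ A u v ∧ A v u then 1 else 0

open Classical in
/-- Bidirectional neighbour indicator. -/
noncomputable def lpB (A : V → V → Prop) (u v : V) : ℝ := if A u v ∧ A v u then 1 else 0

open Classical in
/-- Non-neighbour indicator. -/
noncomputable def lpZ (A : V → V → Prop) (u v : V) : ℝ :=
  if u ≠ v ∧ ¬ A u v ∧ ¬ A v u then 1 else 0

/-- Cherry weight. -/
noncomputable def lpc (η : ℝ) (A : V → V → Prop) (u v w : V) : ℝ :=
  -η * (lpQ A u v * lpQ A u w) + η * (lpP A u v * lpQ A u w + lpQ A u v * lpP A u w)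
  - η / 2 * (lpP A u v * lpB A u w + lpB A u v * lpP A u w)
  + η / 2 * (lpP A u v * lpZ A u w + lpZ A u v * lpP A u w)
  - η / 2 * (lpQ A u v * lpB A u w + lpB A u v * lpQ A u w)
  + 1 / 2 * (lpQ A u v * lpZ A u w + lpZ A u v * lpQ A u w)
  + 1 / 3 * (lpZ A u v * lpZ A u w)

/-- A triple with a sink. -/
def lpSink (A : V → V → Prop) (e : Finset V) : Prop :=
  ∃ x y z, e = {x, y, z} ∧ A y x ∧ A z x

theorem lpc_self_left (η : ℝ) (A : V → V → Prop) (irr : ∀ u, ¬ A u u) (u w : V) :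
    lpc η A u u w = 0 := by
  have := irr u
  simp [lpc, lpP, lpQ, lpB, lpZ, this]

theorem lpc_self_right (η : ℝ) (A : V → V → Prop) (irr : ∀ u, ¬ A u u) (u w : V) :
    lpc η A u w u = 0 := by
  have := irr u
  simp [lpc, lpP, lpQ, lpB, lpZ, this]

theorem lpc_diag (η : ℝ) (A : V → V → Prop) (u v : V) :
    lpc η A u v v = -η * lpQ A u v + 1 / 3 * lpZ A u v := by
  by_cases h1 : A u v <;> by_cases h2 : A v u <;> by_cases h3 : u = v <;>
    simp [lpc, lpP, lpQ, lpB, lpZ, h1, h2, h3]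

theorem lpSink_cases (A : V → V → Prop) (irr : ∀ u, ¬ A u u) {u v w : V}
    (huv : u ≠ v) (huw : u ≠ w) (hvw : v ≠ w) (h : lpSink A {u, v, w}) :
    (A v u ∧ A w u) ∨ (A u v ∧ A w v) ∨ (A u w ∧ A v w) := by
  obtain ⟨x, y, z, he, h1, h2⟩ := h
  have hu : u ∈ ({x, y, z} : Finset V) := by rw [← he]; simp
  have hv : v ∈ ({x, y, z} : Finset V) := by rw [← he]; simp
  have hw : w ∈ ({x, y, z} : Finset V) := by rw [← he]; simp
  simp only [Finset.mem_insert, Finset.mem_singleton] at hu hv hw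
  rcases hu with rfl | rfl | rfl <;> rcases hv with rfl | rfl | rfl <;>
    rcases hw with rfl | rfl | rfl <;> simp_all

open Classical in
theorem lpc_triple (η : ℝ) (h0 : 0 ≤ η) (h1 : η ≤ 1 / 3) (A : V → V → Prop)
    (irr : ∀ u, ¬ A u u) {u v w : V} (huv : u ≠ v) (huw : u ≠ w) (hvw : v ≠ w) :
    lpc η A u v w + lpc η A v u w + lpc η A w u v ≤ if lpSink A {u, v, w} then 0 else 1 := by
  have key : lpc η A u v w + lpc η A v u w + lpc η A w u v ≤
      if (A v u ∧ A w u) ∨ (A u v ∧ A w v) ∨ (A u w ∧ A v w) then 0 else 1 := by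
    by_cases a1 : A u v <;> by_cases a2 : A v u <;> by_cases a3 : A u w <;>
    by_cases a4 : A w u <;> by_cases a5 : A v w <;> by_cases a6 : A w v <;>
    simp [lpc, lpP, lpQ, lpB, lpZ, a1, a2, a3, a4, a5, a6, huv, huw, hvw, huv.symm, huw.symm,
      hvw.symm] <;> linarith
  refine key.trans ?_
  by_cases hs : lpSink A {u, v, w}
  · rw [if_pos (lpSink_cases A irr huv huw hvw hs), if_pos hs]
  · rw [if_neg hs]
    split_ifs <;> norm_num

theorem lp_six [Fintype V] (Q : Finset V → Prop) [DecidablePred Q] :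
    (∑ u : V, ∑ v : V, ∑ w : V,
      if u ≠ v ∧ u ≠ w ∧ v ≠ w ∧ Q {u, v, w} then (1 : ℝ) else 0) ≤
    6 * (((Finset.univ : Finset (Finset V)).filter (fun e => e.card = 3 ∧ Q e)).card : ℝ) := by
  let T : Finset (V × V × V) := Finset.univ.filter
    (fun t => t.1 ≠ t.2.1 ∧ t.1 ≠ t.2.2 ∧ t.2.1 ≠ t.2.2 ∧ Q {t.1, t.2.1, t.2.2})
  have h1 : (∑ u : V, ∑ v : V, ∑ w : V,
      if u ≠ v ∧ u ≠ w ∧ v ≠ w ∧ Q {u, v, w} then (1 : ℝ) else 0) = (T.card : ℝ) := by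
    simp only [T]
    rw [Finset.card_filter]
    push_cast
    rw [Fintype.sum_prod_type]
    refine Finset.sum_congr rfl fun u _ => ?_
    rw [Fintype.sum_prod_type]
  rw [h1]
  have h2 : T.card ≤ 6 * ((Finset.univ : Finset (Finset V)).filter
      (fun e => e.card = 3 ∧ Q e)).card := by
    apply Finset.card_le_mul_card_image_of_maps_to
      (f := fun t : V × V × V => ({t.1, t.2.1, t.2.2} : Finset V))
    · rintro ⟨u, v, w⟩ ht
      simp only [T, Finset.mem_filter, Finset.mem_univ, true_and] at ht ⊢
      exact ⟨Finset.card_eq_three.2 ⟨u, v, w, ht.1, ht.2.1, ht.2.2.1, rfl⟩, ht.2.2.2⟩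
    · intro e he
      simp only [Finset.mem_filter, Finset.mem_univ, true_and] at he
      obtain ⟨a, b, c, hab, hac, hbc, rfl⟩ := Finset.card_eq_three.1 he.1
      refine (Finset.card_le_card (t := {(a, b, c), (a, c, b), (b, a, c), (b, c, a), (c, a, b),
        (c, b, a)}) ?_).trans Finset.card_le_six
      rintro ⟨u, v, w⟩ ht
      simp only [T, Finset.mem_filter, Finset.mem_univ, true_and] at ht
      obtain ⟨⟨huv, huw, hvw, -⟩, he⟩ := ht
      have hu : u ∈ ({a, b, c} : Finset V) := by rw [← he]; simp
      have hv : v ∈ ({a, b, c} : Finset V) := by rw [← he]; simp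
      have hw : w ∈ ({a, b, c} : Finset V) := by rw [← he]; simp
      simp only [Finset.mem_insert, Finset.mem_singleton] at hu hv hw
      clear he
      rcases hu with rfl | rfl | rfl <;> rcases hv with rfl | rfl | rfl <;>
        rcases hw with rfl | rfl | rfl <;> simp_all
  exact_mod_cast h2

open Classical in
theorem lp_count [Fintype V] (η : ℝ) (h0 : 0 ≤ η) (h1 : η ≤ 1 / 3) (A : V → V → Prop)
    (irr : ∀ u, ¬ A u u) :
    ∑ u : V, lpF η (∑ v, lpP A u v) (∑ v, lpQ A u v) (∑ v, lpB A u v) (∑ v, lpZ A u v) ≤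
    (((Finset.univ : Finset (Finset V)).filter (fun e => e.card = 3 ∧ ¬ lpSink A e)).card : ℝ) := by
  let g : V → V → V → ℝ := fun u v w => if u ≠ v ∧ u ≠ w ∧ v ≠ w then lpc η A u v w else 0
  have hg : ∀ u, ∑ v, ∑ w, g u v w =
      2 * lpF η (∑ v, lpP A u v) (∑ v, lpQ A u v) (∑ v, lpB A u v) (∑ v, lpZ A u v) := by
    intro u
    have e1 : ∀ v w, g u v w = lpc η A u v w - if v = w then lpc η A u v v else 0 := by
      intro v w
      simp only [g]
      by_cases huv : u = v
      · subst huv; simp [lpc_self_left η A irr]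
      · by_cases huw : u = w
        · subst huw
          simp [lpc_self_right η A irr, Ne.symm huv, huv]
        · by_cases hvw : v = w
          · subst hvw; simp
          · simp [huv, huw, hvw]
    simp only [e1, Finset.sum_sub_distrib, Finset.sum_ite_eq, Finset.mem_univ, if_true, lpc_diag]
    simp only [lpc, Finset.sum_add_distrib, Finset.sum_sub_distrib, ← Finset.mul_sum]
    simp only [lpF, ← Finset.sum_mul]
    ring
  have hs1 : ∑ u, ∑ v, ∑ w, g v u w = ∑ u, ∑ v, ∑ w, g u v w := by
    rw [Finset.sum_comm]
  have hs2 : ∑ u, ∑ v, ∑ w, g w u v = ∑ u, ∑ v, ∑ w, g u v w := by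
    have : ∀ u, ∑ v, ∑ w, g w u v = ∑ w, ∑ v, g w u v := fun u => Finset.sum_comm
    simp only [this]
    rw [Finset.sum_comm]
  have hle : ∑ u, ∑ v, ∑ w, (g u v w + g v u w + g w u v) ≤
      ∑ u : V, ∑ v : V, ∑ w : V,
      if u ≠ v ∧ u ≠ w ∧ v ≠ w ∧ ¬ lpSink A {u, v, w} then (1 : ℝ) else 0 := by
    refine Finset.sum_le_sum fun u _ => Finset.sum_le_sum fun v _ => Finset.sum_le_sum fun w _ => ?_
    by_cases hd : u ≠ v ∧ u ≠ w ∧ v ≠ w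
    · have := lpc_triple η h0 h1 A irr hd.1 hd.2.1 hd.2.2
      have d2 : v ≠ u ∧ v ≠ w ∧ u ≠ w := ⟨hd.1.symm, hd.2.2, hd.2.1⟩
      have d3 : w ≠ u ∧ w ≠ v ∧ u ≠ v := ⟨hd.2.1.symm, hd.2.2.symm, hd.1⟩
      simp only [g]
      rw [if_pos hd, if_pos d2, if_pos d3]
      refine this.trans (le_of_eq ?_)
      by_cases hs : lpSink A {u, v, w}
      · simp [hs]
      · simp [hs, hd.1, hd.2.1, hd.2.2]
    · have d2 : ¬ (v ≠ u ∧ v ≠ w ∧ u ≠ w) := fun h => hd ⟨h.1.symm, h.2.2, h.2.1⟩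
      have d3 : ¬ (w ≠ u ∧ w ≠ v ∧ u ≠ v) := fun h => hd ⟨h.2.2, h.1.symm, h.2.1.symm⟩
      simp only [g]
      rw [if_neg hd, if_neg d2, if_neg d3]
      split_ifs <;> norm_num
  simp only [Finset.sum_add_distrib] at hle
  rw [hs1, hs2] at hle
  have h6 := hle.trans (lp_six (fun e => ¬ lpSink A e))
  simp only [hg, ← Finset.mul_sum] at h6
  linarith

/-- Basic facts on the local sums. -/
theorem lp_local [Fintype V] (A : V → V → Prop) (irr : ∀ u, ¬ A u u) (u : V) :
    (∑ v, lpP A u v) + (∑ v, lpQ A u v) + (∑ v, lpB A u v) + (∑ v, lpZ A u v)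
      = (Fintype.card V : ℝ) - 1 := by
  rw [← Finset.sum_add_distrib, ← Finset.sum_add_distrib, ← Finset.sum_add_distrib]
  have : ∀ v, lpP A u v + lpQ A u v + lpB A u v + lpZ A u v = 1 - if u = v then 1 else 0 := by
    intro v
    by_cases h : u = v
    · subst h; simp [lpP, lpQ, lpB, lpZ, irr u]
    · by_cases h1 : A u v <;> by_cases h2 : A v u <;> simp [lpP, lpQ, lpB, lpZ, h1, h2, h]
  simp only [this, Finset.sum_sub_distrib]
  simp

theorem lp_bal [Fintype V] (A : V → V → Prop) :
    ∑ u, ∑ v, lpP A u v = ∑ u, ∑ v, lpQ A u v := by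
  rw [Finset.sum_comm]
  refine Finset.sum_congr rfl fun u _ => Finset.sum_congr rfl fun v _ => ?_
  by_cases h1 : A u v <;> by_cases h2 : A v u <;> simp [lpP, lpQ, h1, h2]

theorem lp_outdeg [Fintype V] (A : V → V → Prop) (u : V) [DecidablePred (A u)] :
    (∑ v, lpP A u v) + (∑ v, lpB A u v) = ((Finset.univ.filter (fun v => A u v)).card : ℝ) := by
  rw [← Finset.sum_add_distrib, Finset.card_filter]
  push_cast
  refine Finset.sum_congr rfl fun v _ => ?_
  by_cases h1 : A u v <;> by_cases h2 : A v u <;> simp [lpP, lpB, h1, h2]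

theorem lp_nonneg [Fintype V] (A : V → V → Prop) (u : V) :
    0 ≤ (∑ v, lpP A u v) ∧ 0 ≤ (∑ v, lpQ A u v) ∧ 0 ≤ (∑ v, lpB A u v) ∧
      0 ≤ (∑ v, lpZ A u v) := by
  refine ⟨?_, ?_, ?_, ?_⟩ <;> refine Finset.sum_nonneg fun v _ => ?_
  · unfold lpP; split_ifs <;> norm_num
  · unfold lpQ; split_ifs <;> norm_num
  · unfold lpB; split_ifs <;> norm_num
  · unfold lpZ; split_ifs <;> norm_num

open Classical in
/-- Reduction of the Ramsey statement to a pointwise inequality. -/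
theorem lp_reduce (N n : ℕ) (hN : 0 < N) (η l : ℝ) (h0 : 0 ≤ η) (h1 : η ≤ 1 / 3)
    (hG : ∀ p q b z : ℝ, 0 ≤ p → 0 ≤ q → 0 ≤ b → 0 ≤ z → p + q + b + z = N - 1 → p + b ≤ n →
      0 < lpF η p q b z + l * (p - q) - N / 8 * (n - p - b) - 6 * n)
    (χ : Finset (Fin N) → Fin n) :
    ∃ i : Fin n, HasLoosePath ((Finset.univ : Finset (Finset (Fin N))).filter
      (fun e => e.card = 3 ∧ χ e = i)) := by
  by_contra! hcon
  have hst := fun i => lp_structure (V := Fin N)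
    (H := (Finset.univ : Finset (Finset (Fin N))).filter (fun e => e.card = 3 ∧ χ e = i))
    (fun e he => (Finset.mem_filter.1 he).2.1) (hcon i)
  choose S π hπ hc using hst
  let A : Fin N → Fin N → Prop := fun u v => ∃ i, u ∈ S i ∧ π i u = v
  have irr : ∀ u, ¬ A u u := by
    rintro u ⟨i, hi, h⟩; exact hπ i u hi h
  let d : Fin N → ℕ := fun u => (Finset.univ.filter (fun i => u ∈ S i)).card
  have hdn : ∀ u, d u ≤ n := by
    intro u
    refine (Finset.card_le_univ _).trans ?_
    simp
  have hout : ∀ u, (Finset.univ.filter (fun v => A u v)).card ≤ d u := by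
    intro u
    refine le_trans (Finset.card_le_card
      (t := (Finset.univ.filter (fun i => u ∈ S i)).image (fun i => π i u)) ?_)
      Finset.card_image_le
    intro v hv
    simp only [A, Finset.mem_filter, Finset.mem_univ, true_and, Finset.mem_image] at hv ⊢
    exact hv
  have hsumS : ∑ i, (S i).card = ∑ u, d u := by
    simp only [d, Finset.card_filter]
    rw [Finset.sum_comm]
    refine Finset.sum_congr rfl fun i _ => ?_
    simp
  let Us := (Finset.univ : Finset (Finset (Fin N))).filter (fun e => e.card = 3 ∧ ¬ lpSink A e)
  have hUs : Us.card ≤ ∑ i : Fin n, ((((Finset.univ : Finset (Finset (Fin N))).filter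
      (fun e => e.card = 3 ∧ χ e = i)).filter (fun e => ¬ LPCov (S i) (π i) e)).card) := by
    refine le_trans (Finset.card_le_card ?_) Finset.card_biUnion_le
    intro e he
    simp only [Us, Finset.mem_filter, Finset.mem_univ, true_and, Finset.mem_biUnion] at he ⊢
    refine ⟨χ e, ⟨he.1, rfl⟩, ?_⟩
    rintro ⟨x, y, z, rfl, hy, hz, hyx, hzx⟩
    exact he.2 ⟨x, y, z, rfl, ⟨_, hy, hyx⟩, ⟨_, hz, hzx⟩⟩
  have hUs' : 8 * (Us.card : ℝ) ≤ N * (∑ u, ((n : ℝ) - d u)) + 48 * n * N := by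
    have e1 : (8 * (Us.card : ℝ)) ≤ ∑ i : Fin n, ((N : ℝ) * (N - (S i).card) + 48 * N) := by
      have : (Us.card : ℝ) ≤ ∑ i : Fin n, ((((Finset.univ : Finset (Finset (Fin N))).filter
        (fun e => e.card = 3 ∧ χ e = i)).filter (fun e => ¬ LPCov (S i) (π i) e)).card : ℝ) := by
        exact_mod_cast hUs
      refine (mul_le_mul_of_nonneg_left this (by norm_num)).trans ?_
      rw [Finset.mul_sum]
      refine Finset.sum_le_sum fun i _ => ?_
      have h := hc i
      rw [Fintype.card_fin] at h
      have hle : (S i).card ≤ N := by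
        have := Finset.card_le_univ (S i); rwa [Fintype.card_fin] at this
      have h' : ((8 * ((((Finset.univ : Finset (Finset (Fin N))).filter
        (fun e => e.card = 3 ∧ χ e = i)).filter (fun e => ¬ LPCov (S i) (π i) e)).card) : ℕ) : ℝ)
        ≤ ((N * (N - (S i).card) + 48 * N : ℕ) : ℝ) := by exact_mod_cast h
      push_cast [Nat.cast_sub hle] at h'
      exact h'
    have e2 : ∑ i : Fin n, ((S i).card : ℝ) = ∑ u, (d u : ℝ) := by exact_mod_cast hsumS
    have e3 : ∑ i : Fin n, ((N : ℝ) * (N - (S i).card) + 48 * N)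
        = N * (∑ u, ((n : ℝ) - d u)) + 48 * n * N := by
      simp only [Finset.sum_add_distrib, ← Finset.mul_sum, Finset.sum_sub_distrib, e2]
      simp
      ring
    linarith
  have hcount := lp_count η h0 h1 A irr
  have hbal := lp_bal A
  have hpos : 0 < ∑ u : Fin N, (lpF η (∑ v, lpP A u v) (∑ v, lpQ A u v) (∑ v, lpB A u v)
      (∑ v, lpZ A u v) + l * ((∑ v, lpP A u v) - ∑ v, lpQ A u v)
      - N / 8 * (n - (∑ v, lpP A u v) - (∑ v, lpB A u v)) - 6 * n) := by
    apply Finset.sum_pos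
    · intro u _
      obtain ⟨a1, a2, a3, a4⟩ := lp_nonneg A u
      refine hG _ _ _ _ a1 a2 a3 a4 ?_ ?_
      · rw [lp_local A irr u, Fintype.card_fin]
      · rw [lp_outdeg]
        exact_mod_cast (hout u).trans (hdn u)
    · exact ⟨⟨0, hN⟩, Finset.mem_univ _⟩
  have hterm : ∑ u : Fin N, ((n : ℝ) - d u) ≤
      ∑ u : Fin N, ((n : ℝ) - (∑ v, lpP A u v) - (∑ v, lpB A u v)) := by
    refine Finset.sum_le_sum fun u _ => ?_
    have e1 := lp_outdeg A u
    have e2 : ((Finset.univ.filter (fun v => A u v)).card : ℝ) ≤ d u := by exact_mod_cast hout u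
    linarith
  have hsplit : ∑ u : Fin N, (lpF η (∑ v, lpP A u v) (∑ v, lpQ A u v) (∑ v, lpB A u v)
      (∑ v, lpZ A u v) + l * ((∑ v, lpP A u v) - ∑ v, lpQ A u v)
      - N / 8 * (n - (∑ v, lpP A u v) - (∑ v, lpB A u v)) - 6 * n) =
      (∑ u : Fin N, lpF η (∑ v, lpP A u v) (∑ v, lpQ A u v) (∑ v, lpB A u v) (∑ v, lpZ A u v))
      + l * ((∑ u, ∑ v, lpP A u v) - ∑ u, ∑ v, lpQ A u v)
      - N / 8 * (∑ u : Fin N, ((n : ℝ) - (∑ v, lpP A u v) - (∑ v, lpB A u v))) - N * (6 * n) := by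
    rw [Finset.sum_sub_distrib, Finset.sum_sub_distrib, Finset.sum_add_distrib, ← Finset.mul_sum,
      ← Finset.mul_sum, Finset.sum_sub_distrib (fun u => ∑ v, lpP A u v)]
    simp
  rw [hsplit, hbal, sub_self, mul_zero, add_zero] at hpos
  have hm : (N : ℝ) * (∑ u : Fin N, ((n : ℝ) - d u)) ≤
      N * ∑ u : Fin N, ((n : ℝ) - (∑ v, lpP A u v) - (∑ v, lpB A u v)) :=
    mul_le_mul_of_nonneg_left hterm (by positivity)
  have hUU : (Us.card : ℝ) = (((Finset.univ : Finset (Finset (Fin N))).filter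
    (fun e => e.card = 3 ∧ ¬ lpSink A e)).card : ℝ) := rfl
  linarith

end counting

section pointwise

theorem lp_point (N n η l : ℝ) (hη : 0 ≤ η) (hNn : n < N - 1)
    (hEq : ∀ b h : ℝ, 0 ≤ b → 0 ≤ h → b + h ≤ n →
      0 < (N - 1 - n + h) * (-η * (N - 1 - n + h) / 2 + η * (n - b - h) - η * b / 2 + η / 2 - l)
        - η / 2 * (n - b - h) * b + l * (n - b - h) - N / 8 * h - 6 * n)
    (hEz : ∀ b h : ℝ, 0 ≤ b → 0 ≤ h → b + h ≤ n →
      0 < (N - 1 - n + h) * (η / 2 * (n - b - h) + (N - 1 - n + h) / 6 - 1 / 6)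
        - η / 2 * (n - b - h) * b + l * (n - b - h) - N / 8 * h - 6 * n)
    (p q b z : ℝ) (hp : 0 ≤ p) (hq : 0 ≤ q) (hb : 0 ≤ b) (hz : 0 ≤ z)
    (hsum : p + q + b + z = N - 1) (hpb : p + b ≤ n) :
    0 < lpF η p q b z + l * (p - q) - N / 8 * (n - p - b) - 6 * n := by
  obtain ⟨h, rfl⟩ : ∃ h, p = n - b - h := ⟨n - b - p, by ring⟩
  have hh : 0 ≤ h := by linarith
  have h1 := hEq b h hb hh (by linarith)
  have h2 := hEz b h hb hh (by linarith)
  have hs : N - 1 - n + h = q + z := by linarith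
  rw [hs] at h1 h2
  have hs0 : 0 < q + z := by linarith
  by_contra! hcon
  have h3 := mul_nonneg (mul_nonneg hs0.le (mul_nonneg hq hz)) (by linarith : 0 ≤ η / 2 + 1 / 3)
  have h4 := mul_nonneg hs0.le (sub_nonneg.2 hcon)
  have hpos : ∀ a c : ℝ, 0 < a → 0 < c → 0 < q * a + z * c := by
    intro a c ha hc
    rcases hq.lt_or_eq with h | h
    · have := mul_pos h ha; have := mul_nonneg hz hc.le; linarith
    · have hz' : 0 < z := by linarith
      have := mul_pos hz' hc; have := mul_nonneg hq ha.le; linarith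
  have h5 := hpos _ _ h1 h2
  simp only [lpF] at h4
  nlinarith [h3, h4, h5]

theorem lp_point_gen (N n r : ℝ) (hr : 1.7 ≤ r) (hn : 3 ≤ n) (hnr : n = r ^ 2)
    (hN : 1.95 * n + 7 * r - 1 < N)
    (p q b z : ℝ) (hp : 0 ≤ p) (hq : 0 ≤ q) (hb : 0 ≤ b) (hz : 0 ≤ z)
    (hsum : p + q + b + z = N - 1) (hpb : p + b ≤ n) :
    0 < lpF (1 / 32) p q b z +
      (-(N - 1) * (1 / 6 + 1 / 64) + n * (1 / 6 + 1 / 32)) * (p - q) - N / 8 * (n - p - b) - 6 * n := by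
  obtain ⟨T, rfl⟩ : ∃ T, N = T + 1 := ⟨N - 1, by ring⟩
  have hT : 1.95 * n + 7 * r - 2 < T := by linarith
  have hr3 : 3 ≤ r ^ 2 := by linarith
  -- scalar conditions
  have c1 : 0 < (T - n) ^ 2 / 6 - (T - n) * n / 6 + n ^ 2 / 64 - (T - n) / 6 - 6 * n := by
    obtain ⟨d, hd, rfl⟩ : ∃ d, 0 < d ∧ T = 1.95 * n + 7 * r - 2 + d :=
      ⟨T - (1.95 * n + 7 * r - 2), by linarith, by ring⟩
    subst hnr
    have e1 : 0 < d * (0.9 * r ^ 2 + 14 * r - 5 + d) := by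
      apply mul_pos hd; nlinarith
    have e2 : 0 < 0.04625 * r ^ 4 + 6.3 * r ^ 3 + 10.25 * r ^ 2 - 35 * r + 6 := by
      nlinarith [sq_nonneg (r ^ 2), mul_nonneg (by linarith : 0 ≤ r) (by linarith : 0 ≤ r ^ 2 - 3)]
    nlinarith
  have c2 : 0 < T ^ 2 / 6 - n * T * (31 / 96) + T / 64 - n * (49 / 8) := by
    have e1 : 0.2 * n + 112 * r - 30.5 < 16 * T - 31 * n + 1.5 := by linarith
    have e0 : 0 < 0.2 * n + 112 * r - 30.5 := by linarith
    have e2 : (1.95 * n + 7 * r - 2) * (0.2 * n + 112 * r - 30.5) < T * (16 * T - 31 * n + 1.5) := by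
      apply mul_lt_mul'' hT e1 <;> linarith
    have e3 : 588 * n < (1.95 * n + 7 * r - 2) * (0.2 * n + 112 * r - 30.5) := by
      subst hnr
      nlinarith [sq_nonneg (r ^ 2), mul_nonneg (by linarith : 0 ≤ r) (by linarith : 0 ≤ r ^ 2 - 3)]
    nlinarith
  have hTn : 1.95 * n < T := by linarith
  apply lp_point (T + 1) n (1 / 32) _ (by norm_num) (by linarith) ?_ ?_ p q b z hp hq hb hz
    (by linarith) hpb
  · intro b h hb hh hbh
    have k1 : 0 ≤ b * (T * (1 / 6 - 1 / 32) - n / 6 - h / 32) :=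
      mul_nonneg hb (by linarith)
    have hn0 : 0 < n := by linarith
    have k2 : 0 < (n - h) * ((T - n) ^ 2 / 6 - (T - n) * n / 6 + n ^ 2 / 64 + (T - n) / 64 - 6 * n)
        + h * (T ^ 2 / 6 - n * T * (31 / 96) + T / 64 - n * (49 / 8)) := by
      have k3 : 0 < (T - n) ^ 2 / 6 - (T - n) * n / 6 + n ^ 2 / 64 + (T - n) / 64 - 6 * n := by
        linarith
      rcases hh.lt_or_eq with h' | h'
      · have := mul_pos h' c2
        have := mul_nonneg (by linarith : 0 ≤ n - h) k3.le
        linarith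
      · have := mul_pos (by linarith : 0 < n - h) k3
        have := mul_nonneg hh c2.le
        linarith
    have k4 : 0 ≤ n * (h * (n - h)) :=
      mul_nonneg hn0.le (mul_nonneg hh (by linarith))
    have k5 : 0 ≤ n * (b * (T * (1 / 6 - 1 / 32) - n / 6 - h / 32)) := mul_nonneg hn0.le k1
    have k6 : 0 ≤ n * b ^ 2 := by positivity
    refine pos_of_mul_pos_right (a := n) ?_ hn0.le
    have id : n * ((T + 1 - 1 - n + h) * (-(1 / 32) * (T + 1 - 1 - n + h) / 2 + 1 / 32 * (n - b - h) - 1 / 32 * b / 2 + 1 / 32 / 2 - (-(T + 1 - 1) * (1 / 6 + 1 / 64) + n * (1 / 6 + 1 / 32)))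
        - 1 / 32 / 2 * (n - b - h) * b + (-(T + 1 - 1) * (1 / 6 + 1 / 64) + n * (1 / 6 + 1 / 32)) * (n - b - h) - (T + 1) / 8 * h - 6 * n)
      = ((n - h) * ((T - n) ^ 2 / 6 - (T - n) * n / 6 + n ^ 2 / 64 + (T - n) / 64 - 6 * n)
        + h * (T ^ 2 / 6 - n * T * (31 / 96) + T / 64 - n * (49 / 8)))
        + 3 / 64 * (n * (h * (n - h))) + n * (b * (T * (1 / 6 - 1 / 32) - n / 6 - h / 32))
        + 1 / 64 * (n * b ^ 2) := by ring
    rw [id]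
    linarith
  · intro b h hb hh hbh
    have k1 : 0 ≤ b * (T * (1 / 6 - 1 / 32) - n / 6 - h / 32 + (T - n + h) / 32) :=
      mul_nonneg hb (by linarith)
    have k2 : 0 ≤ h * (3 / 8 * (T + 1) - n / 2 - 2 / 3) := mul_nonneg hh (by linarith)
    have id : (T + 1 - 1 - n + h) * (1 / 32 / 2 * (n - b - h) + (T + 1 - 1 - n + h) / 6 - 1 / 6)
        - 1 / 32 / 2 * (n - b - h) * b + (-(T + 1 - 1) * (1 / 6 + 1 / 64) + n * (1 / 6 + 1 / 32)) * (n - b - h) - (T + 1) / 8 * h - 6 * n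
      = ((T - n) ^ 2 / 6 - (T - n) * n / 6 + n ^ 2 / 64 - (T - n) / 6 - 6 * n)
        + h * (3 / 8 * (T + 1) - n / 2 - 2 / 3) + (1 / 6 - 1 / 64) * h ^ 2
        + b * (T * (1 / 6 - 1 / 32) - n / 6 - h / 32 + (T - n + h) / 32) + 1 / 64 * b ^ 2 := by ring
    rw [id]
    have := sq_nonneg h
    have := sq_nonneg b
    linarith

theorem lp_point_two
    (p q b z : ℝ) (hp : 0 ≤ p) (hq : 0 ≤ q) (hb : 0 ≤ b) (hz : 0 ≤ z)
    (hsum : p + q + b + z = 13 - 1) (hpb : p + b ≤ 2) :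
    0 < lpF (1 / 8) p q b z + (-12 * (1 / 6 + 1 / 16) + 2 * (1 / 6 + 1 / 8) + 3 / 16) * (p - q)
      - 13 / 8 * (2 - p - b) - 6 * 2 := by
  apply lp_point 13 2 (1 / 8) _ (by norm_num) (by norm_num) ?_ ?_ p q b z hp hq hb hz hsum hpb
  · intro b h hb hh hbh
    nlinarith [mul_nonneg hb hh, mul_nonneg hb (sub_nonneg.2 hbh), mul_nonneg hh (sub_nonneg.2 hbh)]
  · intro b h hb hh hbh
    nlinarith [mul_nonneg hb hh, mul_nonneg hb (sub_nonneg.2 hbh), mul_nonneg hh (sub_nonneg.2 hbh)]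

end pointwise

theorem lp_lam (lam : ℝ) (hmem : lam ∈ Set.Ioo (1.9 : ℝ) 2) (hroot : fpoly lam = 0) :
    1.95 < lam := by
  by_contra! hle
  obtain ⟨h1, -⟩ := hmem
  have h1' : 1.9 < lam := h1
  obtain ⟨t, rfl⟩ : ∃ t, lam = 1.9 + t := ⟨lam - 1.9, by ring⟩
  have ht0 : 0 < t := by linarith
  have ht1 : t ≤ 0.05 := by linarith
  unfold fpoly at hroot
  have hc1 : 0 ≤ (1.9 + t) ^ 3 - 3 * (1.9 + t) ^ 2 + 6 * (1.9 + t) - 6 := by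
    nlinarith [pow_pos ht0 3, pow_pos ht0 2]
  have hc2 : (1.9 + t) ^ 3 - 3 * (1.9 + t) ^ 2 + 6 * (1.9 + t) - 6 ≤ 1.75 := by
    nlinarith [pow_pos ht0 3, pow_pos ht0 2, mul_nonneg ht0.le (sub_nonneg.2 ht1),
      mul_nonneg (pow_pos ht0 2).le (sub_nonneg.2 ht1)]
  have hsq : ((1.9 + t) ^ 3 - 3 * (1.9 + t) ^ 2 + 6 * (1.9 + t) - 6) ^ 2 ≤ 1.75 ^ 2 :=
    pow_le_pow_left₀ hc1 hc2 2
  have e1 : 0.05 * 1.9 ≤ (1.9 + t) * (2 - (1.9 + t)) := by nlinarith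
  have e2 : 0.81 ≤ ((1.9 + t) - 1) ^ 2 := by nlinarith
  have e3 : (0.05 * 1.9) * 0.81 ≤ ((1.9 + t) * (2 - (1.9 + t))) * ((1.9 + t) - 1) ^ 2 :=
    mul_le_mul e1 e2 (by norm_num) (le_trans (by norm_num) e1)
  nlinarith

theorem ramsey_loosePath_upper (lam : ℝ) (hmem : lam ∈ Set.Ioo (1.9 : ℝ) 2)
    (hroot : fpoly lam = 0) (hpos : ∀ γ ∈ Set.Ioo lam (2 : ℝ), 0 < fpoly γ)
    (n : ℕ) (hn : 0 < n) :
    (RamseyP n : ℝ) ≤ lam * n + 7 * Real.sqrt n := by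
  have hlam := lp_lam lam hmem hroot
  have hr0 := Real.sqrt_nonneg (n : ℝ)
  have hr2 : Real.sqrt (n : ℝ) ^ 2 = n := Real.sq_sqrt (by positivity)
  rcases (by omega : n = 1 ∨ n = 2 ∨ 3 ≤ n) with h | h | h
  · subst h
    have : RamseyP 1 ≤ 8 := by
      apply Nat.sInf_le
      intro χ
      refine ⟨0, 0, 1, 2, 3, 4, 5, 6, by decide, ?_, ?_, ?_⟩ <;>
      · simp only [Finset.mem_filter, Finset.mem_univ, true_and]
        exact ⟨by decide, Subsingleton.elim _ _⟩
    have h8 : (RamseyP 1 : ℝ) ≤ 8 := by exact_mod_cast this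
    simp only [Nat.cast_one, Real.sqrt_one]
    linarith
  · subst h
    have : RamseyP 2 ≤ 13 := by
      apply Nat.sInf_le
      intro χ
      refine lp_reduce 13 2 (by norm_num) (1 / 8)
        (-12 * (1 / 6 + 1 / 16) + 2 * (1 / 6 + 1 / 8) + 3 / 16) (by norm_num) (by norm_num) ?_ χ
      intro p q b z hp hq hb hz hsum hpb
      push_cast at hsum hpb ⊢
      exact lp_point_two p q b z hp hq hb hz hsum hpb
    have h8 : (RamseyP 2 : ℝ) ≤ 13 := by exact_mod_cast this
    have h14 : 1.4 ≤ Real.sqrt ((2 : ℕ) : ℝ) := by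
      apply Real.le_sqrt_of_sq_le; norm_num
    push_cast at h14 ⊢
    linarith
  · have hn3 : (3 : ℝ) ≤ n := by exact_mod_cast h
    have hr : 1.7 ≤ Real.sqrt (n : ℝ) := by
      apply Real.le_sqrt_of_sq_le; norm_num; linarith
    have hX : 0 ≤ lam * n + 7 * Real.sqrt n := by
      have : 0 ≤ lam * n := mul_nonneg (by linarith) (by linarith)
      linarith
    have hNle := Nat.floor_le hX
    have hNlt := Nat.lt_floor_add_one (lam * n + 7 * Real.sqrt n)
    have hln : 1.95 * (n : ℝ) ≤ lam * n := mul_le_mul_of_nonneg_right hlam.le (by linarith)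
    refine le_trans ?_ hNle
    have : RamseyP n ≤ ⌊lam * n + 7 * Real.sqrt n⌋₊ := by
      apply Nat.sInf_le
      intro χ
      refine lp_reduce _ n ?_ (1 / 32)
        (-((⌊lam * n + 7 * Real.sqrt n⌋₊ : ℝ) - 1) * (1 / 6 + 1 / 64) + n * (1 / 6 + 1 / 32))
        (by norm_num) (by norm_num) ?_ χ
      · apply Nat.floor_pos.2; linarith
      intro p q b z hp hq hb hz hsum hpb
      exact lp_point_gen _ n (Real.sqrt n) hr hn3 hr2.symm (by linarith) p q b z hp hq hb hz hsum hpb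
    exact_mod_cast this
end

section
/- Let H be a 𝒫-free 3-graph on N ≥ 95 vertices such that for some integer s with (N+3)/2 ≤ s ≤ N − 46 one has |H| ≥ C(s−1, 2) + C(N−s, 2), and let V = V_R ∪ V_T ∪ V_S with H = H_R ∪ H_T ∪ H_S be a decomposition of H satisfying conditions (i)–(iii) of the decomposition lemma. Then H_S contains a star on at least s vertices. -/
open Finset

/-- `H` is quasi-bipartite with respect to the vertex set `W`. -/
def QuasiBipartite {V : Type*} [DecidableEq V] (W : Finset V) (H : Finset (Finset V)) : Prop :=
  ∃ (s t : ℕ) (x y : Fin s → V) (z : Fin t → V),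
    Function.Injective x ∧ Function.Injective y ∧ Function.Injective z ∧
    (∀ i j, x i ≠ y j) ∧ (∀ i j, x i ≠ z j) ∧ (∀ i j, y i ≠ z j) ∧
    (Finset.image x Finset.univ ∪ Finset.image y Finset.univ ∪ Finset.image z Finset.univ = W) ∧
    (∀ e ∈ H, ∃ i j, e = ({x i, y i, z j} : Finset V))

/-- `H` is a family of vertex-disjoint stars with centers in `C` and other vertices in `S`. -/
def DisjointStars {V : Type*} [DecidableEq V] (H : Finset (Finset V)) (C S : Finset V) : Prop :=
  ∃ c : Finset V → V,
    (∀ e ∈ H, c e ∈ e ∧ c e ∈ C ∧ ∀ x ∈ e, x ≠ c e → x ∈ S) ∧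
    (∀ e ∈ H, ∀ f ∈ H, c e ≠ c f → Disjoint e f)

theorem two_choose (n : ℕ) : 2 * ((n.choose 2 : ℕ) : ℝ) = (n : ℝ) ^ 2 - n := by
  rw [Nat.cast_choose_two]; ring

theorem sum_sq_le {ι : Type*} (A : Finset ι) (l : ι → ℕ) (M : ℝ)
    (h : ∀ i ∈ A, (l i : ℝ) ≤ M) :
    ∑ i ∈ A, ((l i : ℝ) ^ 2 - l i) ≤ (M - 1) * ∑ i ∈ A, (l i : ℝ) := by
  rw [Finset.mul_sum]
  apply Finset.sum_le_sum
  intro i hi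
  have h1 := h i hi
  have h2 : (0 : ℝ) ≤ l i := Nat.cast_nonneg _
  nlinarith

/-- Convexity bound for several star sizes, each at most `a`, with total at most `m`. -/
theorem sum_bound {ι : Type*} [DecidableEq ι] (A : Finset ι) (l : ι → ℕ) (a m : ℕ)
    (ha : 1 ≤ a) (hl : ∀ i ∈ A, l i ≤ a) (hs : ∑ i ∈ A, l i ≤ m) (h1 : a < m) (h2 : m ≤ 2 * a) :
    ∑ i ∈ A, ((l i : ℝ) ^ 2 - l i) ≤
      ((a : ℝ) ^ 2 - a) + (((m : ℝ) - a) ^ 2 - ((m : ℝ) - a)) := by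
  have ha' : (1 : ℝ) ≤ a := by exact_mod_cast ha
  have h1' : (a : ℝ) + 1 ≤ m := by exact_mod_cast h1
  have h2' : (m : ℝ) ≤ 2 * a := by exact_mod_cast h2
  have hs' : ∑ i ∈ A, (l i : ℝ) ≤ m := by exact_mod_cast hs
  have h0 : 0 ≤ ∑ i ∈ A, (l i : ℝ) := Finset.sum_nonneg (fun i _ => Nat.cast_nonneg _)
  by_cases hb : ∃ i ∈ A, m ≤ l i + a
  · obtain ⟨i, hi, hia⟩ := hb
    have hia' : (m : ℝ) ≤ l i + a := by exact_mod_cast hia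
    have hli : (l i : ℝ) ≤ a := by exact_mod_cast hl i hi
    rw [← Finset.add_sum_erase A _ hi]
    rw [← Finset.add_sum_erase A _ hi] at hs'
    set T := ∑ j ∈ A.erase i, (l j : ℝ) with hT
    have hT0 : 0 ≤ T := Finset.sum_nonneg (fun i _ => Nat.cast_nonneg _)
    have h3 := sum_sq_le (A.erase i) l T (fun j hj =>
      Finset.single_le_sum (f := fun j => (l j : ℝ)) (fun i _ => Nat.cast_nonneg _) hj)
    rw [← hT] at h3
    by_cases hT1 : T ≤ 1
    · have : (T - 1) * T ≤ 0 := by nlinarith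
      nlinarith
    · have h4 : (T - 1) * T ≤ (m - l i - 1) * (m - l i) := by nlinarith
      nlinarith [mul_nonneg (sub_nonneg.2 hli) (sub_nonneg.2 hia')]
  · push Not at hb
    have h3 := sum_sq_le A l ((m : ℝ) - a) (fun i hi => by
      have : (l i : ℝ) + a < m := by exact_mod_cast hb i hi
      linarith)
    have h4 : ((m : ℝ) - a - 1) * ∑ i ∈ A, (l i : ℝ) ≤ ((m : ℝ) - a - 1) * m :=
      mul_le_mul_of_nonneg_left hs' (by linarith)
    nlinarith

theorem num_small (a q m r t : ℝ) (ha : q + 1 ≤ a) (hq : 46 ≤ q) (hm0 : 0 ≤ m) (hm : m ≤ a)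
    (hr : 0 ≤ r) (ht : 0 ≤ t) (hsum : r + t + m = a + q + 2) :
    48 * r + t ^ 2 + 4 * (m ^ 2 - m) < 4 * ((a + 1) ^ 2 - (a + 1)) + 4 * (q ^ 2 - q) := by
  obtain ⟨j, rfl⟩ : ∃ j, m = a - j := ⟨a - m, by ring⟩
  have hj : 0 ≤ j := by linarith
  have hja : j ≤ a := by linarith
  have hu : r + t = q + 2 + j := by linarith
  have h1 : 48 * r + t ^ 2 ≤ (q + 2 + j) ^ 2 := by
    rw [← hu]; nlinarith [mul_nonneg hr ht]
  have h2 : 0 ≤ j * (3 * a - 2 * q - 8) := mul_nonneg hj (by linarith)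
  have h3 : 0 ≤ j * (a - j) := mul_nonneg hj (by linarith)
  nlinarith

theorem num_big (a q b r t : ℝ) (ha : q + 1 ≤ a) (hq : 46 ≤ q) (hb : 1 ≤ b)
    (hr : 0 ≤ r) (ht : 2 ≤ t) (hsum : r + t + b = q + 2) :
    48 * r + t ^ 2 + 4 * ((a ^ 2 - a) + (b ^ 2 - b)) <
      4 * ((a + 1) ^ 2 - (a + 1)) + 4 * (q ^ 2 - q) := by
  obtain ⟨u, rfl⟩ : ∃ u, t = 2 + u := ⟨t - 2, by ring⟩
  have hu : 0 ≤ u := by linarith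
  obtain rfl : b = q - r - u := by linarith
  have h1 : 0 ≤ (r + u) * (q - r - u - 1) := mul_nonneg (by linarith) (by linarith)
  have h2 : 0 ≤ r * (q - 46) := mul_nonneg hr (by linarith)
  have h3 : 0 ≤ u * (q - 46) := mul_nonneg hu (by linarith)
  have h4 : 0 ≤ u * (q - r - u - 1) := mul_nonneg hu (by linarith)
  nlinarith [mul_nonneg hr hu]

theorem num_one (a q r t : ℝ) (ha : q + 1 ≤ a) (hq : 46 ≤ q)
    (hr : 0 ≤ r) (ht : 0 ≤ t) (ht1 : t ≤ 1) (hsum : r + t ≤ q + 2) :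
    48 * r + t ^ 2 + 4 * (a ^ 2 - a) <
      4 * ((a + 1) ^ 2 - (a + 1)) + 4 * (q ^ 2 - q) := by
  nlinarith

theorem bigstar (N : ℕ) (hN : 95 ≤ N)
    (H : Finset (Finset (Fin N))) (h3 : ∀ e ∈ H, e.card = 3)
    (hfree : ¬ HasLoosePath H)
    (s : ℕ) (hs1 : ((N : ℝ) + 3) / 2 ≤ (s : ℝ)) (hs2 : s ≤ N - 46)
    (hH : (s - 1).choose 2 + (N - s).choose 2 ≤ H.card)
    (VR VT VS : Finset (Fin N))
    (hd1 : Disjoint VR VT) (hd2 : Disjoint VR VS) (hd3 : Disjoint VT VS)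
    (hunion : VR ∪ VT ∪ VS = Finset.univ)
    (hR : (H.filter (fun e => (e ∩ VR).Nonempty)).card ≤ 6 * VR.card)
    (hTqb : QuasiBipartite VT (H.filter (fun e => e ⊆ VT)))
    (hTcard : ((H.filter (fun e => e ⊆ VT)).card : ℝ) ≤ (VT.card : ℝ) ^ 2 / 8)
    (hSstars : DisjointStars (H.filter (fun e => e ∩ VR = ∅ ∧ (e ∩ VS).Nonempty)) VT VS)
    (hScard : (H.filter (fun e => e ∩ VR = ∅ ∧ (e ∩ VS).Nonempty)).card ≤ VS.card.choose 2) :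
    ∃ (w : Fin N) (F : Finset (Finset (Fin N))),
      F ⊆ H.filter (fun e => e ∩ VR = ∅ ∧ (e ∩ VS).Nonempty) ∧
      (∀ e ∈ F, w ∈ e) ∧ s ≤ (F.biUnion id).card := by
  by_contra hcon
  push Not at hcon
  obtain ⟨c, hc1, hc2⟩ := hSstars
  set HS := H.filter (fun e => e ∩ VR = ∅ ∧ (e ∩ VS).Nonempty) with hHS
  have hsN : N + 3 ≤ 2 * s := by
    have : (N : ℝ) + 3 ≤ 2 * s := by linarith
    exact_mod_cast this
  obtain ⟨a, rfl⟩ : ∃ a, s = a + 2 := ⟨s - 2, by omega⟩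
  obtain ⟨q, hq⟩ : ∃ q, N = a + 2 + q := ⟨N - (a + 2), by omega⟩
  have e1 : a + 2 - 1 = a + 1 := by omega
  have e2 : N - (a + 2) = q := by omega
  rw [e1, e2] at hH
  have hcards : VR.card + VT.card + VS.card = N := by
    rw [← Finset.card_union_of_disjoint hd1, ← Finset.card_union_of_disjoint
      (Finset.disjoint_union_left.2 ⟨hd2, hd3⟩), hunion, Finset.card_univ, Fintype.card_fin]
  -- total count
  have htot : H.card ≤ (H.filter (fun e => (e ∩ VR).Nonempty)).card
      + (H.filter (fun e => e ⊆ VT)).card + HS.card := by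
    have hsub : H ⊆ (H.filter (fun e => (e ∩ VR).Nonempty)) ∪ (H.filter (fun e => e ⊆ VT)) ∪ HS := by
      intro e he
      simp only [hHS, Finset.mem_union, Finset.mem_filter, he, true_and]
      by_cases hA : (e ∩ VR).Nonempty
      · exact Or.inl (Or.inl hA)
      by_cases hB : (e ∩ VS).Nonempty
      · exact Or.inr ⟨Finset.not_nonempty_iff_eq_empty.1 hA, hB⟩
      refine Or.inl (Or.inr ?_)
      intro x hx
      have hxu : x ∈ VR ∪ VT ∪ VS := hunion ▸ Finset.mem_univ x
      simp only [Finset.mem_union] at hxu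
      rcases hxu with (h | h) | h
      · exact absurd ⟨x, Finset.mem_inter.2 ⟨hx, h⟩⟩ hA
      · exact h
      · exact absurd ⟨x, Finset.mem_inter.2 ⟨hx, h⟩⟩ hB
    exact (Finset.card_le_card hsub).trans ((Finset.card_union_le _ _).trans
      (Nat.add_le_add_right (Finset.card_union_le _ _) _))
  -- the stars and their leaf sets
  let F : Fin N → Finset (Finset (Fin N)) := fun w => HS.filter (fun e => c e = w)
  let L : Fin N → Finset (Fin N) := fun w => ((F w).biUnion id).erase w
  have hmemF : ∀ w e, e ∈ F w ↔ e ∈ HS ∧ c e = w := fun w e => Finset.mem_filter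
  have hwF : ∀ w, ∀ e ∈ F w, w ∈ e := by
    intro w e he
    obtain ⟨h1, h2⟩ := (hmemF w e).1 he
    exact h2 ▸ (hc1 e h1).1
  have hLmem : ∀ w x, x ∈ L w ↔ x ≠ w ∧ ∃ e ∈ F w, x ∈ e := by
    intro w x
    simp [L]
  have hLVS : ∀ w, L w ⊆ VS := by
    intro w x hx
    obtain ⟨hxw, e, he, hxe⟩ := (hLmem w x).1 hx
    obtain ⟨h1, h2⟩ := (hmemF w e).1 he
    exact (hc1 e h1).2.2 x hxe (by rw [h2]; exact hxw)
  have hLa : ∀ w ∈ VT, (L w).card ≤ a := by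
    intro w _
    have h1 := hcon w (F w) (Finset.filter_subset _ _) (hwF w)
    by_cases hne : (F w).Nonempty
    · obtain ⟨e, he⟩ := hne
      have hw : w ∈ (F w).biUnion id := Finset.mem_biUnion.2 ⟨e, he, hwF w e he⟩
      have h2 := Finset.card_erase_add_one hw
      have h3 : (L w).card = (((F w).biUnion id).erase w).card := rfl
      omega
    · have h4 : F w = ∅ := Finset.not_nonempty_iff_eq_empty.1 hne
      simp [L, h4]
  have hLdisj : (VT : Set (Fin N)).PairwiseDisjoint L := by
    intro w _ w' _ hne
    refine Finset.disjoint_left.2 ?_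
    intro x hx hx'
    obtain ⟨_, e, he, hxe⟩ := (hLmem w x).1 hx
    obtain ⟨_, f, hf, hxf⟩ := (hLmem w' x).1 hx'
    obtain ⟨h1, h2⟩ := (hmemF w e).1 he
    obtain ⟨h3, h4⟩ := (hmemF w' f).1 hf
    exact Finset.disjoint_left.1 (hc2 e h1 f h3 (by rw [h2, h4]; exact hne)) hxe hxf
  have hLsum : ∑ w ∈ VT, (L w).card ≤ VS.card := by
    rw [← Finset.card_biUnion hLdisj]
    exact Finset.card_le_card (Finset.biUnion_subset.2 fun w _ => hLVS w)
  have hFcard : ∀ w, (F w).card ≤ (L w).card.choose 2 := by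
    intro w
    rw [← Finset.card_powersetCard]
    apply Finset.card_le_card_of_injOn (fun e => e.erase w)
    · intro e he
      have he' : e ∈ F w := he
      have h1 := ((hmemF w e).1 he').1
      have h2 := h3 e (Finset.mem_filter.1 h1).1
      refine Finset.mem_coe.2 (Finset.mem_powersetCard.2 ⟨?_, ?_⟩)
      · intro x hx
        obtain ⟨hx1, hx2⟩ := Finset.mem_erase.1 hx
        exact (hLmem w x).2 ⟨hx1, e, he', hx2⟩
      · rw [Finset.card_erase_of_mem (hwF w e he'), h2]
    · intro e he f hf hef
      have hef' : e.erase w = f.erase w := hef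
      rw [← Finset.insert_erase (hwF w e he), hef', Finset.insert_erase (hwF w f hf)]
  have hHSsum : HS.card ≤ ∑ w ∈ VT, (L w).card.choose 2 := by
    rw [Finset.card_eq_sum_card_fiberwise (f := c) (t := VT) (fun e he => (hc1 e he).2.1)]
    exact Finset.sum_le_sum fun w _ => hFcard w
  -- pass to real numbers
  have hHSr : 2 * (HS.card : ℝ) ≤ ∑ w ∈ VT, (((L w).card : ℝ) ^ 2 - (L w).card) := by
    have h1 : (HS.card : ℝ) ≤ ∑ w ∈ VT, (((L w).card.choose 2 : ℕ) : ℝ) := by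
      exact_mod_cast hHSsum
    have h2 : ∑ w ∈ VT, (((L w).card : ℝ) ^ 2 - (L w).card)
        = 2 * ∑ w ∈ VT, (((L w).card.choose 2 : ℕ) : ℝ) := by
      rw [Finset.mul_sum]
      exact Finset.sum_congr rfl fun w _ => (two_choose _).symm
    linarith
  have hSr : 2 * (HS.card : ℝ) ≤ (VS.card : ℝ) ^ 2 - VS.card := by
    rw [← two_choose]
    have : (HS.card : ℝ) ≤ ((VS.card.choose 2 : ℕ) : ℝ) := by exact_mod_cast hScard
    linarith
  have hHr : (((a + 1).choose 2 : ℕ) : ℝ) + ((q.choose 2 : ℕ) : ℝ) ≤ H.card := by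
    exact_mod_cast hH
  have t1 := two_choose (a + 1)
  have t2 := two_choose q
  push_cast at t1
  have htotr : (H.card : ℝ) ≤ ((H.filter (fun e => (e ∩ VR).Nonempty)).card : ℝ)
      + ((H.filter (fun e => e ⊆ VT)).card : ℝ) + HS.card := by exact_mod_cast htot
  have hRr : ((H.filter (fun e => (e ∩ VR).Nonempty)).card : ℝ) ≤ 6 * VR.card := by
    exact_mod_cast hR
  have haq : (q : ℝ) + 1 ≤ a := by
    have : q + 1 ≤ a := by omega
    exact_mod_cast this
  have hq46 : (46 : ℝ) ≤ q := by
    have : 46 ≤ q := by omega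
    exact_mod_cast this
  have hcr : (VR.card : ℝ) + VT.card + VS.card = a + q + 2 := by
    have : VR.card + VT.card + VS.card = a + q + 2 := by omega
    exact_mod_cast this
  have p1 : (0 : ℝ) ≤ VR.card := Nat.cast_nonneg _
  have p2 : (0 : ℝ) ≤ VT.card := Nat.cast_nonneg _
  have p3 : (0 : ℝ) ≤ VS.card := Nat.cast_nonneg _
  by_cases hma : VS.card ≤ a
  · have hma' : (VS.card : ℝ) ≤ a := by exact_mod_cast hma
    have := num_small a q VS.card VR.card VT.card haq hq46 p3 hma' p1 p2 hcr
    linarith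
  have hma' : (a : ℝ) + 1 ≤ VS.card := by
    have : a + 1 ≤ VS.card := by omega
    exact_mod_cast this
  by_cases ht : 2 ≤ VT.card
  · have ht' : (2 : ℝ) ≤ VT.card := by exact_mod_cast ht
    have h5 := sum_bound VT (fun w => (L w).card) a VS.card (by omega) hLa hLsum (by omega)
      (by omega)
    have := num_big a q ((VS.card : ℝ) - a) VR.card VT.card haq hq46 (by linarith) p1 ht'
      (by linarith)
    linarith
  · have ht1 : (VT.card : ℝ) ≤ 1 := by
      have : VT.card ≤ 1 := by omega
      exact_mod_cast this
    have h6 : ∑ w ∈ VT, (((L w).card : ℝ) ^ 2 - (L w).card) ≤ (a : ℝ) ^ 2 - a := by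
      have h7 : ∀ w ∈ VT, (((L w).card : ℝ) ^ 2 - (L w).card) ≤ (a : ℝ) ^ 2 - a := by
        intro w hw
        rw [← two_choose, ← two_choose]
        have : (((L w).card.choose 2 : ℕ) : ℝ) ≤ ((a.choose 2 : ℕ) : ℝ) := by
          exact_mod_cast Nat.choose_le_choose 2 (hLa w hw)
        linarith
      have h8 := Finset.sum_le_card_nsmul VT _ _ h7
      rw [nsmul_eq_mul] at h8
      have h9 : (0 : ℝ) ≤ (a : ℝ) ^ 2 - a := by
        rw [← two_choose]; positivity
      exact h8.trans (mul_le_of_le_one_left h9 ht1)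
    have := num_one a q VR.card VT.card haq hq46 p1 p2 ht1 (by linarith)
    linarith
end

section
/- Under the coloring setup, at least β·n colors are rich, where β = (γ³ − 3γ² + 6γ − 6)/(6(γ−1)); that is, |I| ≥ β·n. -/
open Finset

/-- `C(x, 2) = x (x − 1) / 2` for a real number `x`. -/
noncomputable def realChoose2 (x : ℝ) : ℝ := x * (x - 1) / 2

/-- The 3-graph formed by the triples of color `i`. -/
def colorClass {n N : ℕ} (χ : Finset (Fin N) → Fin n) (i : Fin n) :
    Finset (Finset (Fin N)) :=
  Finset.univ.filter (fun e => e.card = 3 ∧ χ e = i)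

/-- The color `i` is rich: `|H_i| ≥ C(n + 6√n − 1, 2) + C(N − n − 6√n, 2)`. -/
noncomputable def Rich (n N : ℕ) (χ : Finset (Fin N) → Fin n) (i : Fin n) : Prop :=
  realChoose2 ((n : ℝ) + 6 * Real.sqrt n - 1) + realChoose2 ((N : ℝ) - n - 6 * Real.sqrt n)
    ≤ ((colorClass χ i).card : ℝ)

section LoosePath

variable {V : Type*} [DecidableEq V]

/-- The edges of `H` containing both `c` and `d`. -/
def codEdges (H : Finset (Finset V)) (c d : V) : Finset (Finset V) :=
  H.filter (fun e => c ∈ e ∧ d ∈ e)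

lemma codEdges_comm (H : Finset (Finset V)) (c d : V) : codEdges H c d = codEdges H d c := by
  ext e; simp only [codEdges, mem_filter]; tauto

/-- A pair is heavy if its codegree is at least 5. -/
def Heavy (H : Finset (Finset V)) (c d : V) : Prop := c ≠ d ∧ 5 ≤ (codEdges H c d).card

lemma Heavy.symm' {H : Finset (Finset V)} {c d : V} (h : Heavy H c d) : Heavy H d c :=
  ⟨h.1.symm, by rw [codEdges_comm]; exact h.2⟩

lemma exists_third {e : Finset V} (he : e.card = 3) {c d : V} (hc : c ∈ e) (hd : d ∈ e)
    (hcd : c ≠ d) : ∃ z, z ≠ c ∧ z ≠ d ∧ e = {c, d, z} := by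
  have h1 : ((e.erase c).erase d).card = 1 := by
    rw [card_erase_of_mem (by simp [hd, hcd.symm]), card_erase_of_mem hc, he]
  obtain ⟨z, hz⟩ := card_eq_one.1 h1
  have hz' : z ∈ (e.erase c).erase d := by rw [hz]; simp
  simp only [mem_erase] at hz'
  refine ⟨z, hz'.2.1, hz'.1, ?_⟩
  rw [← hz, insert_erase (by simp [hd, hcd.symm]), insert_erase hc]

lemma exists_two {e : Finset V} (he : e.card = 3) {c : V} (hc : c ∈ e) :
    ∃ d z, c ≠ d ∧ z ≠ c ∧ z ≠ d ∧ e = {c, d, z} := by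
  have : (e.erase c).Nonempty := by
    rw [← card_pos, card_erase_of_mem hc, he]; norm_num
  obtain ⟨d, hd⟩ := this
  rw [mem_erase] at hd
  obtain ⟨z, h1, h2, h3⟩ := exists_third he hc hd.2 hd.1.symm
  exact ⟨d, z, hd.1.symm, h1, h2, h3⟩

lemma ext_pair {H : Finset (Finset V)} (h3 : ∀ e ∈ H, e.card = 3) {c x : V} (hcx : c ≠ x)
    (F : Finset V) (hF : F.card < (codEdges H c x).card) :
    ∃ z, z ∉ F ∧ z ≠ c ∧ z ≠ x ∧ ({c, x, z} : Finset V) ∈ H := by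
  by_contra hcon
  push Not at hcon
  have hsub : codEdges H c x ⊆ F.image (fun z => ({c, x, z} : Finset V)) := by
    intro e he
    simp only [codEdges, mem_filter] at he
    obtain ⟨z, h1, h2, rfl⟩ := exists_third (h3 e he.1) he.2.1 he.2.2 hcx
    rw [mem_image]
    refine ⟨z, ?_, rfl⟩
    by_contra hz
    exact hcon z hz h1 h2 he.1
  have := (card_le_card hsub).trans card_image_le
  omega

lemma cod_le {H : Finset (Finset V)} (h3 : ∀ e ∈ H, e.card = 3) {S : Finset V}
    (hS : ∀ e ∈ H, e ⊆ S) {c x : V} (hcx : c ≠ x) : (codEdges H c x).card ≤ S.card := by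
  by_contra hcon
  obtain ⟨z, hz, _, _, h⟩ := ext_pair h3 hcx S (by omega)
  exact hz (hS _ h (by simp))

/-- Two heavy pairs at the ends of an edge give a loose path. -/
lemma path_of_heavy {H : Finset (Finset V)} (h3 : ∀ e ∈ H, e.card = 3) {c d e x y : V}
    (hcd : c ≠ d) (hce : c ≠ e) (hde : d ≠ e) (hE : ({c, d, e} : Finset V) ∈ H)
    (hx : Heavy H c x) (hy : Heavy H e y) (hxd : x ≠ d) (hxe : x ≠ e) (hyc : y ≠ c)
    (hyd : y ≠ d) (hxy : x ≠ y) : HasLoosePath H := by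
  obtain ⟨z, hz, hzc, hzx, hzE⟩ := ext_pair h3 hx.1 {d, e, y}
    (lt_of_le_of_lt card_le_three (by have := hx.2; omega))
  obtain ⟨w, hw, hwe, hwy, hwE⟩ := ext_pair h3 hy.1 {c, d, x, z}
    (lt_of_le_of_lt card_le_four (by have := hy.2; omega))
  simp only [mem_insert, mem_singleton, not_or] at hz hw
  have hcx := hx.1
  have hey := hy.1
  refine ⟨x, z, c, d, e, y, w, ?_, ?_, hE, hwE⟩
  · simp only [List.nodup_cons, List.mem_cons, List.not_mem_nil, or_false, not_or]
    simp only [List.nodup_nil, not_false_eq_true, and_true]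
    grind
  · convert hzE using 1
    ext a; simp only [mem_insert, mem_singleton]; tauto

/-- The edges at `c` none of whose pairs through `c` is heavy. -/
noncomputable def lightEdges (H : Finset (Finset V)) (c : V) : Finset (Finset V) :=
  by classical exact H.filter (fun e => c ∈ e ∧ ∀ x ∈ e, ¬ Heavy H c x)

lemma mem_lightEdges {H : Finset (Finset V)} {c : V} {e : Finset V} :
    e ∈ lightEdges H c ↔ e ∈ H ∧ c ∈ e ∧ ∀ x ∈ e, ¬ Heavy H c x := by
  simp [lightEdges]

lemma light_filter_le (H : Finset (Finset V)) {c x : V} (hcx : c ≠ x) :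
    ((lightEdges H c).filter (fun e => x ∈ e)).card ≤ 4 := by
  by_cases hx : Heavy H c x
  · rw [filter_eq_empty_iff.2]
    · simp
    · intro e he hxe
      exact (mem_lightEdges.1 he).2.2 x hxe hx
  · have h5 : (codEdges H c x).card < 5 := by
      by_contra h; exact hx ⟨hcx, by omega⟩
    have hsub : (lightEdges H c).filter (fun e => x ∈ e) ⊆ codEdges H c x := by
      intro e he
      rw [mem_filter, mem_lightEdges] at he
      simp only [codEdges, mem_filter]
      exact ⟨he.1.1, he.1.2.1, he.2⟩
    have := card_le_card hsub
    omega

lemma light_avoid {H : Finset (Finset V)} {c : V} (hl : 17 ≤ (lightEdges H c).card)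
    (F : Finset V) (hF : F.card ≤ 4) (hc : c ∉ F) :
    ∃ e ∈ lightEdges H c, ∀ x ∈ F, x ∉ e := by
  by_contra hcon
  push Not at hcon
  have hsub : lightEdges H c ⊆ F.biUnion (fun x => (lightEdges H c).filter (fun e => x ∈ e)) := by
    intro e he
    obtain ⟨x, hx, hxe⟩ := hcon e he
    simp only [mem_biUnion, mem_filter]
    exact ⟨x, hx, he, hxe⟩
  have h1 := (card_le_card hsub).trans (card_biUnion_le_card_mul _ _ 4
    (fun x hx => light_filter_le H (fun h => hc (h ▸ hx))))
  omega

lemma light_le {H : Finset (Finset V)} (h3 : ∀ e ∈ H, e.card = 3) {S : Finset V}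
    (hS : ∀ e ∈ H, e ⊆ S)
    (hdeg : ∀ v ∈ S, S.card + 31 ≤ (H.filter (fun e => v ∈ e)).card)
    (hfree : ¬ HasLoosePath H) (c : V) : (lightEdges H c).card ≤ 16 := by
  by_contra hcon
  have hl : 17 ≤ (lightEdges H c).card := by omega
  obtain ⟨f0, hf0⟩ := card_pos.1 (show 0 < (lightEdges H c).card by omega)
  have hf := mem_lightEdges.1 hf0
  obtain ⟨d, e, hcd, hec, hed, rfl⟩ := exists_two (h3 _ hf.1) hf.2.1
  have heS : e ∈ S := hS _ hf.1 (by simp)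
  have hsub : H.filter (fun f => e ∈ f) ⊆ codEdges H e c ∪ codEdges H e d := by
    intro f hfm
    rw [mem_filter] at hfm
    obtain ⟨a, b, hea, hbe, hba, rfl⟩ := exists_two (h3 _ hfm.1) hfm.2
    simp only [codEdges, mem_union, mem_filter]
    by_contra hno
    have hc' : c ∉ ({e, a, b} : Finset V) := fun h => hno (Or.inl ⟨hfm.1, hfm.2, h⟩)
    have hd' : d ∉ ({e, a, b} : Finset V) := fun h => hno (Or.inr ⟨hfm.1, hfm.2, h⟩)
    simp only [mem_insert, mem_singleton, not_or] at hc' hd'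
    obtain ⟨g, hg, hgF⟩ := light_avoid hl {d, e, a, b} card_le_four
      (by simp only [mem_insert, mem_singleton, not_or]; exact ⟨hcd, hc'⟩)
    have hg' := mem_lightEdges.1 hg
    obtain ⟨x, y, hcx, hyc, hyx, rfl⟩ := exists_two (h3 _ hg'.1) hg'.2.1
    simp only [mem_insert, mem_singleton, forall_eq_or_imp, forall_eq, not_or] at hgF
    apply hfree
    refine ⟨x, y, c, d, e, a, b, ?_, ?_, hf.1, hfm.1⟩
    · simp only [List.nodup_cons, List.mem_cons, List.not_mem_nil, or_false, not_or]
      simp only [List.nodup_nil, not_false_eq_true, and_true]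
      grind
    · convert hg'.1 using 1
      ext a; simp only [mem_insert, mem_singleton]; tauto
  have h1 := (card_le_card hsub).trans (card_union_le _ _)
  have h2 := hdeg e heS
  have h4 := cod_le h3 hS hed
  refine hf.2.2 e (by simp) ⟨hec.symm, ?_⟩
  rw [codEdges_comm]
  omega

/-- The heavy neighbours of `c` in `S`. -/
noncomputable def heavyNbrs (H : Finset (Finset V)) (S : Finset V) (c : V) : Finset V :=
  by classical exact S.filter (fun x => Heavy H c x)

lemma mem_heavyNbrs {H : Finset (Finset V)} {S : Finset V} {c x : V} :
    x ∈ heavyNbrs H S c ↔ x ∈ S ∧ Heavy H c x := by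
  simp [heavyNbrs]

lemma two_le_heavy {H : Finset (Finset V)} (h3 : ∀ e ∈ H, e.card = 3) {S : Finset V}
    (hS : ∀ e ∈ H, e ⊆ S)
    (hdeg : ∀ v ∈ S, S.card + 31 ≤ (H.filter (fun e => v ∈ e)).card)
    (hfree : ¬ HasLoosePath H) {c : V} (hc : c ∈ S) : 2 ≤ (heavyNbrs H S c).card := by
  by_contra hcon
  have hsub : H.filter (fun f => c ∈ f) ⊆
      lightEdges H c ∪ (heavyNbrs H S c).biUnion (fun x => codEdges H c x) := by
    intro f hf
    rw [mem_filter] at hf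
    rw [mem_union, mem_lightEdges, mem_biUnion]
    by_cases h : ∀ x ∈ f, ¬ Heavy H c x
    · exact Or.inl ⟨hf.1, hf.2, h⟩
    · push Not at h
      obtain ⟨x, hx, hh⟩ := h
      refine Or.inr ⟨x, mem_heavyNbrs.2 ⟨hS f hf.1 hx, hh⟩, ?_⟩
      simp only [codEdges, mem_filter]
      exact ⟨hf.1, hf.2, hx⟩
  have h1 := (card_le_card hsub).trans (card_union_le _ _)
  have h2 : ((heavyNbrs H S c).biUnion (fun x => codEdges H c x)).card ≤
      (heavyNbrs H S c).card * S.card := card_biUnion_le_card_mul _ _ _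
    (fun x hx => cod_le h3 hS (mem_heavyNbrs.1 hx).2.1)
  have h4 := hdeg c hc
  have h5 := light_le h3 hS hdeg hfree c
  have h6 : (heavyNbrs H S c).card * S.card ≤ 1 * S.card :=
    Nat.mul_le_mul_right _ (by omega)
  omega

/-- A 3-graph with large minimum degree contains a loose path. -/
lemma path_of_minDegree {H : Finset (Finset V)} (h3 : ∀ e ∈ H, e.card = 3) {S : Finset V}
    (hS : ∀ e ∈ H, e ⊆ S) (hne : S.Nonempty)
    (hdeg : ∀ v ∈ S, S.card + 31 ≤ (H.filter (fun e => v ∈ e)).card) : HasLoosePath H := by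
  by_contra hfree
  have h2 : ∀ c ∈ S, 2 ≤ (heavyNbrs H S c).card :=
    fun c hc => two_le_heavy h3 hS hdeg hfree hc
  have pick : ∀ (c : V) (F : Finset V), F.card < (heavyNbrs H S c).card →
      ∃ x, x ∈ S ∧ Heavy H c x ∧ x ∉ F := by
    intro c F hF
    obtain ⟨x, hx, hxF⟩ := exists_mem_notMem_of_card_lt_card hF
    exact ⟨x, (mem_heavyNbrs.1 hx).1, (mem_heavyNbrs.1 hx).2, hxF⟩
  have hle : ∀ v ∈ S, (heavyNbrs H S v).card ≤ 3 := by
    intro v hv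
    by_contra h4
    obtain ⟨u, hu, hvu, -⟩ := pick v ∅ (by rw [card_empty]; have := h2 v hv; omega)
    obtain ⟨x, hx, hux, hxv⟩ := pick u {v} (by simp; have := h2 u hu; omega)
    obtain ⟨w, hw, hwu, hwv, hE⟩ := ext_pair h3 hvu.1 {x}
      (by simp; have := hvu.2; omega)
    obtain ⟨y, hy, hvy, hyF⟩ := pick v {u, w, x}
      (lt_of_le_of_lt card_le_three (by omega))
    simp only [mem_insert, mem_singleton, not_or] at hxv hw hyF
    refine hfree (path_of_heavy h3 (c := u) (d := w) (e := v) (x := x) (y := y) (Ne.symm hwv)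
      hvu.1.symm hwu ?_ hux hvy (Ne.symm hw) hxv hyF.1 hyF.2.1 (Ne.symm hyF.2.2))
    convert hE using 1
    ext a; simp only [mem_insert, mem_singleton]; tauto
  obtain ⟨v, hv⟩ := hne
  obtain ⟨u, hu, hvu, -⟩ := pick v ∅ (by rw [card_empty]; have := h2 v hv; omega)
  have hF : ((heavyNbrs H S u).erase v ∪ (heavyNbrs H S v).erase u).card ≤ 4 := by
    refine (card_union_le _ _).trans ?_
    rw [card_erase_of_mem (mem_heavyNbrs.2 ⟨hv, hvu.symm'⟩),
      card_erase_of_mem (mem_heavyNbrs.2 ⟨hu, hvu⟩)]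
    have := hle u hu
    have := hle v hv
    omega
  obtain ⟨w, hw, hwu, hwv, hE⟩ := ext_pair h3 hvu.1.symm _
    (lt_of_le_of_lt hF (lt_of_lt_of_le (by norm_num) hvu.symm'.2))
  have hwS : w ∈ S := hS _ hE (by simp)
  simp only [mem_union, mem_erase, mem_heavyNbrs, not_or, not_and] at hw
  have hwu' : ¬ Heavy H u w := hw.1 hwv hwS
  have hwv' : ¬ Heavy H v w := hw.2 hwu hwS
  obtain ⟨x, hx, hux, hxv⟩ := pick u {v} (by simp; have := h2 u hu; omega)
  obtain ⟨y, hy, hwy, hyx⟩ := pick w {x} (by simp; have := h2 w hwS; omega)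
  rw [mem_singleton] at hxv hyx
  refine hfree (path_of_heavy h3 (c := u) (d := v) (e := w) (x := x) (y := y) hvu.1.symm
      hwu.symm hwv.symm hE hux hwy hxv ?_ ?_ ?_ (Ne.symm hyx))
  · rintro rfl; exact hwu' hux
  · rintro rfl; exact hwu' hwy.symm'
  · rintro rfl; exact hwv' hwy.symm'

/-- Weak Turán bound for the loose path. -/
lemma turan_weak (k : ℕ) : ∀ (S : Finset V) (H : Finset (Finset V)), S.card = k →
    (∀ e ∈ H, e.card = 3) → (∀ e ∈ H, e ⊆ S) → ¬ HasLoosePath H →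
    2 * H.card ≤ k ^ 2 + 61 * k := by
  induction k with
  | zero =>
    intro S H hk h3 hS _
    have hH : H = ∅ := by
      rw [eq_empty_iff_forall_notMem]
      intro e he
      have := card_le_card (hS e he)
      rw [h3 e he, hk] at this
      omega
    simp [hH]
  | succ k ih =>
    intro S H hk h3 hS hfree
    have hne : S.Nonempty := card_pos.1 (by omega)
    have : ∃ v ∈ S, (H.filter (fun e => v ∈ e)).card < S.card + 31 := by
      by_contra hcon
      push Not at hcon
      exact hfree (path_of_minDegree h3 hS hne hcon)
    obtain ⟨v, hv, hlt⟩ := this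
    have h1 := ih (S.erase v) (H.filter (fun e => ¬ v ∈ e))
      (by rw [card_erase_of_mem hv, hk]; rfl)
      (fun e he => h3 e (mem_filter.1 he).1)
      (fun e he => subset_erase.2 ⟨hS e (mem_filter.1 he).1, (mem_filter.1 he).2⟩)
      (by
        rintro ⟨a, b, c, d, e, f, g, h, h1, h2, h4⟩
        exact hfree ⟨a, b, c, d, e, f, g, h, (mem_filter.1 h1).1, (mem_filter.1 h2).1,
          (mem_filter.1 h4).1⟩)
    have h2 := card_filter_add_card_filter_not (s := H) (fun e => v ∈ e)
    nlinarith

end LoosePath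

lemma sum_colorClass {n N : ℕ} (χ : Finset (Fin N) → Fin n) :
    ∑ i, (colorClass χ i).card = N.choose 3 := by
  have h := card_eq_sum_card_fiberwise (f := χ) (s := powersetCard 3 (univ : Finset (Fin N)))
    (t := univ) (fun _ _ => by simp)
  rw [card_powersetCard, card_univ, Fintype.card_fin] at h
  rw [h]
  refine sum_congr rfl fun i _ => congrArg _ ?_
  ext e
  simp [colorClass, mem_powersetCard]

lemma choose_three_real (N : ℕ) (hN : 2 ≤ N) :
    ((N.choose 3 : ℕ) : ℝ) = (N : ℝ) * (N - 1) * (N - 2) / 6 := by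
  obtain ⟨k, rfl⟩ := Nat.exists_eq_add_of_le hN
  have h := Nat.descFactorial_eq_factorial_mul_choose (2 + k) 3
  have h' : (2 + k).descFactorial 3 = k * ((1 + k) * (2 + k)) := by
    simp [Nat.descFactorial_succ]
  rw [h'] at h
  have h6 : Nat.factorial 3 = 6 := rfl
  rw [h6] at h
  have h2 : ((k * ((1 + k) * (2 + k)) : ℕ) : ℝ) = ((6 * (2 + k).choose 3 : ℕ) : ℝ) := by rw [h]
  push_cast at h2 ⊢
  linarith

lemma main_poly (s g : ℝ) (hs : 6 ≤ s) (h1 : 1.9 < g) (h2 : g < 2) :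
    0 ≤ s ^ 5 * (-6 * g ^ 4 + 44 * g ^ 3 - 78 * g ^ 2 + 42 * g)
      + s ^ 4 * (-31 * g ^ 4 + 83 * g ^ 3 - 12 * g ^ 2 - 111 * g + 147)
      + s ^ 3 * (-223 * g ^ 3 + 627 * g ^ 2 - 896 * g + 938)
      + s ^ 2 * (g ^ 3 - g ^ 2 - 149 * g + 147) + s * (14 * g - 14) := by
  obtain ⟨t, rfl⟩ : ∃ t, g = 1.9 + t := ⟨g - 1.9, by ring⟩
  have ht0 : 0 ≤ t := by linarith
  have ht1 : t ≤ 0.1 := by linarith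
  have q2 : t ^ 2 ≤ 0.1 * t := by nlinarith
  have q2' : 0 ≤ t ^ 2 := by positivity
  have q3 : t ^ 3 ≤ 0.01 * t := by nlinarith
  have q3' : 0 ≤ t ^ 3 := by positivity
  have q4 : t ^ 4 ≤ 0.001 * t := by nlinarith
  have q4' : 0 ≤ t ^ 4 := by positivity
  have c5 : 20 ≤ -6 * (1.9 + t) ^ 4 + 44 * (1.9 + t) ^ 3 - 78 * (1.9 + t) ^ 2 + 42 * (1.9 + t) := by
    ring_nf; linarith
  have c4 : 0 ≤ -31 * (1.9 + t) ^ 4 + 83 * (1.9 + t) ^ 3 - 12 * (1.9 + t) ^ 2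
      - 111 * (1.9 + t) + 147 := by
    ring_nf; linarith
  have c3 : -300 ≤ -223 * (1.9 + t) ^ 3 + 627 * (1.9 + t) ^ 2 - 896 * (1.9 + t) + 938 := by
    ring_nf; linarith
  have c2 : -300 ≤ (1.9 + t) ^ 3 - (1.9 + t) ^ 2 - 149 * (1.9 + t) + 147 := by
    ring_nf; linarith
  have c1 : 0 ≤ 14 * (1.9 + t) - 14 := by linarith
  have hs0 : 0 ≤ s := by linarith
  have e5 := mul_le_mul_of_nonneg_left c5 (pow_nonneg hs0 5)
  have e4 := mul_nonneg (pow_nonneg hs0 4) c4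
  have e3 := mul_le_mul_of_nonneg_left c3 (pow_nonneg hs0 3)
  have e2 := mul_le_mul_of_nonneg_left c2 (pow_nonneg hs0 2)
  have e1 := mul_nonneg hs0 c1
  have p2 : 0 ≤ s ^ 2 := by positivity
  have p3 : 6 * s ^ 2 ≤ s ^ 3 := by nlinarith
  have p5 : 36 * s ^ 3 ≤ s ^ 5 := by
    have : s ^ 5 = s ^ 3 * s ^ 2 := by ring
    have : 36 ≤ s ^ 2 := by nlinarith
    nlinarith
  linarith

open scoped Classical in
theorem many_rich_colors (n N : ℕ) (hn : 41 ≤ n) (γ : ℝ)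
    (hγ : γ = ((N : ℝ) - 7 * Real.sqrt n) / n) (hγ1 : 1.9 < γ) (hγ2 : γ < 2)
    (χ : Finset (Fin N) → Fin n)
    (hfree : ∀ i : Fin n, ¬ HasLoosePath (colorClass χ i)) :
    (γ ^ 3 - 3 * γ ^ 2 + 6 * γ - 6) / (6 * (γ - 1)) * n
      ≤ ((Finset.univ.filter (fun i : Fin n => Rich n N χ i)).card : ℝ) := by
  have hnR : (41 : ℝ) ≤ n := by exact_mod_cast hn
  obtain ⟨s, hs⟩ : ∃ s, s = Real.sqrt n := ⟨_, rfl⟩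
  have hsn : (n : ℝ) = s ^ 2 := by rw [hs, Real.sq_sqrt (by linarith)]
  have hs0 : 0 ≤ s := by rw [hs]; positivity
  have hs6 : 6 ≤ s := by nlinarith
  have hN : (N : ℝ) = γ * s ^ 2 + 7 * s := by
    rw [← hs] at hγ
    rw [hγ, ← hsn]
    field_simp
    ring
  have hN2 : 2 ≤ N := by
    have : (2 : ℝ) ≤ N := by rw [hN]; nlinarith
    exact_mod_cast this
  set T : ℝ := realChoose2 ((n : ℝ) + 6 * Real.sqrt n - 1)
    + realChoose2 ((N : ℝ) - n - 6 * Real.sqrt n) with hT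
  set U : ℝ := ((N : ℝ) ^ 2 + 61 * N) / 2 with hU
  have hUb : ∀ i, ((colorClass χ i).card : ℝ) ≤ U := by
    intro i
    have h := turan_weak N (univ : Finset (Fin N)) (colorClass χ i) (by simp)
      (fun e he => by simp only [colorClass, mem_filter] at he; exact he.2.1)
      (fun e _ => subset_univ e) (hfree i)
    have h' : (2 : ℝ) * (colorClass χ i).card ≤ (N : ℝ) ^ 2 + 61 * N := by exact_mod_cast h
    rw [hU]; linarith
  set r : ℝ := ((Finset.univ.filter (fun i : Fin n => Rich n N χ i)).card : ℝ) with hr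
  have hsum : ((N.choose 3 : ℕ) : ℝ) ≤ r * U + (n - r) * T := by
    rw [← sum_colorClass χ]
    push_cast
    have h1 : ∀ i ∈ (univ : Finset (Fin n)), ((colorClass χ i).card : ℝ) ≤
        T + (if Rich n N χ i then U - T else 0) := by
      intro i _
      split_ifs with h
      · linarith [hUb i]
      · have : ¬ (T ≤ ((colorClass χ i).card : ℝ)) := h
        linarith
    refine (sum_le_sum h1).trans (le_of_eq ?_)
    rw [sum_add_distrib, ← sum_filter, sum_const, sum_const, card_univ, Fintype.card_fin,
      nsmul_eq_mul, nsmul_eq_mul, hr]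
    ring
  rw [choose_three_real N hN2] at hsum
  have hTe : T = realChoose2 (s ^ 2 + 6 * s - 1) + realChoose2 (γ * s ^ 2 + 7 * s - s ^ 2 - 6 * s) := by
    rw [hT, ← hs, hsn, hN]
  have hUT : 0 < U - T := by
    have : U - T = s ^ 4 * (γ - 1) + s ^ 3 * (6 * γ - 5) + s ^ 2 * (31 * γ + 7) + (223 * s - 1) := by
      rw [hTe, hU, hN]; simp only [realChoose2]; ring
    rw [this]
    have a1 := mul_nonneg (pow_nonneg hs0 4) (show 0 ≤ γ - 1 by linarith)
    have a2 := mul_nonneg (pow_nonneg hs0 3) (show 0 ≤ 6 * γ - 5 by linarith)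
    have a3 := mul_nonneg (pow_nonneg hs0 2) (show 0 ≤ 31 * γ + 7 by linarith)
    linarith
  have hkey : (γ ^ 3 - 3 * γ ^ 2 + 6 * γ - 6) * n * (U - T) ≤
      6 * (γ - 1) * ((N : ℝ) * (N - 1) * (N - 2) / 6 - n * T) := by
    have hp := main_poly s γ hs6 hγ1 hγ2
    rw [← sub_nonneg]
    refine hp.trans (le_of_eq ?_)
    rw [hTe, hU, hN, hsn]; simp only [realChoose2]; ring
  have hg : 0 < 6 * (γ - 1) := by linarith
  have hfin : (γ ^ 3 - 3 * γ ^ 2 + 6 * γ - 6) * n * (U - T) ≤ r * (6 * (γ - 1)) * (U - T) := by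
    refine hkey.trans ?_
    have := mul_le_mul_of_nonneg_left (show (N : ℝ) * (N - 1) * (N - 2) / 6 - n * T ≤ r * (U - T) by
      linarith) hg.le
    linarith
  rw [div_mul_eq_mul_div, div_le_iff₀ hg]
  exact le_of_mul_le_mul_right hfin hUT
end

section
/- Under the extended coloring setup, if a color i is rich then G_i contains more than 2·w(G_i) − N private edges, and all private edges of G_i share a common vertex (they form a star in the graph sense, centered at the center of the largest star of H_S^i). -/
open Finset

/-- `H_R^i = {h ∈ H_i : h ∩ V_R^i ≠ ∅}`. -/
def HRpart {n N : ℕ} (χ : Finset (Fin N) → Fin n) (VR : Fin n → Finset (Fin N)) (i : Fin n) :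
    Finset (Finset (Fin N)) :=
  (colorClass χ i).filter (fun e => (e ∩ VR i).Nonempty)

/-- `H_T^i = H_i[V_T^i]`. -/
def HTpart {n N : ℕ} (χ : Finset (Fin N) → Fin n) (VT : Fin n → Finset (Fin N)) (i : Fin n) :
    Finset (Finset (Fin N)) :=
  (colorClass χ i).filter (fun e => e ⊆ VT i)

/-- `H_S^i = {h ∈ H_i[V ∖ V_R^i] : h ∩ V_S^i ≠ ∅}`. -/
def HSpart {n N : ℕ} (χ : Finset (Fin N) → Fin n) (VR VS : Fin n → Finset (Fin N)) (i : Fin n) :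
    Finset (Finset (Fin N)) :=
  (colorClass χ i).filter (fun e => e ∩ VR i = ∅ ∧ (e ∩ VS i).Nonempty)

/-- `Ĥ_i = H_i ∖ H_R^i`. -/
def Hhat {n N : ℕ} (χ : Finset (Fin N) → Fin n) (VR : Fin n → Finset (Fin N)) (i : Fin n) :
    Finset (Finset (Fin N)) :=
  (colorClass χ i).filter (fun e => e ∩ VR i = ∅)

/-- The set of blank triples: triples belonging to `H_R^i` for their own color `i`. -/
def BlankSet {n N : ℕ} (χ : Finset (Fin N) → Fin n) (VR : Fin n → Finset (Fin N)) :
    Finset (Finset (Fin N)) :=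
  Finset.univ.filter (fun e => e.card = 3 ∧ (e ∩ VR (χ e)).Nonempty)

/-- The edge finset of a simple graph on a finite vertex type. -/
noncomputable def edgeF {V : Type*} [Fintype V] (G : SimpleGraph V) : Finset (Sym2 V) :=
  (Set.toFinite G.edgeSet).toFinset

/-- The private edges of `G i`: edges of `G i` lying in no `G j` with `j ≠ i`. -/
noncomputable def privE {n N : ℕ} (G : Fin n → SimpleGraph (Fin N)) (i : Fin n) :
    Finset (Sym2 (Fin N)) :=
  (edgeF (G i)).filter (fun p => ∀ j, j ≠ i → p ∉ edgeF (G j))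

/-- The public edges of `G i`: edges of `G i` lying in some `G j` with `j ≠ i`. -/
noncomputable def pubE {n N : ℕ} (G : Fin n → SimpleGraph (Fin N)) (i : Fin n) :
    Finset (Sym2 (Fin N)) :=
  (edgeF (G i)).filter (fun p => ∃ j, j ≠ i ∧ p ∈ edgeF (G j))

/-- The weight `w(G_i) = e_i + e'_i / 2`. -/
noncomputable def wG {n N : ℕ} (G : Fin n → SimpleGraph (Fin N)) (i : Fin n) : ℝ :=
  ((privE G i).card : ℝ) + ((pubE G i).card : ℝ) / 2

lemma aux_num1 (a b r t s : ℝ) (hb : 43 ≤ b) (hab : b ≤ a) (hr : 0 ≤ r) (ht : 0 ≤ t)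
    (hs : 0 ≤ s) (hsa : s ≤ a) (hsum : r + t + s ≤ a + b + 1) :
    6 * r + t ^ 2 / 8 + s * (s - 1) / 2 < realChoose2 a + realChoose2 b := by
  unfold realChoose2
  have h1 : t ^ 2 ≤ (a + b + 1 - s) ^ 2 := by
    apply pow_le_pow_left₀ ht; linarith
  have h2 : 6 * r + t ^ 2 / 8 ≤ 6 * (a + b + 1 - s) + (a + b + 1 - s) ^ 2 / 8 := by linarith
  have h3 : 0 ≤ s * (a - s) := mul_nonneg hs (by linarith)
  have h4 : 6 * (a + b + 1 - s) + (a + b + 1 - s) ^ 2 / 8 + s * (s - 1) / 2 ≤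
      6 * (a + b + 1) + (a + b + 1) ^ 2 / 8 + s * (3 * a / 8 - b / 4 - 27 / 4) := by
    nlinarith
  have h5 : 6 * (a + b + 1) + (a + b + 1) ^ 2 / 8 < a * (a - 1) / 2 + b * (b - 1) / 2 := by
    nlinarith [sq_nonneg (a - b), mul_self_nonneg (a - 43), mul_self_nonneg (b - 43)]
  have h6 : 6 * (a + b + 1) + (a + b + 1) ^ 2 / 8 + a * (3 * a / 8 - b / 4 - 27 / 4)
      < a * (a - 1) / 2 + b * (b - 1) / 2 := by
    nlinarith [mul_self_nonneg (b - 43)]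
  rcases le_total 0 (3 * a / 8 - b / 4 - 27 / 4) with h | h
  · have := mul_le_mul_of_nonneg_right hsa h
    linarith
  · have : s * (3 * a / 8 - b / 4 - 27 / 4) ≤ 0 := mul_nonpos_of_nonneg_of_nonpos hs h
    linarith

lemma aux_num2 (b r t q : ℝ) (hb : 43 ≤ b) (hr : 0 ≤ r) (ht : 0 ≤ t) (hq : 0 ≤ q)
    (hsum : r + t + q = b) :
    6 * r + (t + 1) * t / 4 + q * (q - 1) / 2 ≤ realChoose2 b := by
  unfold realChoose2
  subst hsum
  nlinarith [mul_nonneg hr (sub_nonneg.2 hb), mul_nonneg ht (sub_nonneg.2 hb),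
    mul_nonneg hr ht, mul_nonneg hr hq, mul_nonneg ht hq]

lemma aux_choose (m : ℕ) : ((m.choose 2 : ℕ) : ℝ) = (m : ℝ) * (m - 1) / 2 := by
  exact Nat.cast_choose_two ℝ m

lemma aux_sum {ι : Type*} (W : Finset ι) (m : ι → ℕ) (M : ℕ)
    (h : ∑ w ∈ W, m w ≤ M) (c : ℝ) (hc : ∀ w ∈ W, (m w : ℝ) ≤ c) (hc1 : M = 0 ∨ 1 ≤ c) :
    ∑ w ∈ W, (((m w).choose 2 : ℕ) : ℝ) ≤ M * (c - 1) / 2 := by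
  rcases hc1 with h0 | h1
  · subst h0
    have : ∀ w ∈ W, m w = 0 := by
      simpa using h
    rw [Finset.sum_eq_zero]
    · simp
    · intro w hw; simp [this w hw]
  · have : ∀ w ∈ W, (((m w).choose 2 : ℕ) : ℝ) ≤ (m w : ℝ) * ((c - 1) / 2) := by
      intro w hw
      rw [aux_choose]
      have := hc w hw
      have h0 : (0 : ℝ) ≤ m w := Nat.cast_nonneg _
      nlinarith
    refine (Finset.sum_le_sum this).trans ?_
    rw [← Finset.sum_mul]
    have h' : (∑ w ∈ W, (m w : ℝ)) ≤ M := by exact_mod_cast h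
    have : (0 : ℝ) ≤ (c - 1) / 2 := by linarith
    have := mul_le_mul_of_nonneg_right h' this
    linarith

lemma aux_sum2 {ι : Type*} [DecidableEq ι] (W : Finset ι) (m : ι → ℕ) (s : ℕ) (a : ℝ)
    (h : ∑ w ∈ W, m w ≤ s) (ha : ∀ w ∈ W, (m w : ℝ) < a) (hsa : a < s) (hs2 : (s : ℝ) < 2 * a)
    (ha1 : 2 ≤ a) :
    ∑ w ∈ W, (((m w).choose 2 : ℕ) : ℝ) < realChoose2 a + ((s : ℝ) - a) * (s - a - 1) / 2 := by
  unfold realChoose2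
  by_cases hall : ∀ w ∈ W, (m w : ℝ) ≤ s / 2
  · have := aux_sum W m s h (s / 2) hall (Or.inr (by linarith))
    nlinarith [mul_pos (sub_pos.2 hs2) (sub_pos.2 hs2)]
  · push Not at hall
    obtain ⟨w, hw, hw2⟩ := hall
    have hsum := Finset.add_sum_erase W m hw
    have hle : m w ≤ s := by omega
    have h2 : ∑ x ∈ W.erase w, m x ≤ s - m w := by omega
    have h3 := aux_sum (W.erase w) m (s - m w) h2 ((s - m w : ℕ) : ℝ) (by
      intro x hx
      have := Finset.single_le_sum (f := m) (fun _ _ => Nat.zero_le _) hx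
      exact_mod_cast this.trans h2) (by
      rcases Nat.eq_zero_or_pos (s - m w) with h0 | h0
      · exact Or.inl h0
      · right; exact_mod_cast h0)
    rw [← Finset.add_sum_erase W _ hw, aux_choose]
    rw [Nat.cast_sub hle] at h3
    have := ha w hw
    nlinarith [mul_pos (sub_pos.2 this) (show (0:ℝ) < m w + a - s by linarith)]

lemma aux_edges {N : ℕ} (hN : 0 < N) (G : SimpleGraph (Fin N)) (h : G.IsAcyclic) :
    (edgeF G).card < N := by
  classical
  have h1 : edgeF G = G.edgeFinset := by
    ext e; simp [edgeF]
  rw [h1]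
  have : Nonempty (Fin N) := ⟨⟨0, hN⟩⟩
  obtain ⟨T, hT, hT2, hT3⟩ :=
    (SimpleGraph.connected_top (V := Fin N)).exists_isTree_le_of_le_of_isAcyclic le_top h
  have h2 := hT3.card_edgeFinset
  have h3 := Finset.card_le_card (SimpleGraph.edgeFinset_mono hT)
  simp only [Fintype.card_fin] at h2
  omega

/-- leaves of the star with center `w` -/
def leavesOf {N : ℕ} (H : Finset (Finset (Fin N))) (c : Finset (Fin N) → Fin N) (w : Fin N) :
    Finset (Fin N) :=
  ((H.filter (fun e => c e = w)).biUnion id).erase w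

lemma mem_leavesOf {N : ℕ} {H : Finset (Finset (Fin N))} {c : Finset (Fin N) → Fin N}
    {w x : Fin N} : x ∈ leavesOf H c w ↔ x ≠ w ∧ ∃ e ∈ H, c e = w ∧ x ∈ e := by
  simp [leavesOf, and_assoc]

lemma aux_HS {N : ℕ} (H : Finset (Finset (Fin N))) (c : Finset (Fin N) → Fin N)
    (C S : Finset (Fin N)) (h3 : ∀ e ∈ H, e.card = 3)
    (h1 : ∀ e ∈ H, c e ∈ e ∧ c e ∈ C ∧ ∀ x ∈ e, x ≠ c e → x ∈ S)
    (h2 : ∀ e ∈ H, ∀ f ∈ H, c e ≠ c f → Disjoint e f) :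
    H.card ≤ ∑ w, (leavesOf H c w).card.choose 2 ∧
    ∑ w, (leavesOf H c w).card ≤ S.card := by
  constructor
  · rw [Finset.card_eq_sum_card_fiberwise (f := c) (t := Finset.univ) (by intro x _; simp)]
    refine Finset.sum_le_sum fun w _ => ?_
    rw [← Finset.card_powersetCard]
    refine Finset.card_le_card_of_injOn (fun e => e.erase w) ?_ ?_
    · intro e he
      simp only [Finset.coe_filter, Set.mem_ofPred_eq] at he
      obtain ⟨he, rfl⟩ := he
      simp only [Finset.mem_coe, Finset.mem_powersetCard]
      refine ⟨?_, ?_⟩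
      · intro x hx
        rw [Finset.mem_erase] at hx
        exact mem_leavesOf.2 ⟨hx.1, e, he, rfl, hx.2⟩
      · rw [Finset.card_erase_of_mem (h1 e he).1, h3 e he]
    · intro e he f hf hef
      simp only [Finset.coe_filter, Set.mem_ofPred_eq] at he hf
      have e1 : w ∈ e := he.2 ▸ (h1 e he.1).1
      have f1 : w ∈ f := hf.2 ▸ (h1 f hf.1).1
      rw [← Finset.insert_erase e1, ← Finset.insert_erase f1]
      exact congrArg _ hef
  · rw [← Finset.card_biUnion]
    · apply Finset.card_le_card
      intro x hx
      simp only [Finset.mem_biUnion, Finset.mem_univ, true_and] at hx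
      obtain ⟨w, hx⟩ := hx
      obtain ⟨hxw, e, he, rfl, hxe⟩ := mem_leavesOf.1 hx
      exact (h1 e he).2.2 x hxe hxw
    · intro w _ w' _ hww
      rw [Function.onFun, Finset.disjoint_left]
      intro x hx hx'
      obtain ⟨_, e, he, rfl, hxe⟩ := mem_leavesOf.1 hx
      obtain ⟨_, f, hf, rfl, hxf⟩ := mem_leavesOf.1 hx'
      exact Finset.disjoint_left.1 (h2 e he f hf hww) hxe hxf

lemma aux_third {N : ℕ} (D : Finset (Finset (Fin N))) (u v : Fin N) (huv : u ≠ v)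
    (h3 : ∀ e ∈ D, e.card = 3 ∧ u ∈ e ∧ v ∈ e) (L : Finset (Fin N)) (hu : u ∉ L) (hv : v ∉ L)
    (hL : ∀ e ∈ D, ∀ x ∈ e, x ∉ L) : D.card + 2 + L.card ≤ N := by
  have key : D.card ≤ (Finset.powersetCard 1 (Finset.univ \ (L ∪ {u, v}))).card := by
    refine Finset.card_le_card_of_injOn (fun e => e \ {u, v}) ?_ ?_
    · intro e he
      obtain ⟨h, h1, h2⟩ := h3 e he
      simp only [Finset.mem_coe, Finset.mem_powersetCard]
      refine ⟨?_, ?_⟩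
      · intro x hx
        have := hL e he x
        simp at hx ⊢
        tauto
      · rw [Finset.card_sdiff_of_subset, h, Finset.card_pair huv]
        intro x hx
        simp at hx
        rcases hx with rfl | rfl <;> assumption
    · intro e he f hf hef
      obtain ⟨h, h1, h2⟩ := h3 e he
      obtain ⟨h', h1', h2'⟩ := h3 f hf
      ext x
      have := congrArg (fun A => x ∈ A) hef
      simp at this
      by_cases xu : x = u
      · subst xu; tauto
      · by_cases xv : x = v
        · subst xv; tauto
        · tauto
  rw [Finset.card_powersetCard, Nat.choose_one_right, Finset.card_sdiff_of_subset (by simp),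
    Finset.card_union_of_disjoint, Finset.card_pair huv, Finset.card_univ, Fintype.card_fin] at key
  · have := Finset.card_le_univ (L ∪ {u, v})
    rw [Finset.card_union_of_disjoint, Finset.card_pair huv, Fintype.card_fin] at this
    · omega
    · simp [hu, hv]
  · simp [hu, hv]

lemma aux_deg {n N : ℕ} (χ : Finset (Fin N) → Fin n) (VR : Fin n → Finset (Fin N)) (i : Fin n)
    (u v : Fin N) (huv : u ≠ v)
    (hj : ∀ j, j ≠ i → ((Hhat χ VR j).filter (fun e => u ∈ e ∧ v ∈ e)).card ≤ 1) :
    N ≤ ((BlankSet χ VR).filter (fun e => u ∈ e ∧ v ∈ e)).card + n + 1 +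
      ((Hhat χ VR i).filter (fun e => u ∈ e ∧ v ∈ e)).card := by
  have h1 : N - 2 ≤ ((BlankSet χ VR).filter (fun e => u ∈ e ∧ v ∈ e) ∪
      Finset.univ.biUnion (fun j => (Hhat χ VR j).filter (fun e => u ∈ e ∧ v ∈ e))).card := by
    have : N - 2 = (Finset.univ \ ({u, v} : Finset (Fin N))).card := by
      rw [Finset.card_sdiff_of_subset (by simp), Finset.card_pair huv]; simp
    rw [this]
    refine Finset.card_le_card_of_injOn (fun x => {x, u, v}) ?_ ?_
    · intro x hx
      simp at hx
      have hc : ({x, u, v} : Finset (Fin N)).card = 3 :=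
        Finset.card_eq_three.2 ⟨x, u, v, hx.1, hx.2, huv, rfl⟩
      by_cases hb : ({x, u, v} : Finset (Fin N)) ∩ VR (χ {x, u, v}) = ∅
      · rw [Finset.mem_coe, Finset.mem_union]
        right
        simp only [Finset.mem_biUnion]
        refine ⟨χ {x, u, v}, Finset.mem_univ _, ?_⟩
        simp only [Hhat, colorClass, Finset.mem_filter]
        exact ⟨⟨⟨Finset.mem_univ _, hc, by simp⟩, hb⟩, by simp, by simp⟩
      · rw [Finset.mem_coe, Finset.mem_union]
        left
        simp only [BlankSet, Finset.mem_filter]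
        exact ⟨⟨Finset.mem_univ _, hc, Finset.nonempty_iff_ne_empty.2 hb⟩, by simp, by simp⟩
    · intro x hx y hy hxy
      simp at hx hy
      have : x ∈ ({y, u, v} : Finset (Fin N)) := by
        have hxy : ({x, u, v} : Finset (Fin N)) = {y, u, v} := hxy
        rw [← hxy]; simp
      simp at this
      tauto
  have h2 := h1.trans ((Finset.card_union_le _ _).trans
    (Nat.add_le_add_left Finset.card_biUnion_le _))
  rw [← Finset.add_sum_erase _ _ (Finset.mem_univ i)] at h2
  have h3 : ∑ j ∈ Finset.univ.erase i, ((Hhat χ VR j).filter (fun e => u ∈ e ∧ v ∈ e)).card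
      ≤ n - 1 := by
    refine (Finset.sum_le_card_nsmul _ _ 1 ?_).trans ?_
    · intro j h; exact hj j (Finset.ne_of_mem_erase h)
    · simp
  have := i.pos
  omega

theorem rich_color_private_star (n N : ℕ) (hn : 41 ≤ n) (γ : ℝ)
    (hγ : γ = ((N : ℝ) - 7 * Real.sqrt n) / n) (hγ1 : 1.9 < γ) (hγ2 : γ < 2)
    (χ : Finset (Fin N) → Fin n)
    (hfree : ∀ i : Fin n, ¬ HasLoosePath (colorClass χ i))
    (VR VT VS : Fin n → Finset (Fin N))
    (hpart : ∀ i, Disjoint (VR i) (VT i) ∧ Disjoint (VR i) (VS i) ∧ Disjoint (VT i) (VS i) ∧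
      VR i ∪ VT i ∪ VS i = Finset.univ)
    (hR : ∀ i, (HRpart χ VR i).card ≤ 6 * (VR i).card)
    (hTqb : ∀ i, QuasiBipartite (VT i) (HTpart χ VT i))
    (hTcard : ∀ i, ((HTpart χ VT i).card : ℝ) ≤ ((VT i).card : ℝ) ^ 2 / 8)
    (hSstars : ∀ i, DisjointStars (HSpart χ VR VS i) (VT i) (VS i))
    (hScard : ∀ i, (HSpart χ VR VS i).card ≤ ((VS i).card.choose 2))
    (G : Fin n → SimpleGraph (Fin N))
    (hG : ∀ i u v, (G i).Adj u v ↔ u ≠ v ∧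
      2 ≤ ((Hhat χ VR i).filter (fun e => u ∈ e ∧ v ∈ e)).card ∧
      ((((BlankSet χ VR).filter (fun e => u ∈ e ∧ v ∈ e)).card : ℝ) < 6 * Real.sqrt n))
    (hforest : ∀ i, (G i).IsAcyclic)
    (i : Fin n) (hrich : Rich n N χ i) :
    2 * wG G i - (N : ℝ) < ((privE G i).card : ℝ) ∧
    ∃ v : Fin N, ∀ p ∈ privE G i, v ∈ p := by
  classical
  set q := Real.sqrt n with hq
  have hn' : (41 : ℝ) ≤ n := by exact_mod_cast hn
  have hqq : q * q = n := Real.mul_self_sqrt (by linarith)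
  have hq0 : 0 ≤ q := Real.sqrt_nonneg _
  have hq6 : 6.4 ≤ q := by
    by_contra hcon
    push Not at hcon
    nlinarith
  have hNg : (N : ℝ) = γ * n + 7 * q := by
    rw [hγ]; field_simp; ring
  obtain ⟨a, ha⟩ : ∃ a : ℝ, a = n + 6 * q - 1 := ⟨_, rfl⟩
  obtain ⟨b, hb⟩ : ∃ b : ℝ, b = N - n - 6 * q := ⟨_, rfl⟩
  have hb43 : 43 ≤ b := by
    rw [hb, hNg]; nlinarith
  have hba : b < a := by
    rw [hb, ha, hNg]; nlinarith
  have hNab : (N : ℝ) = a + b + 1 := by rw [ha, hb]; ring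
  have hNpos : 0 < N := by
    rcases Nat.eq_zero_or_pos N with h | h
    · subst h; simp at hNab; linarith
    · exact h
  refine ⟨?_, ?_⟩
  · have h1 : (privE G i).card + (pubE G i).card = (edgeF (G i)).card := by
      rw [← Finset.card_filter_add_card_filter_not (s := edgeF (G i))
        (fun p => ∀ j, j ≠ i → p ∉ edgeF (G j))]
      unfold privE pubE
      congr 2
      apply Finset.filter_congr
      intro p _
      push Not
      rfl
    have h2 := aux_edges hNpos (G i) (hforest i)
    have h3 : ((privE G i).card : ℝ) + (pubE G i).card < N := by
      exact_mod_cast h1 ▸ h2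
    unfold wG
    linarith
  obtain ⟨d1, d2, d3, hun⟩ := hpart i
  obtain ⟨c, hc1, hc2⟩ := hSstars i
  have hS3 : ∀ e ∈ HSpart χ VR VS i, e.card = 3 := by
    intro e he
    simp only [HSpart, colorClass, Finset.mem_filter] at he
    exact he.1.2.1
  have hcards : (VR i).card + (VT i).card + (VS i).card = N := by
    rw [← Finset.card_union_of_disjoint d1, ← Finset.card_union_of_disjoint, hun]
    · simp
    · rw [Finset.disjoint_union_left]; exact ⟨d2, d3⟩
  have hcov : ∀ e ∈ Hhat χ VR i, e ⊆ VT i ∨ e ∈ HSpart χ VR VS i := by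
    intro e he
    simp only [Hhat, Finset.mem_filter] at he
    by_cases h : (e ∩ VS i).Nonempty
    · right; simp only [HSpart, Finset.mem_filter]; exact ⟨he.1, he.2, h⟩
    · left
      intro x hx
      have hx1 : x ∈ VR i ∪ VT i ∪ VS i := by rw [hun]; simp
      have hx2 : x ∉ VS i := fun h' => h ⟨x, Finset.mem_inter.2 ⟨hx, h'⟩⟩
      have hx3 : x ∉ VR i := fun h' => by
        have : x ∈ e ∩ VR i := Finset.mem_inter.2 ⟨hx, h'⟩
        rw [he.2] at this; simp at this
      simp only [Finset.mem_union] at hx1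
      tauto
  have htot : (colorClass χ i).card ≤ (HRpart χ VR i).card + (HTpart χ VT i).card +
      (HSpart χ VR VS i).card := by
    refine (Finset.card_le_card (t := HRpart χ VR i ∪ HTpart χ VT i ∪ HSpart χ VR VS i) ?_).trans
      ((Finset.card_union_le _ _).trans (Nat.add_le_add_right (Finset.card_union_le _ _) _))
    intro e he
    simp only [Finset.mem_union]
    by_cases h : (e ∩ VR i).Nonempty
    · left; left; simp only [HRpart, Finset.mem_filter]; exact ⟨he, h⟩
    · rcases hcov e (by
        simp only [Hhat, Finset.mem_filter]
        exact ⟨he, Finset.not_nonempty_iff_eq_empty.1 h⟩) with h' | h'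
      · left; right; simp only [HTpart, Finset.mem_filter]; exact ⟨he, h'⟩
      · right; exact h'
  have htot' : ((colorClass χ i).card : ℝ) ≤ 6 * (VR i).card + (HTpart χ VT i).card +
      (HSpart χ VR VS i).card := by
    have := hR i
    have : (colorClass χ i).card ≤ 6 * (VR i).card + (HTpart χ VT i).card +
      (HSpart χ VR VS i).card := by omega
    exact_mod_cast this
  have hcards' : ((VR i).card : ℝ) + (VT i).card + (VS i).card = a + b + 1 := by
    rw [← hNab]; exact_mod_cast hcards
  have hrich' : realChoose2 a + realChoose2 b ≤ ((colorClass χ i).card : ℝ) := by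
    rw [ha, hb]; exact hrich
  obtain ⟨hs1, hs2⟩ := aux_HS _ c _ _ hS3 hc1 hc2
  -- the largest star
  have hstar : ∃ w, a ≤ ((leavesOf (HSpart χ VR VS i) c w).card : ℝ) := by
    by_contra hcon
    push Not at hcon
    have hT := hTcard i
    have r0 : (0 : ℝ) ≤ (VR i).card := Nat.cast_nonneg _
    have t0 : (0 : ℝ) ≤ (VT i).card := Nat.cast_nonneg _
    have s0 : (0 : ℝ) ≤ (VS i).card := Nat.cast_nonneg _
    rcases (HSpart χ VR VS i).eq_empty_or_nonempty with hE | hE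
    · rw [hE] at htot'
      have := aux_num1 a b (VR i).card (VT i).card 0 hb43 hba.le r0 t0 le_rfl (by linarith)
        (by linarith)
      simp at htot' this
      linarith
    rcases le_or_gt ((VS i).card : ℝ) a with hsa | hsa
    · have := aux_num1 a b (VR i).card (VT i).card (VS i).card hb43 hba.le r0 t0 s0 hsa
        (by linarith)
      have h2 : ((HSpart χ VR VS i).card : ℝ) ≤ (((VS i).card.choose 2 : ℕ) : ℝ) := by
        exact_mod_cast hScard i
      rw [aux_choose] at h2
      linarith
    · obtain ⟨e, he⟩ := hE
      have ht1 : 1 ≤ (VT i).card := Finset.card_pos.2 ⟨_, (hc1 e he).2.1⟩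
      have ht1' : (1 : ℝ) ≤ (VT i).card := by exact_mod_cast ht1
      have hT' : ((HTpart χ VT i).card : ℝ) ≤
          ((VT i).card - 1 + 1) * ((VT i).card - 1 : ℝ) / 4 := by
        rcases Nat.lt_or_ge (VT i).card 2 with h | h
        · have : HTpart χ VT i = ∅ := by
            rw [Finset.eq_empty_iff_forall_notMem]
            intro f hf
            simp only [HTpart, colorClass, Finset.mem_filter] at hf
            have := Finset.card_le_card hf.2
            omega
          rw [this]
          have : (VT i).card = 1 := by omega
          rw [this]; simp
        · have : (2 : ℝ) ≤ (VT i).card := by exact_mod_cast h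
          nlinarith
      have k1 := aux_sum2 Finset.univ (fun w => (leavesOf (HSpart χ VR VS i) c w).card)
        (VS i).card a hs2 (fun w _ => hcon w) hsa (by linarith) (by linarith)
      have k2 : ((HSpart χ VR VS i).card : ℝ) ≤
          ∑ w, (((leavesOf (HSpart χ VR VS i) c w).card.choose 2 : ℕ) : ℝ) := by
        exact_mod_cast hs1
      have k3 := aux_num2 b (VR i).card ((VT i).card - 1) ((VS i).card - a) hb43 r0
        (by linarith) (by linarith) (by linarith)
      linarith
  obtain ⟨w, hw⟩ := hstar
  refine ⟨w, ?_⟩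
  intro p hp
  induction p using Sym2.ind with
  | _ u v =>
  by_contra hwp
  have hwu : w ≠ u := fun h => hwp (by simp [h])
  have hwv : w ≠ v := fun h => hwp (by simp [h])
  have memF : ∀ j, s(u, v) ∈ edgeF (G j) ↔ (G j).Adj u v := by
    intro j; simp [edgeF]
  simp only [privE, Finset.mem_filter, memF] at hp
  obtain ⟨hadj, hpriv⟩ := hp
  obtain ⟨huv, hdeg2, hblank⟩ := (hG i u v).1 hadj
  have hdeg := aux_deg χ VR i u v huv (by
    intro j hj
    have := hpriv j hj
    rw [hG] at this
    by_contra hcon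
    exact this ⟨huv, by omega, hblank⟩)
  -- membership facts
  have hDm : ∀ e ∈ (Hhat χ VR i).filter (fun e => u ∈ e ∧ v ∈ e),
      e.card = 3 ∧ u ∈ e ∧ v ∈ e := by
    intro e he
    simp only [Hhat, colorClass, Finset.mem_filter] at he
    exact ⟨he.1.1.2.1, he.2⟩
  have hTS : ∀ x, x ∈ VT i → x ∉ VS i := fun x h1 h2 => Finset.disjoint_left.1 d3 h1 h2
  have hLS : ∀ x, ∀ y ∈ leavesOf (HSpart χ VR VS i) c x, y ∈ VS i := by
    intro x y hy
    obtain ⟨h1, e, he, rfl, h2⟩ := mem_leavesOf.1 hy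
    exact (hc1 e he).2.2 y h2 h1
  -- no star edge through both u and v has center outside {u, v}
  have hcen : ∀ e ∈ (Hhat χ VR i).filter (fun e => u ∈ e ∧ v ∈ e), e ∈ HSpart χ VR VS i →
      c e = u ∨ c e = v := by
    intro e he heS
    by_contra hcon
    push Not at hcon
    have hu := (hc1 e heS).2.2 u (hDm e he).2.1 hcon.1.symm
    have hv := (hc1 e heS).2.2 v (hDm e he).2.2 hcon.2.symm
    have hone : ∀ f ∈ (Hhat χ VR i).filter (fun e => u ∈ e ∧ v ∈ e), f = {u, v, c e} := by
      intro f hf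
      have hfS : f ∈ HSpart χ VR VS i := by
        rcases hcov f (Finset.mem_filter.1 hf).1 with h | h
        · exact absurd hu (hTS _ (h (hDm f hf).2.1))
        · exact h
      have hcc : c e = c f := by
        by_contra h
        exact Finset.disjoint_left.1 (hc2 e heS f hfS h) (hDm e he).2.1 (hDm f hf).2.1
      symm
      apply Finset.eq_of_subset_of_card_le
      · intro x hx
        simp only [Finset.mem_insert, Finset.mem_singleton] at hx
        rcases hx with rfl | rfl | rfl
        · exact (hDm f hf).2.1
        · exact (hDm f hf).2.2
        · rw [hcc]; exact (hc1 f hfS).1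
      · rw [(hDm f hf).1, Finset.card_eq_three.2 ⟨u, v, c e, huv, hcon.1.symm, hcon.2.symm, rfl⟩]
    have : ((Hhat χ VR i).filter (fun e => u ∈ e ∧ v ∈ e)).card ≤ 1 := by
      rw [Finset.card_le_one]
      intro x hx y hy
      rw [hone x hx, hone y hy]
    omega
  have hL : ∀ e ∈ (Hhat χ VR i).filter (fun e => u ∈ e ∧ v ∈ e), ∀ x ∈ e,
      x ∉ leavesOf (HSpart χ VR VS i) c w := by
    intro e he x hx hxL
    rcases hcov e (Finset.mem_filter.1 he).1 with h | h
    · exact hTS x (h hx) (hLS w x hxL)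
    · obtain ⟨_, f, hf, hfw, hxf⟩ := mem_leavesOf.1 hxL
      have hne : c e ≠ c f := by
        rw [hfw]
        rcases hcen e he h with h' | h'
        · rw [h']; exact hwu.symm
        · rw [h']; exact hwv.symm
      exact Finset.disjoint_left.1 (hc2 e h f hf hne) hx hxf
  obtain ⟨e0, he0⟩ : ((Hhat χ VR i).filter (fun e => u ∈ e ∧ v ∈ e)).Nonempty :=
    Finset.card_pos.1 (by omega)
  have hfin := aux_third _ u v huv hDm (leavesOf (HSpart χ VR VS i) c w)
    (hL e0 he0 u (hDm e0 he0).2.1) (hL e0 he0 v (hDm e0 he0).2.2) hL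
  have f1 : (((Hhat χ VR i).filter (fun e => u ∈ e ∧ v ∈ e)).card : ℝ) + 2 +
      (leavesOf (HSpart χ VR VS i) c w).card ≤ N := by exact_mod_cast hfin
  have f2 : (N : ℝ) ≤ (((BlankSet χ VR).filter (fun e => u ∈ e ∧ v ∈ e)).card : ℝ) + n + 1 +
      ((Hhat χ VR i).filter (fun e => u ∈ e ∧ v ∈ e)).card := by exact_mod_cast hdeg
  linarith
end

section
/- Let K, m be nonnegative integers with 2K ≥ m, and let k_1, …, k_r be nonnegative integers with k_i ≤ K for every i and k_1 + … + k_r ≤ m. Then C(k_1,2) + … + C(k_r,2) ≤ C(K,2) + C(m−K,2). -/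
open Finset

lemma aux_succ (n : ℕ) : (n + 1).choose 2 = n + n.choose 2 := by
  simp [Nat.choose_succ_succ' n 1]

lemma aux_conv (s e d : ℕ) (h : e ≤ s) :
    s.choose 2 + (e + d).choose 2 ≤ (s + d).choose 2 + e.choose 2 := by
  induction d with
  | zero => simp
  | succ d ih =>
    rw [← add_assoc, ← add_assoc, aux_succ, aux_succ]
    omega

lemma aux_super (s d : ℕ) : s.choose 2 + d.choose 2 ≤ (s + d).choose 2 := by
  simpa using aux_conv s 0 d (Nat.zero_le _)

lemma aux_step (K S a : ℕ) (ha : a ≤ K) :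
    a.choose 2 + ((min S K).choose 2 + (S - K).choose 2) ≤
      (min (a + S) K).choose 2 + (a + S - K).choose 2 := by
  rcases le_total (a + S) K with h | h
  · have h1 : S - K = 0 := by omega
    have h2 : a + S - K = 0 := by omega
    rw [min_eq_left h, min_eq_left (by omega : S ≤ K), h1, h2]
    have := aux_super a S
    simp
    omega
  · rw [min_eq_right h]
    rcases le_total S K with h' | h'
    · have h1 : S - K = 0 := by omega
      rw [min_eq_left h', h1]
      have := aux_conv S (a + S - K) (K - S) (by omega)
      rw [show a + S - K + (K - S) = a by omega, show S + (K - S) = K by omega] at this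
      simp
      omega
    · rw [min_eq_right h']
      have := aux_super a (S - K)
      rw [show a + (S - K) = a + S - K by omega] at this
      omega

theorem sum_choose_two_le (K m : ℕ) (hKm : m ≤ 2 * K)
    (r : ℕ) (k : Fin r → ℕ) (hk : ∀ i, k i ≤ K) (hsum : ∑ i, k i ≤ m) :
    ∑ i, (k i).choose 2 ≤ K.choose 2 + (m - K).choose 2 := by
  have key : ∀ s : Finset (Fin r), ∑ i ∈ s, (k i).choose 2 ≤
      (min (∑ i ∈ s, k i) K).choose 2 + (∑ i ∈ s, k i - K).choose 2 := by
    intro s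
    induction s using Finset.induction_on with
    | empty => simp
    | insert a s ha ih =>
      rw [Finset.sum_insert ha, Finset.sum_insert ha]
      exact (Nat.add_le_add_left ih _).trans (aux_step K _ _ (hk a))
  refine (key univ).trans (Nat.add_le_add ?_ ?_)
  · exact Nat.choose_le_choose 2 (min_le_right _ _)
  · exact Nat.choose_le_choose 2 (Nat.sub_le_sub_right hsum K)
end

section
/- Let H be a 𝒫-free 3-graph on N ≥ 95 vertices such that for some integer s with (N+3)/2 ≤ s ≤ N − 46 one has |H| ≥ C(s−1, 2) + C(N−s, 2), and let V = V_R ∪ V_T ∪ V_S be a decomposition of H satisfying conditions (i)–(iii) of the decomposition lemma. Then |V_S| ≥ s − 1. -/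
open Finset

theorem VS_large (N : ℕ) (hN : 95 ≤ N)
    (H : Finset (Finset (Fin N))) (h3 : ∀ e ∈ H, e.card = 3)
    (hfree : ¬ HasLoosePath H)
    (s : ℕ) (hs1 : ((N : ℝ) + 3) / 2 ≤ (s : ℝ)) (hs2 : s ≤ N - 46)
    (hH : (s - 1).choose 2 + (N - s).choose 2 ≤ H.card)
    (VR VT VS : Finset (Fin N))
    (hd1 : Disjoint VR VT) (hd2 : Disjoint VR VS) (hd3 : Disjoint VT VS)
    (hunion : VR ∪ VT ∪ VS = Finset.univ)
    (hR : (H.filter (fun e => (e ∩ VR).Nonempty)).card ≤ 6 * VR.card)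
    (hTqb : QuasiBipartite VT (H.filter (fun e => e ⊆ VT)))
    (hTcard : ((H.filter (fun e => e ⊆ VT)).card : ℝ) ≤ (VT.card : ℝ) ^ 2 / 8)
    (hSstars : DisjointStars (H.filter (fun e => e ∩ VR = ∅ ∧ (e ∩ VS).Nonempty)) VT VS)
    (hScard : (H.filter (fun e => e ∩ VR = ∅ ∧ (e ∩ VS).Nonempty)).card ≤ VS.card.choose 2) :
    s - 1 ≤ VS.card := by
  by_contra hlt
  push Not at hlt
  have hcov : H ⊆ (H.filter (fun e => (e ∩ VR).Nonempty)) ∪ ((H.filter (fun e => e ⊆ VT)) ∪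
      (H.filter (fun e => e ∩ VR = ∅ ∧ (e ∩ VS).Nonempty))) := by
    intro e he
    simp only [Finset.mem_union, Finset.mem_filter, he, true_and]
    by_cases h1 : (e ∩ VR).Nonempty
    · exact Or.inl h1
    right
    have h1' := Finset.not_nonempty_iff_eq_empty.1 h1
    by_cases h2 : (e ∩ VS).Nonempty
    · exact Or.inr ⟨h1', h2⟩
    left
    intro x hx
    have hxu : x ∈ VR ∪ VT ∪ VS := by rw [hunion]; exact Finset.mem_univ x
    simp only [Finset.mem_union] at hxu
    rcases hxu with (hx1 | hx1) | hx1
    · exact absurd ⟨x, Finset.mem_inter.2 ⟨hx, hx1⟩⟩ h1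
    · exact hx1
    · exact absurd ⟨x, Finset.mem_inter.2 ⟨hx, hx1⟩⟩ h2
  have hc1 := (Finset.card_le_card hcov).trans (Finset.card_union_le _ _)
  have hc2 := Finset.card_union_le (H.filter (fun e => e ⊆ VT))
      (H.filter (fun e => e ∩ VR = ∅ ∧ (e ∩ VS).Nonempty))
  have hsum : VR.card + VT.card + VS.card = N := by
    have h := congrArg Finset.card hunion
    rw [Finset.card_union_of_disjoint (Finset.disjoint_union_left.2 ⟨hd2, hd3⟩),
      Finset.card_union_of_disjoint hd1, Finset.card_univ, Fintype.card_fin] at h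
    exact h
  have hs1' : N + 3 ≤ 2 * s := by
    have : (N : ℝ) + 3 ≤ 2 * s := by linarith
    exact_mod_cast this
  obtain ⟨b, hb⟩ : ∃ b, N = s + b := ⟨N - s, by omega⟩
  obtain ⟨u, hu⟩ : ∃ u, s = u + 2 := ⟨s - 2, by omega⟩
  have e1 : s - 1 = u + 1 := by omega
  have e2 : N - s = b := by omega
  rw [e1, e2] at hH
  have hHR : (((u + 1).choose 2 : ℕ) : ℝ) + ((b.choose 2 : ℕ) : ℝ) ≤
      6 * VR.card + (VT.card : ℝ) ^ 2 / 8 + ((VS.card.choose 2 : ℕ) : ℝ) := by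
    have : (u + 1).choose 2 + b.choose 2 ≤
      6 * VR.card + (H.filter (fun e => e ⊆ VT)).card + VS.card.choose 2 := by omega
    have h' : (((u + 1).choose 2 : ℕ) : ℝ) + ((b.choose 2 : ℕ) : ℝ) ≤
      6 * VR.card + ((H.filter (fun e => e ⊆ VT)).card : ℝ) + ((VS.card.choose 2 : ℕ) : ℝ) := by
      exact_mod_cast this
    linarith
  simp only [Nat.cast_choose_two] at hHR
  push_cast at hHR
  have k1 : (VR.card : ℝ) + VT.card + VS.card = u + 2 + b := by
    have : VR.card + VT.card + VS.card = u + 2 + b := by omega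
    exact_mod_cast this
  have k2 : (46 : ℝ) ≤ b := by
    have : 46 ≤ b := by omega
    exact_mod_cast this
  have k3 : (b : ℝ) + 1 ≤ u := by
    have : b + 1 ≤ u := by omega
    exact_mod_cast this
  have k4 : (VS.card : ℝ) ≤ u := by
    have : VS.card ≤ u := by omega
    exact_mod_cast this
  have p1 : (0 : ℝ) ≤ VR.card := Nat.cast_nonneg _
  have p2 : (0 : ℝ) ≤ VT.card := Nat.cast_nonneg _
  have p3 : (0 : ℝ) ≤ VS.card := Nat.cast_nonneg _
  generalize (VR.card : ℝ) = r at *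
  generalize (VT.card : ℝ) = t at *
  generalize (VS.card : ℝ) = v at *
  generalize (u : ℝ) = U at *
  generalize (b : ℝ) = B at *
  have q1 : 6 * r + t ^ 2 / 8 ≤ (r + t) ^ 2 / 8 := by
    nlinarith [mul_nonneg p1 p2, mul_nonneg p1 (show (0:ℝ) ≤ r + 2 * t - 48 by linarith)]
  have hm : r + t = U + 2 + B - v := by linarith
  rw [hm] at q1
  have q2 : (U + 2 + B - v) ^ 2 / 8 + v * (v - 1) / 2 ≤ (B + 2) ^ 2 / 8 + U * (U - 1) / 2 := by
    nlinarith [mul_nonneg p3 (sub_nonneg.2 k4), mul_nonneg (sub_nonneg.2 k4)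
      (show (0:ℝ) ≤ 5 * U / 8 - (U + 2 + B) / 4 - 1 / 2 by linarith)]
  nlinarith
end

section
/- Under the extended coloring setup, the total number of private edges over all rich colors satisfies Σ_{i ∈ I} e_i ≤ C(|I|, 2) + |I|·(N − |I|), where I is the set of rich colors. -/
open Finset

/-- A family of triples through `u`, `v` with third vertices in `W` has at most `|W|` members. -/
lemma card_third {V : Type*} [DecidableEq V] (F : Finset (Finset V)) (u v : V) (huv : u ≠ v)
    (W : Finset V) (h3 : ∀ e ∈ F, e.card = 3 ∧ u ∈ e ∧ v ∈ e)
    (hW : ∀ e ∈ F, ∀ x ∈ e, x ≠ u → x ≠ v → x ∈ W) : F.card ≤ W.card := by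
  have hsub : F ⊆ W.image (fun w => ({u, v, w} : Finset V)) := by
    intro e he
    obtain ⟨hc, hu, hv⟩ := h3 e he
    have hc1 : ((e.erase u).erase v).card = 1 := by
      rw [Finset.card_erase_of_mem (by simp [hv, huv.symm]), Finset.card_erase_of_mem hu, hc]
    obtain ⟨w, hw⟩ := Finset.card_eq_one.mp hc1
    have hwm : w ∈ (e.erase u).erase v := by rw [hw]; simp
    simp only [Finset.mem_erase] at hwm
    refine Finset.mem_image.mpr ⟨w, hW e he w hwm.2.2 hwm.2.1 hwm.1, ?_⟩
    have h1 : e = insert u (insert v ((e.erase u).erase v)) := by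
      rw [Finset.insert_erase (by simp [hv, huv.symm]), Finset.insert_erase hu]
    rw [h1, hw]
  exact (Finset.card_le_card hsub).trans Finset.card_image_le

/-- There are at least `N - 2` triples through a pair. -/
lemma card_triples_ge {N : ℕ} (u v : Fin N) (huv : u ≠ v) :
    N ≤ ((Finset.univ : Finset (Finset (Fin N))).filter
      (fun e => e.card = 3 ∧ u ∈ e ∧ v ∈ e)).card + 2 := by
  have h1 : ((Finset.univ : Finset (Fin N)) \ {u, v}).card + 2 = N := by
    have := Finset.card_sdiff_add_card_eq_card (Finset.subset_univ ({u, v} : Finset (Fin N)))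
    rw [Finset.card_pair huv] at this
    simpa using this
  have h2 : ((Finset.univ : Finset (Fin N)) \ {u, v}).card ≤
      ((Finset.univ : Finset (Finset (Fin N))).filter
      (fun e => e.card = 3 ∧ u ∈ e ∧ v ∈ e)).card := by
    apply Finset.card_le_card_of_injOn (fun w => ({u, v, w} : Finset (Fin N)))
    · intro w hw
      simp only [Finset.coe_sdiff, Set.mem_sdiff, Finset.mem_coe, Finset.mem_univ, true_and,
        Finset.mem_insert, Finset.mem_singleton, not_or] at hw
      simp only [Finset.coe_filter, Finset.mem_univ, true_and, Set.mem_ofPred_eq]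
      refine ⟨?_, by simp, by simp⟩
      exact Finset.card_eq_three.mpr ⟨u, v, w, huv, Ne.symm hw.1, Ne.symm hw.2, rfl⟩
    · intro w hw w' hw' hww
      simp only [Finset.coe_sdiff, Set.mem_sdiff, Finset.mem_coe, Finset.mem_univ, true_and,
        Finset.mem_insert, Finset.mem_singleton, not_or] at hw hw'
      have : w ∈ ({u, v, w'} : Finset (Fin N)) := by
        have hww2 : ({u, v, w} : Finset (Fin N)) = {u, v, w'} := hww
        rw [← hww2]; simp
      simp only [Finset.mem_insert, Finset.mem_singleton] at this
      tauto
  omega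

/-- Degree count: if every other colour has at most one triple of `Ĥ_j` on the pair. -/
lemma degree_count {n N : ℕ} (χ : Finset (Fin N) → Fin n) (VR : Fin n → Finset (Fin N))
    (i : Fin n) (u v : Fin N) (huv : u ≠ v)
    (h : ∀ j, j ≠ i → ((Hhat χ VR j).filter (fun e => u ∈ e ∧ v ∈ e)).card ≤ 1) :
    N ≤ ((Hhat χ VR i).filter (fun e => u ∈ e ∧ v ∈ e)).card + (n - 1) +
      ((BlankSet χ VR).filter (fun e => u ∈ e ∧ v ∈ e)).card + 2 := by
  have h0 := card_triples_ge u v huv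
  have hsub : ((Finset.univ : Finset (Finset (Fin N))).filter
      (fun e => e.card = 3 ∧ u ∈ e ∧ v ∈ e)) ⊆
      ((Hhat χ VR i).filter (fun e => u ∈ e ∧ v ∈ e) ∪
      (Finset.univ.erase i).biUnion (fun j => (Hhat χ VR j).filter (fun e => u ∈ e ∧ v ∈ e))) ∪
      ((BlankSet χ VR).filter (fun e => u ∈ e ∧ v ∈ e)) := by
    intro e he
    simp only [Finset.mem_filter, Finset.mem_univ, true_and] at he
    obtain ⟨hc, hu, hv⟩ := he
    simp only [Finset.mem_union, Finset.mem_biUnion, Finset.mem_filter, Finset.mem_erase,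
      Hhat, BlankSet, colorClass, Finset.mem_univ, true_and, and_true, hu, hv, hc]
    by_cases hb : e ∩ VR (χ e) = ∅
    · left
      by_cases hi : χ e = i
      · left; subst hi; exact ⟨rfl, hb⟩
      · right; exact ⟨χ e, hi, rfl, hb⟩
    · right; exact Finset.nonempty_iff_ne_empty.mpr hb
  have h1 := Finset.card_le_card hsub
  have h2 := Finset.card_union_le ((Hhat χ VR i).filter (fun e => u ∈ e ∧ v ∈ e) ∪
      (Finset.univ.erase i).biUnion (fun j => (Hhat χ VR j).filter (fun e => u ∈ e ∧ v ∈ e)))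
      ((BlankSet χ VR).filter (fun e => u ∈ e ∧ v ∈ e))
  have h3 := Finset.card_union_le ((Hhat χ VR i).filter (fun e => u ∈ e ∧ v ∈ e))
      ((Finset.univ.erase i).biUnion (fun j => (Hhat χ VR j).filter (fun e => u ∈ e ∧ v ∈ e)))
  have h4 : ((Finset.univ.erase i).biUnion
      (fun j => (Hhat χ VR j).filter (fun e => u ∈ e ∧ v ∈ e))).card ≤ n - 1 := by
    refine (Finset.card_biUnion_le_card_mul _ _ 1 ?_).trans ?_
    · intro j hj; exact h j (Finset.ne_of_mem_erase hj)
    · simp [Finset.card_erase_of_mem]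
  omega

lemma card_colorClass_le {n N : ℕ} (χ : Finset (Fin N) → Fin n)
    (VR VT VS : Fin n → Finset (Fin N)) (i : Fin n)
    (hU : VR i ∪ VT i ∪ VS i = Finset.univ) :
    (colorClass χ i).card ≤
      (HRpart χ VR i).card + (HTpart χ VT i).card + (HSpart χ VR VS i).card := by
  have hsub : colorClass χ i ⊆ (HRpart χ VR i ∪ HTpart χ VT i) ∪ HSpart χ VR VS i := by
    intro e he
    simp only [Finset.mem_union, HRpart, HTpart, HSpart, Finset.mem_filter, he, true_and]
    by_cases h1 : (e ∩ VR i).Nonempty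
    · exact Or.inl (Or.inl h1)
    · rw [Finset.not_nonempty_iff_eq_empty] at h1
      by_cases h2 : (e ∩ VS i).Nonempty
      · exact Or.inr ⟨h1, h2⟩
      · left; right
        rw [Finset.not_nonempty_iff_eq_empty] at h2
        intro x hx
        have hxU : x ∈ VR i ∪ VT i ∪ VS i := by rw [hU]; simp
        simp only [Finset.mem_union] at hxU
        rcases hxU with (h | h) | h
        · exact absurd (Finset.mem_inter.mpr ⟨hx, h⟩) (by rw [h1]; simp)
        · exact h
        · exact absurd (Finset.mem_inter.mpr ⟨hx, h⟩) (by rw [h2]; simp)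
  have h1 := Finset.card_le_card hsub
  have h2 := Finset.card_union_le (HRpart χ VR i ∪ HTpart χ VT i) (HSpart χ VR VS i)
  have h3 := Finset.card_union_le (HRpart χ VR i) (HTpart χ VT i)
  omega

/-- Leaves of the star with center `u`. -/
def starLeaves {V : Type*} [DecidableEq V] (H : Finset (Finset V)) (c : Finset V → V)
    (S : Finset V) (u : V) : Finset V :=
  S.filter (fun x => ∃ e ∈ H, c e = u ∧ x ∈ e)

lemma stars_split {V : Type*} [DecidableEq V] (H : Finset (Finset V)) (C S : Finset V)
    (c : Finset V → V) (h3 : ∀ e ∈ H, e.card = 3)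
    (hc : ∀ e ∈ H, c e ∈ e ∧ c e ∈ C ∧ ∀ x ∈ e, x ≠ c e → x ∈ S)
    (hd : ∀ e ∈ H, ∀ f ∈ H, c e ≠ c f → Disjoint e f) (u : V) :
    H.card ≤ (starLeaves H c S u).card.choose 2 + (S \ starLeaves H c S u).card.choose 2 := by
  have hcard : ∀ e ∈ H, (e.erase (c e)).card = 2 := by
    intro e he
    rw [Finset.card_erase_of_mem (hc e he).1, h3 e he]
  rw [← Finset.card_powersetCard, ← Finset.card_powersetCard]
  refine le_trans ?_ (Finset.card_union_le _ _)
  apply Finset.card_le_card_of_injOn (fun e => e.erase (c e))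
  · intro e he
    have he : e ∈ H := he
    simp only [Finset.coe_union, Set.mem_union, Finset.mem_coe, Finset.mem_powersetCard,
      hcard e he, and_true]
    by_cases hu : c e = u
    · left
      intro x hx
      have hx' := Finset.mem_erase.mp hx
      exact Finset.mem_filter.mpr ⟨(hc e he).2.2 x hx'.2 hx'.1, e, he, hu, hx'.2⟩
    · right
      intro x hx
      have hx' := Finset.mem_erase.mp hx
      refine Finset.mem_sdiff.mpr ⟨(hc e he).2.2 x hx'.2 hx'.1, ?_⟩
      intro hxL
      obtain ⟨_, f, hf, hfu, hxf⟩ := Finset.mem_filter.mp hxL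
      have := hd e he f hf (by rw [hfu]; exact hu)
      exact Finset.disjoint_left.mp this hx'.2 hxf
  · intro e he f hf hef
    have he : e ∈ H := he
    have hf : f ∈ H := hf
    have hef : e.erase (c e) = f.erase (c f) := hef
    have hne : (e.erase (c e)).Nonempty := by
      rw [← Finset.card_pos, hcard e he]; norm_num
    obtain ⟨x, hx⟩ := hne
    have hxe := (Finset.mem_erase.mp hx).2
    rw [hef] at hx
    have hxf := (Finset.mem_erase.mp hx).2
    have hcc : c e = c f := by
      by_contra hne
      exact Finset.disjoint_left.mp (hd e he f hf hne) hxe hxf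
    rw [← Finset.insert_erase (hc e he).1, ← Finset.insert_erase (hc f hf).1, hef, hcc]

lemma leaves_disj {V : Type*} [DecidableEq V] (H : Finset (Finset V)) (S : Finset V)
    (c : Finset V → V)
    (hd : ∀ e ∈ H, ∀ f ∈ H, c e ≠ c f → Disjoint e f) (u u' : V) (huu : u ≠ u') :
    starLeaves H c S u' ⊆ S \ starLeaves H c S u := by
  intro x hx
  obtain ⟨hxS, f, hf, hfu, hxf⟩ := Finset.mem_filter.mp hx
  refine Finset.mem_sdiff.mpr ⟨hxS, ?_⟩
  intro hxL
  obtain ⟨_, e, he, heu, hxe⟩ := Finset.mem_filter.mp hxL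
  exact Finset.disjoint_left.mp (hd e he f hf (by rw [heu, hfu]; exact huu)) hxe hxf

lemma arith_T (M P R T S : ℝ) (hM : 40 ≤ M) (hP : M + 30 ≤ P) (hsum : R + T + S = M + P)
    (hR : 0 ≤ R) (hS : 0 ≤ S) (hT : M + 1 ≤ T) :
    6 * R + T ^ 2 / 8 + S * (S - 1) / 2 < (P - 1) * (P - 1 - 1) / 2 + M * (M - 1) / 2 := by
  obtain ⟨τ, hτ⟩ : ∃ τ, τ = T - M - 1 := ⟨_, rfl⟩
  have hT' : T = M + 1 + τ := by linarith
  have hτ0 : 0 ≤ τ := by linarith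
  have hS' : S = P - 1 - (τ + R) := by linarith
  have hy : τ + R ≤ P - 1 := by linarith
  subst hT' hS'
  have h1 : (τ + R) * (P - 1 - (τ + R)) ≥ 0 := mul_nonneg (by linarith) (by linarith)
  have h2 : τ * (P - 1 - τ) ≥ 0 := mul_nonneg hτ0 (by linarith)
  have h3 : τ * (P - 30 - M) ≥ 0 := mul_nonneg hτ0 (by linarith)
  have h3' : τ * (P - 30) ≥ 0 := mul_nonneg hτ0 (by linarith)
  have h4 : R * (P - 70) ≥ 0 := mul_nonneg hR (by linarith)
  have h5 : M * (M - 40) ≥ 0 := mul_nonneg (by linarith) (by linarith)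
  nlinarith

lemma arith_S (M P R T a b : ℝ) (hM : 40 ≤ M) (hsum : R + T + (a + b) = M + P)
    (hR : 0 ≤ R) (hT : 2 ≤ T) (ha : M ≤ a) (hb : M ≤ b) :
    6 * R + T ^ 2 / 8 + (a * (a - 1) / 2 + b * (b - 1) / 2)
      < (P - 1) * (P - 1 - 1) / 2 + M * (M - 1) / 2 := by
  obtain ⟨τ, hτ⟩ : ∃ τ, T = 2 + τ := ⟨T - 2, by ring⟩
  obtain ⟨α, hα⟩ : ∃ α, a = M + α := ⟨a - M, by ring⟩
  obtain ⟨β, hβ⟩ : ∃ β, b = M + β := ⟨b - M, by ring⟩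
  have hP : P = M + 2 + τ + α + β + R := by linarith
  have hτ0 : 0 ≤ τ := by linarith
  have hα0 : 0 ≤ α := by linarith
  have hβ0 : 0 ≤ β := by linarith
  subst hτ hα hβ hP
  have h1 := mul_nonneg hα0 hβ0
  have h2 := mul_nonneg hα0 hτ0
  have h3 := mul_nonneg hα0 hR
  have h4 := mul_nonneg hβ0 hτ0
  have h5 := mul_nonneg hβ0 hR
  have h6 := mul_nonneg hτ0 hR
  have h7 := mul_nonneg hR (sub_nonneg.mpr hM)
  have h8 := mul_nonneg hτ0 (sub_nonneg.mpr hM)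
  nlinarith [sq_nonneg τ, sq_nonneg R]

/-- Pairwise disjoint families of pairs, each through its own vertex. -/
lemma count_pairs {n N : ℕ} (I : Finset (Fin n)) (hIN : I.card ≤ N)
    (E : Fin n → Finset (Sym2 (Fin N))) (c : Fin n → Fin N)
    (hdiag : ∀ i ∈ I, ∀ p ∈ E i, ¬ p.IsDiag)
    (hdisj : ∀ i ∈ I, ∀ j ∈ I, i ≠ j → Disjoint (E i) (E j))
    (hc : ∀ i ∈ I, ∀ p ∈ E i, c i ∈ p) :
    ∑ i ∈ I, ((E i).card : ℝ) ≤ realChoose2 (I.card : ℝ) + (I.card : ℝ) * ((N : ℝ) - I.card) := by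
  classical
  have h1 : (I.biUnion E).card = ∑ i ∈ I, (E i).card :=
    Finset.card_biUnion (fun i hi j hj hij => hdisj i hi j hj hij)
  have h2 : Disjoint (I.biUnion E) ((I.image c)ᶜ.offDiag.image Sym2.mk.uncurry) := by
    rw [Finset.disjoint_left]
    intro p hp hp'
    obtain ⟨i, hi, hpi⟩ := Finset.mem_biUnion.mp hp
    obtain ⟨⟨x, y⟩, hxy, rfl⟩ := Finset.mem_image.mp hp'
    have hci := hc i hi _ hpi
    rw [Finset.mem_offDiag] at hxy
    have hcI : c i ∈ I.image c := Finset.mem_image_of_mem c hi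
    rcases Sym2.mem_iff.mp hci with h | h
    · have := hxy.1; rw [← h, Finset.mem_compl] at this; exact this hcI
    · have := hxy.2.1; rw [← h, Finset.mem_compl] at this; exact this hcI
  have h3 : I.biUnion E ∪ ((I.image c)ᶜ.offDiag.image Sym2.mk.uncurry) ⊆
      ((Finset.univ : Finset (Fin N)).offDiag.image Sym2.mk.uncurry) := by
    apply Finset.union_subset
    · intro p hp
      obtain ⟨i, hi, hpi⟩ := Finset.mem_biUnion.mp hp
      have hd := hdiag i hi p hpi
      induction p using Sym2.ind with
      | _ x y =>
        refine Finset.mem_image.mpr ⟨(x, y), ?_, rfl⟩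
        simpa using hd
    · exact Finset.image_subset_image (Finset.offDiag_mono (Finset.subset_univ _))
  have h4 := Finset.card_le_card h3
  rw [Finset.card_union_of_disjoint h2, Sym2.card_image_offDiag, Sym2.card_image_offDiag, h1,
    Finset.card_compl, Fintype.card_fin, Finset.card_univ, Fintype.card_fin] at h4
  have h5 : N - I.card ≤ N - (I.image c).card := Nat.sub_le_sub_left Finset.card_image_le N
  have h6 := Nat.choose_le_choose 2 h5
  have h7 : ∑ i ∈ I, (E i).card + (N - I.card).choose 2 ≤ N.choose 2 := by omega
  have h8 : ((∑ i ∈ I, (E i).card : ℕ) : ℝ) + ((N - I.card).choose 2 : ℕ) ≤ (N.choose 2 : ℕ) := by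
    exact_mod_cast h7
  rw [Nat.cast_choose_two, Nat.cast_choose_two, Nat.cast_sub hIN] at h8
  push_cast at h8
  unfold realChoose2
  nlinarith

/-- A pair of large degree in `Ĥ_i` with `i` rich contains the center of a large star. -/
lemma pair_has_center {n N : ℕ} (χ : Finset (Fin N) → Fin n)
    (VR VT VS : Fin n → Finset (Fin N)) (i : Fin n) (M : ℝ) (hM : 40 ≤ M)
    (hdTS : Disjoint (VT i) (VS i)) (hU : VR i ∪ VT i ∪ VS i = Finset.univ)
    (c : Finset (Fin N) → Fin N)
    (hc : ∀ e ∈ HSpart χ VR VS i, c e ∈ e ∧ c e ∈ VT i ∧ ∀ x ∈ e, x ≠ c e → x ∈ VS i)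
    (hd : ∀ e ∈ HSpart χ VR VS i, ∀ f ∈ HSpart χ VR VS i, c e ≠ c f → Disjoint e f)
    (u v : Fin N) (huv : u ≠ v)
    (hdeg : M - 1 < (((Hhat χ VR i).filter (fun e => u ∈ e ∧ v ∈ e)).card : ℝ))
    (hTsmall : ((VT i).card : ℝ) ≤ M + 1) :
    ∃ w, (w = u ∨ w = v) ∧ w ∈ VT i ∧
      M < ((starLeaves (HSpart χ VR VS i) c (VS i) w).card : ℝ) := by
  set D := (Hhat χ VR i).filter (fun e => u ∈ e ∧ v ∈ e) with hD
  have hDe : ∀ e ∈ D, e ∈ colorClass χ i ∧ e.card = 3 ∧ e ∩ VR i = ∅ ∧ u ∈ e ∧ v ∈ e := by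
    intro e he
    simp only [hD, Finset.mem_filter, Hhat] at he
    refine ⟨he.1.1, ?_, he.1.2, he.2.1, he.2.2⟩
    have := he.1.1
    simp only [colorClass, Finset.mem_filter] at this
    exact this.2.1
  have hD3 : ∀ e ∈ D, e.card = 3 ∧ u ∈ e ∧ v ∈ e := fun e he =>
    ⟨(hDe e he).2.1, (hDe e he).2.2.2⟩
  have hmem : ∀ e ∈ D, ∀ x ∈ e, x ∈ VT i ∨ x ∈ VS i := by
    intro e he x hx
    have hxU : x ∈ VR i ∪ VT i ∪ VS i := by rw [hU]; simp
    simp only [Finset.mem_union] at hxU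
    rcases hxU with (h | h) | h
    · exact absurd (Finset.mem_inter.mpr ⟨hx, h⟩) (by rw [(hDe e he).2.2.1]; simp)
    · exact Or.inl h
    · exact Or.inr h
  have hHS : ∀ e ∈ D, ∀ x ∈ e, x ∈ VS i → e ∈ HSpart χ VR VS i := by
    intro e he x hx hxS
    exact Finset.mem_filter.mpr ⟨(hDe e he).1, (hDe e he).2.2.1, x, Finset.mem_inter.mpr ⟨hx, hxS⟩⟩
  have hTS : ∀ x, x ∈ VT i → x ∉ VS i := fun x hx => Finset.disjoint_left.mp hdTS hx
  have hne : D.Nonempty := by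
    rw [← Finset.card_pos]
    have : (0 : ℝ) < D.card := by linarith
    exact_mod_cast this
  -- the one-sided case
  have key : ∀ a b : Fin N, a ≠ b → (∀ e ∈ D, a ∈ e ∧ b ∈ e) → a ∈ VT i → b ∈ VS i →
      M < ((starLeaves (HSpart χ VR VS i) c (VS i) a).card : ℝ) := by
    intro a b hab hDab haT hbS
    have hce : ∀ e ∈ D, c e = a := by
      intro e he
      by_contra hne'
      have heS := hHS e he b (hDab e he).2 hbS
      exact hTS a haT ((hc e heS).2.2 a (hDab e he).1 (fun h => hne' h.symm))
    have hle : D.card ≤ ((starLeaves (HSpart χ VR VS i) c (VS i) a).erase b).card := by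
      apply card_third D a b hab _ (fun e he => ⟨(hD3 e he).1, hDab e he⟩)
      intro e he x hx hxa hxb
      have heS := hHS e he b (hDab e he).2 hbS
      refine Finset.mem_erase.mpr ⟨hxb, Finset.mem_filter.mpr ⟨?_, e, heS, hce e he, hx⟩⟩
      exact (hc e heS).2.2 x hx (by rw [hce e he]; exact hxa)
    obtain ⟨e, he⟩ := hne
    have hbL : b ∈ starLeaves (HSpart χ VR VS i) c (VS i) a :=
      Finset.mem_filter.mpr ⟨hbS, e, hHS e he b (hDab e he).2 hbS, hce e he, (hDab e he).2⟩
    have hcard := Finset.card_erase_add_one hbL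
    have : D.card + 1 ≤ (starLeaves (HSpart χ VR VS i) c (VS i) a).card := by omega
    have : (D.card : ℝ) + 1 ≤ (starLeaves (HSpart χ VR VS i) c (VS i) a).card := by
      exact_mod_cast this
    linarith
  obtain ⟨e0, he0⟩ := id hne
  rcases hmem e0 he0 u (hD3 e0 he0).2.1 with hu | hu <;>
    rcases hmem e0 he0 v (hD3 e0 he0).2.2 with hv | hv
  · exfalso
    have hle : D.card ≤ (((VT i).erase u).erase v).card := by
      apply card_third D u v huv _ hD3
      intro e he x hx hxu hxv
      refine Finset.mem_erase.mpr ⟨hxv, Finset.mem_erase.mpr ⟨hxu, ?_⟩⟩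
      rcases hmem e he x hx with h | h
      · exact h
      · exfalso
        have heS := hHS e he x hx h
        have hcu : c e = u := by
          by_contra h'
          exact hTS u hu ((hc e heS).2.2 u (hD3 e he).2.1 (fun h => h' h.symm))
        exact hTS v hv ((hc e heS).2.2 v (hD3 e he).2.2 (by rw [hcu]; exact huv.symm))
    have h1 := Finset.card_erase_add_one hu
    have h2 : (((VT i).erase u).erase v).card + 1 = ((VT i).erase u).card :=
      Finset.card_erase_add_one (Finset.mem_erase.mpr ⟨huv.symm, hv⟩)
    have h3 : D.card + 2 ≤ (VT i).card := by omega
    have h4 : (D.card : ℝ) + 2 ≤ (VT i).card := by exact_mod_cast h3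
    linarith
  · exact ⟨u, Or.inl rfl, hu, key u v huv (fun e he => (hD3 e he).2) hu hv⟩
  · exact ⟨v, Or.inr rfl, hv, key v u huv.symm
      (fun e he => ⟨(hD3 e he).2.2, (hD3 e he).2.1⟩) hv hu⟩
  · exfalso
    have hle : D.card ≤ ({c e0} : Finset (Fin N)).card := by
      apply card_third D u v huv _ hD3
      intro e he x hx hxu hxv
      have heS := hHS e he u (hD3 e he).2.1 hu
      have he0S := hHS e0 he0 u (hD3 e0 he0).2.1 hu
      have hcc : c e = c e0 := by
        by_contra h'
        exact Finset.disjoint_left.mp (hd e heS e0 he0S h') (hD3 e he).2.1 (hD3 e0 he0).2.1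
      by_contra hxc
      rw [Finset.mem_singleton, ← hcc] at hxc
      -- four distinct vertices in a triple
      have hcT := (hc e heS).2.1
      have hcu : c e ≠ u := fun h => hTS _ hcT (h ▸ hu)
      have hcv : c e ≠ v := fun h => hTS _ hcT (h ▸ hv)
      have hsub : ({x, c e, u, v} : Finset (Fin N)) ⊆ e := by
        intro y hy
        simp only [Finset.mem_insert, Finset.mem_singleton] at hy
        rcases hy with rfl | rfl | rfl | rfl
        · exact hx
        · exact (hc e heS).1
        · exact (hD3 e he).2.1
        · exact (hD3 e he).2.2
      have h4 : ({x, c e, u, v} : Finset (Fin N)).card = 4 := by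
        rw [Finset.card_insert_of_notMem (by simp [hxc, hxu, hxv]),
          Finset.card_insert_of_notMem (by simp [hcu, hcv]), Finset.card_pair huv]
      have := Finset.card_le_card hsub
      rw [h4, (hD3 e he).1] at this
      omega
    rw [Finset.card_singleton] at hle
    have : (D.card : ℝ) ≤ 1 := by exact_mod_cast hle
    linarith

open scoped Classical in
theorem sum_private_edges_bound (n N : ℕ) (hn : 41 ≤ n) (γ : ℝ)
    (hγ : γ = ((N : ℝ) - 7 * Real.sqrt n) / n) (hγ1 : 1.9 < γ) (hγ2 : γ < 2)
    (χ : Finset (Fin N) → Fin n)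
    (hfree : ∀ i : Fin n, ¬ HasLoosePath (colorClass χ i))
    (VR VT VS : Fin n → Finset (Fin N))
    (hpart : ∀ i, Disjoint (VR i) (VT i) ∧ Disjoint (VR i) (VS i) ∧ Disjoint (VT i) (VS i) ∧
      VR i ∪ VT i ∪ VS i = Finset.univ)
    (hR : ∀ i, (HRpart χ VR i).card ≤ 6 * (VR i).card)
    (hTqb : ∀ i, QuasiBipartite (VT i) (HTpart χ VT i))
    (hTcard : ∀ i, ((HTpart χ VT i).card : ℝ) ≤ ((VT i).card : ℝ) ^ 2 / 8)
    (hSstars : ∀ i, DisjointStars (HSpart χ VR VS i) (VT i) (VS i))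
    (hScard : ∀ i, (HSpart χ VR VS i).card ≤ ((VS i).card.choose 2))
    (G : Fin n → SimpleGraph (Fin N))
    (hG : ∀ i u v, (G i).Adj u v ↔ u ≠ v ∧
      2 ≤ ((Hhat χ VR i).filter (fun e => u ∈ e ∧ v ∈ e)).card ∧
      ((((BlankSet χ VR).filter (fun e => u ∈ e ∧ v ∈ e)).card : ℝ) < 6 * Real.sqrt n)) :
    ∑ i ∈ Finset.univ.filter (fun i : Fin n => Rich n N χ i), ((privE G i).card : ℝ)
      ≤ realChoose2 (((Finset.univ.filter (fun i : Fin n => Rich n N χ i)).card : ℝ))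
        + ((Finset.univ.filter (fun i : Fin n => Rich n N χ i)).card : ℝ) *
          ((N : ℝ) - ((Finset.univ.filter (fun i : Fin n => Rich n N χ i)).card : ℝ)) := by
  classical
  set M : ℝ := (N : ℝ) - n - 6 * Real.sqrt n with hMdef
  set P : ℝ := (n : ℝ) + 6 * Real.sqrt n with hPdef
  have hnR : (41 : ℝ) ≤ n := by exact_mod_cast hn
  have hn0 : (0 : ℝ) < n := by linarith
  have hsq : 6 ≤ Real.sqrt n := by
    apply Real.le_sqrt_of_sq_le; norm_num; linarith
  have hNeq : (N : ℝ) = γ * n + 7 * Real.sqrt n := by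
    rw [hγ]; field_simp; ring
  have hN1 : 1.9 * (n : ℝ) < γ * n := mul_lt_mul_of_pos_right hγ1 hn0
  have hN2 : γ * (n : ℝ) < 2 * n := mul_lt_mul_of_pos_right hγ2 hn0
  have hM40 : 40 ≤ M := by rw [hMdef, hNeq]; norm_num at hN1; linarith
  have hMP : M + 30 ≤ P := by rw [hMdef, hPdef, hNeq]; linarith
  have hMPN : M + P = N := by rw [hMdef, hPdef]; ring
  have hnN : n ≤ N := by
    have : (n : ℝ) ≤ N := by linarith
    exact_mod_cast this
  have hadj : ∀ i, ∀ p, p ∈ privE G i ↔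
      (p ∈ (G i).edgeSet ∧ ∀ j, j ≠ i → p ∉ (G j).edgeSet) := by
    intro i p
    simp [privE, edgeF]
  have hcenter : ∀ i, Rich n N χ i → ∃ w : Fin N, ∀ p ∈ privE G i, w ∈ p := by
    intro i hi
    obtain ⟨hRT, hRS, hTS, hU⟩ := hpart i
    obtain ⟨c, hc, hd⟩ := hSstars i
    have hsumN : (VR i).card + (VT i).card + (VS i).card = N := by
      rw [← Finset.card_union_of_disjoint hRT, ← Finset.card_union_of_disjoint
        (Finset.disjoint_union_left.mpr ⟨hRS, hTS⟩), hU, Finset.card_univ, Fintype.card_fin]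
    have hsumR : ((VR i).card : ℝ) + (VT i).card + (VS i).card = M + P := by
      rw [hMPN]; exact_mod_cast hsumN
    have hcc : ((colorClass χ i).card : ℝ) ≤
        (HRpart χ VR i).card + (HTpart χ VT i).card + (HSpart χ VR VS i).card := by
      exact_mod_cast card_colorClass_le χ VR VT VS i hU
    have hRi : ((HRpart χ VR i).card : ℝ) ≤ 6 * (VR i).card := by exact_mod_cast hR i
    have hTi := hTcard i
    unfold Rich realChoose2 at hi
    have hR0 : (0 : ℝ) ≤ (VR i).card := Nat.cast_nonneg _
    have hTsmall : ((VT i).card : ℝ) ≤ M + 1 := by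
      by_contra hcon
      push Not at hcon
      have hSi : ((HSpart χ VR VS i).card : ℝ) ≤ ((VS i).card.choose 2 : ℕ) := by
        exact_mod_cast hScard i
      rw [Nat.cast_choose_two] at hSi
      have := arith_T M P _ _ _ hM40 hMP hsumR hR0 (Nat.cast_nonneg _) hcon.le
      linarith
    have hex : ∀ p ∈ privE G i, ∃ w ∈ p, w ∈ VT i ∧
        M < ((starLeaves (HSpart χ VR VS i) c (VS i) w).card : ℝ) := by
      intro p hp
      rw [hadj] at hp
      induction p using Sym2.ind with
      | _ u v =>
        obtain ⟨hpi, hpj⟩ := hp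
        rw [SimpleGraph.mem_edgeSet, hG] at hpi
        obtain ⟨huv, h2, hb⟩ := hpi
        have hle : ∀ j, j ≠ i → ((Hhat χ VR j).filter (fun e => u ∈ e ∧ v ∈ e)).card ≤ 1 := by
          intro j hj
          have hj' := hpj j hj
          rw [SimpleGraph.mem_edgeSet, hG] at hj'
          by_contra hcon
          push Not at hcon
          apply hj'
          refine ⟨huv, ?_, hb⟩
          exact hcon
        have hdc := degree_count χ VR i u v huv hle
        have hdcR : (N : ℝ) ≤ (((Hhat χ VR i).filter (fun e => u ∈ e ∧ v ∈ e)).card : ℝ) +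
            ((n : ℝ) - 1) + (((BlankSet χ VR).filter (fun e => u ∈ e ∧ v ∈ e)).card : ℝ) + 2 := by
          have h1 : (((n - 1 : ℕ)) : ℝ) = (n : ℝ) - 1 := by
            rw [Nat.cast_sub (by omega)]; simp
          rw [← h1]
          exact_mod_cast hdc
        have hb' : (((BlankSet χ VR).filter (fun e => u ∈ e ∧ v ∈ e)).card : ℝ)
            < 6 * Real.sqrt n := by
          convert hb using 1
        have hdeg : M - 1 < (((Hhat χ VR i).filter (fun e => u ∈ e ∧ v ∈ e)).card : ℝ) := by
          rw [hMdef]; linarith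
        obtain ⟨w, hw, hw2⟩ := pair_has_center χ VR VT VS i M hM40 hTS hU c hc hd u v huv
          hdeg hTsmall
        exact ⟨w, Sym2.mem_iff.mpr hw, hw2⟩
    have huniq : ∀ w w' : Fin N, w ∈ VT i → w' ∈ VT i →
        M < ((starLeaves (HSpart χ VR VS i) c (VS i) w).card : ℝ) →
        M < ((starLeaves (HSpart χ VR VS i) c (VS i) w').card : ℝ) → w = w' := by
      intro w w' hw hw' hL hL'
      by_contra hne
      have h3 : ∀ e ∈ HSpart χ VR VS i, e.card = 3 := by
        intro e he
        simp only [HSpart, colorClass, Finset.mem_filter] at he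
        exact he.1.2.1
      have hsp := stars_split _ _ _ c h3 hc hd w
      have hsub := Finset.card_le_card (leaves_disj _ (VS i) c hd w w' hne)
      have hadd := Finset.card_sdiff_add_card_eq_card
        (Finset.filter_subset _ _ : starLeaves (HSpart χ VR VS i) c (VS i) w ⊆ VS i)
      have hspR : ((HSpart χ VR VS i).card : ℝ) ≤
          ((starLeaves (HSpart χ VR VS i) c (VS i) w).card.choose 2 : ℕ) +
          ((VS i \ starLeaves (HSpart χ VR VS i) c (VS i) w).card.choose 2 : ℕ) := by
        exact_mod_cast hsp
      rw [Nat.cast_choose_two, Nat.cast_choose_two] at hspR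
      have hsubR : ((starLeaves (HSpart χ VR VS i) c (VS i) w').card : ℝ) ≤
          (VS i \ starLeaves (HSpart χ VR VS i) c (VS i) w).card := by exact_mod_cast hsub
      have haddR : ((VS i \ starLeaves (HSpart χ VR VS i) c (VS i) w).card : ℝ) +
          (starLeaves (HSpart χ VR VS i) c (VS i) w).card = (VS i).card := by
        exact_mod_cast hadd
      have hT2 : 2 ≤ (VT i).card := by
        rw [← Finset.card_pair hne]
        apply Finset.card_le_card
        intro x hx
        simp only [Finset.mem_insert, Finset.mem_singleton] at hx
        rcases hx with rfl | rfl <;> assumption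
      have hT2R : (2 : ℝ) ≤ (VT i).card := by exact_mod_cast hT2
      have := arith_S M P _ _ _ _ hM40 (by rw [← hsumR, ← haddR]; ring) hR0 hT2R hL.le
        (hL'.le.trans hsubR)
      linarith
    by_cases hemp : (privE G i).Nonempty
    · obtain ⟨p0, hp0⟩ := hemp
      obtain ⟨w, _, hwT, hwL⟩ := hex p0 hp0
      refine ⟨w, fun p hp => ?_⟩
      obtain ⟨w', hw'p, hw'T, hw'L⟩ := hex p hp
      rw [huniq w w' hwT hw'T hwL hw'L]
      exact hw'p
    · rw [Finset.not_nonempty_iff_eq_empty] at hemp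
      exact ⟨⟨0, by omega⟩, by rw [hemp]; simp⟩
  have hchoose : ∀ i, ∃ w : Fin N, Rich n N χ i → ∀ p ∈ privE G i, w ∈ p := by
    intro i
    by_cases hi : Rich n N χ i
    · obtain ⟨w, hw⟩ := hcenter i hi
      exact ⟨w, fun _ => hw⟩
    · exact ⟨⟨0, by omega⟩, fun h => absurd h hi⟩
  choose c hc using hchoose
  refine count_pairs _ ?_ (privE G) c ?_ ?_ ?_
  · refine (Finset.card_le_univ _).trans ?_
    rw [Fintype.card_fin]; exact hnN
  · intro i _ p hp
    rw [hadj] at hp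
    exact SimpleGraph.not_isDiag_of_mem_edgeSet _ hp.1
  · intro i _ j _ hij
    rw [Finset.disjoint_left]
    intro p hp hp'
    rw [hadj] at hp hp'
    exact hp.2 j hij.symm hp'.1
  · intro i hi p hp
    exact hc i (Finset.mem_filter.mp hi).2 p hp
end
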